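/- If f and g are homeomorphisms of the torus T = (ℝ/ℤ) × (ℝ/ℤ) that are homotopic as continuous maps, then f is isotopic to g: there exists a continuous map F : [0,1] × T → T such that F(0,·) = f, F(1,·) = g, and F(t,·) : T → T is a homeomorphism for every t ∈ [0,1]. -/

import Mathlib

namespace TorusIso

open Filter Topology Set

abbrev E2 := ℝ × ℝ

def lat (n : ℤ × ℤ) : E2 := ((n.1 : ℝ), (n.2 : ℝ))

lemma lat_zero : lat 0 = 0 := by simp [lat]

lemma lat_add (m n : ℤ × ℤ) : lat (m + n) = lat m + lat n := by simp [lat]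

lemma lat_neg (n : ℤ × ℤ) : lat (-n) = - lat n := by simp [lat]

lemma lat_sub (m n : ℤ × ℤ) : lat (m - n) = lat m - lat n := by simp [lat]

lemma lat_inj {m n : ℤ × ℤ} (h : lat m = lat n) : m = n := by
  simp only [lat, Prod.mk.injEq, Int.cast_inj] at h
  exact Prod.ext h.1 h.2

/-- commutes with integer translations -/
def Equi (F : E2 → E2) : Prop := ∀ z n, F (z + lat n) = F z + lat n

lemma Equi.comp {F G : E2 → E2} (hF : Equi F) (hG : Equi G) : Equi (fun z => F (G z)) := by
  intro z n
  simp only [hG z n, hF _ n]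

lemma Equi.symm {F : E2 ≃ₜ E2} (hF : Equi F) : Equi F.symm := by
  intro z n
  apply F.injective
  rw [F.apply_symm_apply, hF, F.apply_symm_apply]

lemma dist_lat_ge {m n : ℤ × ℤ} (h : m ≠ n) : 1 ≤ ‖lat m - lat n‖ := by
  by_contra! hc
  apply h
  rw [← lat_sub] at hc
  have h1 : ‖lat (m - n)‖ = max |((m.1 - n.1 : ℤ) : ℝ)| |((m.2 - n.2 : ℤ) : ℝ)| := by
    simp [lat, Prod.norm_def]
  rw [h1, max_lt_iff] at hc
  obtain ⟨h2, h3⟩ := hc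
  have h2' : |m.1 - n.1| < 1 := by exact_mod_cast h2
  have h3' : |m.2 - n.2| < 1 := by exact_mod_cast h3
  rw [Int.abs_lt_one_iff] at h2' h3'
  ext <;> omega

noncomputable def rnd (z : E2) : ℤ × ℤ := (round z.1, round z.2)

lemma norm_sub_rnd (z : E2) : ‖z - lat (rnd z)‖ ≤ 1 / 2 := by
  rw [Prod.norm_def]
  simp only [lat, rnd, Prod.fst_sub, Prod.snd_sub, Real.norm_eq_abs]
  exact max_le (abs_sub_round _) (abs_sub_round _)

lemma Equi.exists_bound {F : E2 → E2} (hc : Continuous F) (hF : Equi F) :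
    ∃ C, ∀ z, ‖F z - z‖ ≤ C := by
  have hcpt : IsCompact (Metric.closedBall (0 : E2) (1/2)) := isCompact_closedBall _ _
  obtain ⟨C, hC⟩ := hcpt.exists_bound_of_continuousOn
    (f := fun z => F z - z) (by fun_prop)
  refine ⟨C, fun z => ?_⟩
  have h1 := hC (z - lat (rnd z)) (by simpa using norm_sub_rnd z)
  have h2 := hF (z - lat (rnd z)) (rnd z)
  rw [sub_add_cancel] at h2
  rw [h2, show F (z - lat (rnd z)) + lat (rnd z) - z = F (z - lat (rnd z)) - (z - lat (rnd z)) by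
    abel]
  exact h1

lemma isHomeo_of_bdd {F : E2 → E2} (hc : Continuous F) (hb : Function.Bijective F) {C : ℝ}
    (hC : ∀ z, ‖F z - z‖ ≤ C) : IsHomeomorph F := by
  rw [isHomeomorph_iff_continuous_isClosedMap_bijective]
  refine ⟨hc, ?_, hb⟩
  apply IsProperMap.isClosedMap
  rw [isProperMap_iff_tendsto_cocompact]
  refine ⟨hc, ?_⟩
  rw [← Metric.cobounded_eq_cocompact, ← tendsto_norm_atTop_iff_cobounded]
  have : Tendsto (fun z : E2 => ‖z‖ - C) (Bornology.cobounded E2) atTop :=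
    tendsto_atTop_add_const_right _ _ tendsto_norm_cobounded_atTop
  refine tendsto_atTop_mono (fun z => ?_) this
  have := norm_sub_norm_le z (F z)
  have h2 := hC z
  rw [norm_sub_rev] at h2
  linarith

noncomputable def mkHomeo (F : E2 → E2) (hc : Continuous F) (hb : Function.Bijective F) (C : ℝ)
    (hC : ∀ z, ‖F z - z‖ ≤ C) : E2 ≃ₜ E2 := (isHomeo_of_bdd hc hb hC).homeomorph

@[simp] lemma mkHomeo_apply (F : E2 → E2) (hc : Continuous F) (hb : Function.Bijective F) (C : ℝ)
    (hC : ∀ z, ‖F z - z‖ ≤ C) (z : E2) : mkHomeo F hc hb C hC z = F z := rfl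

/-- isotopic to the identity through equivariant bijections -/
def Triv (F : E2 → E2) : Prop :=
  ∃ Φ : ℝ × E2 → E2, Continuous Φ ∧ (∀ z, Φ (0, z) = z) ∧ (∀ z, Φ (1, z) = F z) ∧
    (∀ t, Function.Bijective (fun z => Φ (t, z))) ∧ (∀ t, Equi (fun z => Φ (t, z)))

lemma Triv.comp {F G : E2 → E2} (hF : Triv F) (hG : Triv G) : Triv (fun z => F (G z)) := by
  obtain ⟨Φ, h1, h2, h3, h4, h5⟩ := hF
  obtain ⟨Ψ, k1, k2, k3, k4, k5⟩ := hG
  refine ⟨fun p => Φ (p.1, Ψ p), by fun_prop, by simp [h2, k2], by simp [h3, k3], ?_, ?_⟩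
  · intro t
    exact (h4 t).comp (k4 t)
  · intro t
    exact (h5 t).comp (k5 t)

lemma Triv.symm {F : E2 ≃ₜ E2} (hF : Triv F) : Triv F.symm := by
  obtain ⟨Φ, h1, h2, h3, h4, h5⟩ := hF
  have hE : Equi F := by
    have := h5 1
    simp only [h3] at this
    exact this
  refine ⟨fun p => Φ (1 - p.1, F.symm p.2), by fun_prop, ?_, ?_, ?_, ?_⟩
  · simp [h3]
  · simp [h2]
  · intro t
    exact (h4 (1 - t)).comp F.symm.bijective
  · intro t
    exact (h5 (1 - t)).comp hE.symm

lemma Triv.congr {F G : E2 → E2} (hF : Triv F) (h : ∀ z, F z = G z) : Triv G := by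
  have : F = G := funext h
  rwa [← this]

lemma triv_id : Triv (fun z => z) :=
  ⟨fun p => p.2, by fun_prop, by simp, by simp, fun _ => Function.bijective_id, fun _ z n => rfl⟩

lemma triv_translate (c : E2) : Triv (fun z => z + c) := by
  refine ⟨fun p => p.2 + p.1 • c, by fun_prop, by simp, by simp, ?_, ?_⟩
  · intro t
    exact (Equiv.addRight (t • c)).bijective
  · intro t z n
    simp only
    abel

/-- if `F` after removing a trivial map on the right is trivial then `F` is trivial -/
lemma Triv.of_comp_symm {F : E2 → E2} {G : E2 ≃ₜ E2} (h : Triv (fun z => F (G.symm z)))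
    (hG : Triv G) : Triv F := by
  refine (h.comp hG).congr ?_
  intro z
  simp

/-! ### conjugation by an isometry-like homeomorphism -/

lemma Triv.conj {F : E2 → E2} (hF : Triv F) (c : E2 ≃ₜ E2) (σ : ℤ × ℤ → ℤ × ℤ)
    (τ : ℤ × ℤ → ℤ × ℤ) (hστ : ∀ n, σ (τ n) = n)
    (hc : ∀ z n, c (z + lat n) = c z + lat (σ n)) : Triv (fun z => c (F (c.symm z))) := by
  obtain ⟨Φ, h1, h2, h3, h4, h5⟩ := hF
  refine ⟨fun p => c (Φ (p.1, c.symm p.2)), by fun_prop, by simp [h2], by simp [h3], ?_, ?_⟩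
  · intro t
    exact c.bijective.comp ((h4 t).comp c.symm.bijective)
  · intro t z n
    have : c.symm (z + lat n) = c.symm z + lat (τ n) := by
      apply c.injective
      rw [hc, c.apply_symm_apply, c.apply_symm_apply, hστ]
    simp only
    rw [this]
    have h := h5 t (c.symm z) (τ n)
    simp only at h
    rw [h, hc, hστ]

lemma Triv.conj_add {F : E2 → E2} (hF : Triv F) (c : E2) : Triv (fun z => F (z - c) + c) := by
  have := hF.conj (Homeomorph.addRight c) id id (fun _ => rfl) (by
    intro z n
    simp only [Homeomorph.coe_addRight, id]
    abel)
  refine this.congr (fun z => ?_)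
  simp only [sub_eq_add_neg]
  rfl

lemma Triv.conj_swap {F : E2 → E2} (hF : Triv F) : Triv (fun z => (F z.swap).swap) := by
  have := hF.conj (Homeomorph.prodComm ℝ ℝ) Prod.swap Prod.swap (fun _ => rfl) (by
    intro z n
    simp [lat])
  exact this.congr (fun z => rfl)

/-! ### periodization -/

/-- periodized displacement -/
noncomputable def perD (D : E2 → E2) (z : E2) : E2 := ∑ᶠ n, D (z - lat n)

/-- periodization -/
noncomputable def Per (h : E2 → E2) (z : E2) : E2 := z + perD (fun w => h w - w) z

def Supp (h : E2 → E2) : Prop := ∀ z, 1 / 2 ≤ ‖z‖ → h z = z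

lemma per_eq {h : E2 → E2} (hs : Supp h) {z : E2} {n : ℤ × ℤ} (hn : ‖z - lat n‖ ≤ 1 / 2) :
    Per h z = h (z - lat n) + lat n := by
  rw [Per, perD, finsum_eq_single _ n]
  · abel
  · intro m hm
    rw [hs, sub_self]
    have h1 := dist_lat_ge hm
    have h2 : ‖lat m - lat n‖ ≤ ‖z - lat n‖ + ‖z - lat m‖ := by
      have := norm_sub_le (z - lat n) (z - lat m)
      rwa [show z - lat n - (z - lat m) = lat m - lat n by abel] at this
    linarith

lemma per_equi {h : E2 → E2} (hs : Supp h) : Equi (Per h) := by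
  intro z n
  have h1 := norm_sub_rnd z
  have h2 : z + lat n - lat (rnd z + n) = z - lat (rnd z) := by
    rw [lat_add]; abel
  rw [per_eq hs h1, per_eq (n := rnd z + n) hs (by rw [h2]; exact h1), h2, lat_add]
  abel

lemma per_fix {h : E2 → E2} {z : E2} (hz : ∀ n, h (z - lat n) = z - lat n) : Per h z = z := by
  rw [Per, perD, finsum_eq_zero_of_forall_eq_zero, add_zero]
  intro n
  rw [hz, sub_self]

lemma Supp.norm_le {h : E2 → E2} (hs : Supp h) (hi : Function.Injective h) {z : E2}
    (hz : ‖z‖ ≤ 1 / 2) : ‖h z‖ ≤ 1 / 2 := by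
  by_contra! hc
  have h1 := hs (h z) hc.le
  have h2 := hi h1
  rw [h2] at hc
  linarith

lemma per_comp {h h' : E2 → E2} (hs : Supp h) (hs' : Supp h') (hi : Function.Injective h')
    (z : E2) : Per h (Per h' z) = Per (fun w => h (h' w)) z := by
  have hss : Supp (fun w => h (h' w)) := by
    intro z hz
    simp only
    rw [hs' z hz, hs z hz]
  have h1 := norm_sub_rnd z
  rw [per_eq hs' h1, per_eq hss h1, per_eq (n := rnd z) hs]
  · simp
  · rw [add_sub_cancel_right]
    exact hs'.norm_le hi h1

lemma supp_symm {h : E2 ≃ E2} (hs : Supp h) : Supp h.symm := by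
  intro z hz
  rw [Equiv.symm_apply_eq, hs z hz]

lemma per_id (z : E2) : Per (fun w => w) z = z := by
  simp [Per, perD]

lemma per_bij {h : E2 → E2} (hs : Supp h) (hb : Function.Bijective h) :
    Function.Bijective (Per h) := by
  set e := Equiv.ofBijective h hb with he
  have hs1 : Supp e := hs
  have hs2 : Supp e.symm := supp_symm hs1
  rw [Function.bijective_iff_has_inverse]
  refine ⟨Per e.symm, fun z => ?_, fun z => ?_⟩
  · have := per_comp hs2 hs1 hb.injective z
    change Per e.symm (Per e z) = z
    rw [this]
    simp only [Equiv.symm_apply_apply]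
    exact per_id z
  · have := per_comp hs1 hs2 e.symm.injective z
    change Per e (Per e.symm z) = z
    rw [this]
    simp only [Equiv.apply_symm_apply]
    exact per_id z

lemma finite_lat_ball (z : E2) (r : ℝ) : {n : ℤ × ℤ | ‖z - lat n‖ ≤ r}.Finite := by
  have : {n : ℤ × ℤ | ‖z - lat n‖ ≤ r} ⊆
      (Set.Icc ⌊z.1 - r⌋ ⌈z.1 + r⌉) ×ˢ (Set.Icc ⌊z.2 - r⌋ ⌈z.2 + r⌉) := by
    intro n hn
    simp only [mem_ofPred_eq, Prod.norm_def, lat, Prod.fst_sub, Prod.snd_sub, Real.norm_eq_abs,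
      max_le_iff, abs_le] at hn
    obtain ⟨⟨h1, h2⟩, h3, h4⟩ := hn
    simp only [mem_prod, mem_Icc]
    refine ⟨⟨?_, ?_⟩, ?_, ?_⟩
    · have := Int.floor_le (z.1 - r)
      exact_mod_cast (by linarith : (⌊z.1 - r⌋ : ℝ) ≤ n.1)
    · have := Int.le_ceil (z.1 + r)
      exact_mod_cast (by linarith : (n.1 : ℝ) ≤ ⌈z.1 + r⌉)
    · have := Int.floor_le (z.2 - r)
      exact_mod_cast (by linarith : (⌊z.2 - r⌋ : ℝ) ≤ n.2)
    · have := Int.le_ceil (z.2 + r)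
      exact_mod_cast (by linarith : (n.2 : ℝ) ≤ ⌈z.2 + r⌉)
  exact ((Set.finite_Icc _ _).prod (Set.finite_Icc _ _)).subset this

lemma per_cont_param {h : ℝ × E2 → E2} (hc : Continuous h)
    (hs : ∀ t, Supp (fun z => h (t, z))) :
    Continuous (fun p : ℝ × E2 => Per (fun z => h (p.1, z)) p.2) := by
  unfold Per perD
  refine continuous_snd.add (continuous_finsum (fun n => by fun_prop) ?_)
  rintro ⟨t, z⟩
  refine ⟨univ ×ˢ Metric.ball z 1, prod_mem_nhds univ_mem (Metric.ball_mem_nhds _ one_pos), ?_⟩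
  refine (finite_lat_ball z 2).subset ?_
  rintro n ⟨⟨t', z'⟩, h1, h2⟩
  simp only [Function.mem_support] at h1
  have h3 : ‖z' - lat n‖ < 1 / 2 := by
    by_contra! hcon
    exact h1 (sub_eq_zero.mpr (hs t' _ hcon))
  have h4 : ‖z' - z‖ < 1 := by
    simpa [dist_eq_norm] using h2
  have : ‖z - lat n‖ ≤ ‖z' - lat n‖ + ‖z' - z‖ := by
    have := norm_sub_le (z' - lat n) (z' - z)
    rwa [show z' - lat n - (z' - z) = z - lat n by abel] at this
  simp only [mem_ofPred_eq]
  linarith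

lemma per_cont {h : E2 → E2} (hc : Continuous h) (hs : Supp h) : Continuous (Per h) := by
  have := per_cont_param (h := fun p => h p.2) (by fun_prop) (fun _ => hs)
  exact this.comp (Continuous.prodMk_right (0 : ℝ))

/-! ### Alexander trick -/

noncomputable def alex (h : E2 → E2) (p : ℝ × E2) : E2 := p.2 + p.1 • (h (p.1⁻¹ • p.2) - p.1⁻¹ • p.2)

lemma alex_zero (h : E2 → E2) (z : E2) : alex h (0, z) = z := by simp [alex]

lemma alex_one (h : E2 → E2) (z : E2) : alex h (1, z) = h z := by simp [alex]

lemma alex_ne {h : E2 → E2} {t : ℝ} (ht : t ≠ 0) (z : E2) : alex h (t, z) = t • h (t⁻¹ • z) := by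
  simp [alex, smul_sub, ht]

lemma Supp.bdd {h : E2 → E2} (hc : Continuous h) (hs : Supp h) :
    ∃ M, ∀ z, ‖h z - z‖ ≤ M := by
  obtain ⟨C, hC⟩ := (isCompact_closedBall (0 : E2) (1/2)).exists_bound_of_continuousOn
    (f := fun z => h z - z) (by fun_prop)
  refine ⟨max C 0, fun z => ?_⟩
  by_cases hz : ‖z‖ ≤ 1 / 2
  · exact le_max_of_le_left (hC z (by simpa using hz))
  · rw [hs z (le_of_not_ge hz), sub_self, norm_zero]
    exact le_max_right _ _

lemma alex_cont {h : E2 → E2} (hc : Continuous h) (hs : Supp h) : Continuous (alex h) := by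
  obtain ⟨M, hM⟩ := hs.bdd hc
  rw [continuous_iff_continuousAt]
  rintro ⟨t, z⟩
  unfold alex
  refine continuousAt_snd.add ?_
  by_cases ht : t = 0
  · subst ht
    unfold ContinuousAt
    simp only [zero_smul]
    rw [tendsto_zero_iff_norm_tendsto_zero]
    have h1 : Tendsto (fun p : ℝ × E2 => |p.1| * M) (𝓝 (0, z)) (𝓝 0) := by
      have : Continuous (fun p : ℝ × E2 => |p.1| * M) := by fun_prop
      simpa using this.tendsto (0, z)
    refine squeeze_zero (fun _ => norm_nonneg _) (fun p => ?_) h1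
    rw [norm_smul, Real.norm_eq_abs]
    exact mul_le_mul_of_nonneg_left (hM _) (abs_nonneg _)
  · have h1 : ContinuousAt (fun p : ℝ × E2 => p.1⁻¹) (t, z) := continuousAt_fst.inv₀ ht
    have h2 : ContinuousAt (fun p : ℝ × E2 => p.1⁻¹ • p.2) (t, z) := h1.smul continuousAt_snd
    refine continuousAt_fst.smul (ContinuousAt.sub ?_ h2)
    exact ContinuousAt.comp (f := fun p : ℝ × E2 => p.1⁻¹ • p.2) (g := h) hc.continuousAt h2

lemma alex_bij {h : E2 → E2} (hb : Function.Bijective h) (t : ℝ) :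
    Function.Bijective (fun z => alex h (t, z)) := by
  by_cases ht : t = 0
  · subst ht
    simp only [alex_zero]
    exact Function.bijective_id
  · simp only [alex_ne ht]
    have h1 : Function.Bijective (fun z : E2 => t • z) := MulAction.bijective₀ ht
    have h2 : Function.Bijective (fun z : E2 => t⁻¹ • z) := MulAction.bijective₀ (inv_ne_zero ht)
    exact h1.comp (hb.comp h2)

lemma alex_supp {h : E2 → E2} (hs : Supp h) {t : ℝ} (h0 : 0 ≤ t) (h1 : t ≤ 1) :
    Supp (fun z => alex h (t, z)) := by
  intro z hz
  simp only
  rcases h0.eq_or_lt with rfl | h0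
  · exact alex_zero h z
  · rw [alex_ne h0.ne', hs, smul_inv_smul₀ h0.ne']
    rw [norm_smul, norm_inv, Real.norm_eq_abs, abs_of_pos h0]
    have : 1 ≤ t⁻¹ := (one_le_inv₀ h0).mpr h1
    nlinarith

/-- L1: periodizations are trivial -/
lemma triv_per {h : E2 → E2} (hc : Continuous h) (hb : Function.Bijective h) (hs : Supp h) :
    Triv (Per h) := by
  have hcl : ∀ t : ℝ, 0 ≤ max 0 (min 1 t) ∧ max 0 (min 1 t) ≤ 1 := fun t =>
    ⟨le_max_left _ _, max_le zero_le_one (min_le_left _ _)⟩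
  refine ⟨fun p => Per (fun z => alex h (max 0 (min 1 p.1), z)) p.2, ?_, ?_, ?_, ?_, ?_⟩
  · have := per_cont_param (h := fun p => alex h (max 0 (min 1 p.1), p.2))
      ((alex_cont hc hs).comp (by fun_prop))
      (fun t => alex_supp hs (hcl t).1 (hcl t).2)
    exact this
  · intro z
    simp only [min_eq_right zero_le_one, max_self, alex_zero]
    exact per_id z
  · intro z
    simp [alex_one]
  · intro t
    exact per_bij (alex_supp hs (hcl t).1 (hcl t).2) (alex_bij hb _)
  · intro t
    exact per_equi (alex_supp hs (hcl t).1 (hcl t).2)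

/-- homeomorphism version of periodization -/
noncomputable def perHomeo (h : E2 ≃ₜ E2) (hs : Supp h) : E2 ≃ₜ E2 where
  toFun := Per h
  invFun := Per h.symm
  left_inv z := by
    have hs2 : Supp h.symm := supp_symm (h := h.toEquiv) hs
    rw [per_comp hs2 hs h.injective z]
    simp only [Homeomorph.symm_apply_apply]
    exact per_id z
  right_inv z := by
    have hs2 : Supp h.symm := supp_symm (h := h.toEquiv) hs
    rw [per_comp hs hs2 h.symm.injective z]
    simp only [Homeomorph.apply_symm_apply]
    exact per_id z
  continuous_toFun := per_cont h.continuous hs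
  continuous_invFun := per_cont h.symm.continuous (supp_symm (h := h.toEquiv) hs)

@[simp] lemma perHomeo_apply (h : E2 ≃ₜ E2) (hs : Supp h) (z : E2) : perHomeo h hs z = Per h z := rfl

lemma perHomeo_symm_apply (h : E2 ≃ₜ E2) (hs : Supp h) (z : E2) :
    (perHomeo h hs).symm z = Per h.symm z := rfl

lemma triv_perHomeo (h : E2 ≃ₜ E2) (hs : Supp h) : Triv (perHomeo h hs) :=
  triv_per h.continuous h.bijective hs

/-! ### extension by the identity (LemC) -/

open Classical in
noncomputable def ext0 (γ Φ : E2 → E2) (w : E2) : E2 :=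
  if h : ∃ z, γ z = w then γ (Φ h.choose) else w

lemma ext0_mem {γ Φ : E2 → E2} (hγ : Function.Injective γ) (z : E2) :
    ext0 γ Φ (γ z) = γ (Φ z) := by
  have h : ∃ z', γ z' = γ z := ⟨z, rfl⟩
  rw [ext0, dif_pos h, hγ h.choose_spec]

lemma ext0_not {γ Φ : E2 → E2} {w : E2} (hw : w ∉ range γ) : ext0 γ Φ w = w := by
  rw [ext0, dif_neg]
  exact hw

lemma ext0_cont {γ Φ : E2 → E2} (hγ : IsOpenEmbedding γ) (hΦ : Continuous Φ)
    (ht : Tendsto (fun z => γ (Φ z) - γ z) (cocompact E2) (𝓝 0)) : Continuous (ext0 γ Φ) := by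
  rw [continuous_iff_continuousAt]
  intro w
  by_cases hw : w ∈ range γ
  · obtain ⟨z, rfl⟩ := hw
    rw [← hγ.continuousAt_iff]
    have : ext0 γ Φ ∘ γ = fun z => γ (Φ z) := funext (fun z => ext0_mem hγ.injective z)
    rw [this]
    exact (hγ.continuous.comp hΦ).continuousAt
  · unfold ContinuousAt
    rw [ext0_not hw]
    have h1 : Tendsto (fun x => ext0 γ Φ x - x) (𝓝 w) (𝓝 0) := by
      rw [Metric.tendsto_nhds]
      intro ε hε
      have h2 := (Metric.tendsto_nhds.mp ht) ε hε
      rw [Filter.eventually_iff, mem_cocompact] at h2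
      obtain ⟨K, hK, hK2⟩ := h2
      have hcl : IsClosed (γ '' K) := (hK.image hγ.continuous).isClosed
      have hwK : w ∈ (γ '' K)ᶜ := fun ⟨z, _, hz⟩ => hw ⟨z, hz⟩
      filter_upwards [hcl.isOpen_compl.mem_nhds hwK] with x hx
      by_cases hxr : x ∈ range γ
      · obtain ⟨z, rfl⟩ := hxr
        rw [ext0_mem hγ.injective]
        exact hK2 (fun hz => hx ⟨z, hz, rfl⟩)
      · rw [ext0_not hxr, sub_self, dist_self]
        exact hε
    have := h1.add tendsto_id
    simpa using this

lemma ext0_comp {γ Φ Ψ : E2 → E2} (hγ : Function.Injective γ) (h : ∀ z, Φ (Ψ z) = z) (w : E2) :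
    ext0 γ Φ (ext0 γ Ψ w) = w := by
  by_cases hw : w ∈ range γ
  · obtain ⟨z, rfl⟩ := hw
    rw [ext0_mem hγ, ext0_mem hγ, h]
  · rw [ext0_not hw, ext0_not hw]

noncomputable def extHomeo (γ : E2 → E2) (Φ : E2 ≃ₜ E2) (hγ : IsOpenEmbedding γ)
    (ht : Tendsto (fun z => γ (Φ z) - γ z) (cocompact E2) (𝓝 0)) : E2 ≃ₜ E2 where
  toFun := ext0 γ Φ
  invFun := ext0 γ Φ.symm
  left_inv := ext0_comp hγ.injective (fun z => Φ.symm_apply_apply z)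
  right_inv := ext0_comp hγ.injective (fun z => Φ.apply_symm_apply z)
  continuous_toFun := ext0_cont hγ Φ.continuous ht
  continuous_invFun := by
    refine ext0_cont hγ Φ.symm.continuous ?_
    have h1 := (ht.comp (Φ.symm.isClosedEmbedding.tendsto_cocompact)).neg
    simp only [neg_zero] at h1
    refine h1.congr (fun z => ?_)
    simp

@[simp] lemma extHomeo_apply (γ : E2 → E2) (Φ : E2 ≃ₜ E2) (hγ : IsOpenEmbedding γ)
    (ht : Tendsto (fun z => γ (Φ z) - γ z) (cocompact E2) (𝓝 0)) (w : E2) :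
    extHomeo γ Φ hγ ht w = ext0 γ Φ w := rfl

/-! ### radial compressions -/

noncomputable def mu (q : E2 → ℝ) (a b : ℝ) (z : E2) : ℝ := b / (b + max 0 (q z - a))

noncomputable def cmp (q : E2 → ℝ) (a b : ℝ) (z : E2) : E2 := mu q a b z • z

noncomputable def cmpInv (q : E2 → ℝ) (a b : ℝ) (w : E2) : E2 := ((b - a) / (b - max (q w) a)) • w

section
variable {q : E2 → ℝ} {a b : ℝ}

lemma mu_pos (hab : 0 < b) (z : E2) : 0 < mu q a b z := by
  unfold mu
  have := le_max_left 0 (q z - a)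
  positivity

lemma mu_le_one (hab : 0 < b) (z : E2) : mu q a b z ≤ 1 := by
  unfold mu
  have := le_max_left 0 (q z - a)
  rw [div_le_one (by positivity)]
  linarith

lemma cmp_id (hb : 0 < b) {z : E2} (hz : q z ≤ a) : cmp q a b z = z := by
  rw [cmp, mu, max_eq_left (by linarith), add_zero, div_self hb.ne', one_smul]

lemma cmp_cont (hq : Continuous q) (hb : 0 < b) : Continuous (cmp q a b) := by
  unfold cmp mu
  have h1 : Continuous (fun z => b + max 0 (q z - a)) := by fun_prop
  refine Continuous.smul (Continuous.div continuous_const h1 ?_) continuous_id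
  intro z
  have := le_max_left 0 (q z - a)
  positivity

lemma q_cmp (hh : ∀ c : ℝ, 0 ≤ c → ∀ z, q (c • z) = c * q z) (hb : 0 < b) (z : E2) :
    q (cmp q a b z) = mu q a b z * q z := by
  rw [cmp, hh _ (mu_pos hb z).le]

lemma q_cmp_lt (hh : ∀ c : ℝ, 0 ≤ c → ∀ z, q (c • z) = c * q z) (ha : 0 < a) (hab : a < b)
    (z : E2) : q (cmp q a b z) < b := by
  have hb : 0 < b := ha.trans hab
  rw [q_cmp hh hb, mu]
  have h1 := le_max_left 0 (q z - a)
  have h2 := le_max_right 0 (q z - a)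
  rw [div_mul_eq_mul_div, div_lt_iff₀ (by positivity)]
  nlinarith

lemma cmpInv_cmp (hh : ∀ c : ℝ, 0 ≤ c → ∀ z, q (c • z) = c * q z) (ha : 0 < a) (hab : a < b)
    (z : E2) : cmpInv q a b (cmp q a b z) = z := by
  have hb : 0 < b := ha.trans hab
  by_cases hz : q z ≤ a
  · rw [cmp_id hb hz, cmpInv, max_eq_right hz, div_self (by linarith), one_smul]
  · push Not at hz
    rw [cmpInv, q_cmp hh hb]
    have h1 : a ≤ mu q a b z * q z := by
      rw [mu, max_eq_right (by linarith), div_mul_eq_mul_div, le_div_iff₀ (by linarith)]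
      nlinarith
    rw [max_eq_left h1, cmp, smul_smul]
    convert one_smul ℝ z
    have h3 : b - mu q a b z * q z ≠ 0 := by
      have := q_cmp_lt (q := q) hh ha hab z
      rw [q_cmp hh hb] at this
      linarith
    rw [div_mul_eq_mul_div, div_eq_one_iff_eq h3]
    rw [mu, max_eq_right (by linarith)]
    have h4 : b + (q z - a) ≠ 0 := by linarith
    field_simp
    ring

lemma cmp_cmpInv (hh : ∀ c : ℝ, 0 ≤ c → ∀ z, q (c • z) = c * q z) (ha : 0 < a) (hab : a < b)
    {w : E2} (hw : q w < b) : cmp q a b (cmpInv q a b w) = w := by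
  have hb : 0 < b := ha.trans hab
  by_cases hz : q w ≤ a
  · rw [cmpInv, max_eq_right hz, div_self (by linarith), one_smul, cmp_id hb hz]
  · push Not at hz
    have hbw : 0 < b - q w := by linarith
    have hba : 0 < b - a := by linarith
    rw [cmpInv, max_eq_left hz.le, cmp, smul_smul, mu, hh _ (by positivity)]
    convert one_smul ℝ w
    have h5 : (b - a) / (b - q w) * q w - a = b * (q w - a) / (b - q w) := by
      field_simp
      ring
    rw [h5, max_eq_right (by have : 0 < q w - a := by linarith
                             positivity)]
    have h6 : 0 < b + b * (q w - a) / (b - q w) := by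
      have : 0 < q w - a := by linarith
      positivity
    have h7 : b + b * (q w - a) / (b - q w) = b * (b - a) / (b - q w) := by
      field_simp
      ring
    rw [h7]
    field_simp

lemma range_cmp (hh : ∀ c : ℝ, 0 ≤ c → ∀ z, q (c • z) = c * q z) (ha : 0 < a) (hab : a < b) :
    range (cmp q a b) = {w | q w < b} := by
  ext w
  constructor
  · rintro ⟨z, rfl⟩
    exact q_cmp_lt hh ha hab z
  · intro hw
    exact ⟨_, cmp_cmpInv hh ha hab hw⟩

lemma cmp_openEmb (hq : Continuous q) (hh : ∀ c : ℝ, 0 ≤ c → ∀ z, q (c • z) = c * q z)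
    (ha : 0 < a) (hab : a < b) : IsOpenEmbedding (cmp q a b) := by
  have hb : 0 < b := ha.trans hab
  refine IsOpenEmbedding.of_continuous_injective_isOpenMap (cmp_cont hq hb)
    (Function.LeftInverse.injective (cmpInv_cmp hh ha hab)) ?_
  intro U hU
  have h1 : cmp q a b '' U = {w | q w < b} ∩ cmpInv q a b ⁻¹' U := by
    ext w
    constructor
    · rintro ⟨z, hz, rfl⟩
      refine ⟨q_cmp_lt hh ha hab z, ?_⟩
      rwa [mem_preimage, cmpInv_cmp hh ha hab]
    · rintro ⟨h1, h2⟩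
      exact ⟨_, h2, cmp_cmpInv hh ha hab h1⟩
  rw [h1]
  refine ContinuousOn.isOpen_inter_preimage ?_ (isOpen_lt hq continuous_const) hU
  unfold cmpInv
  have h2 : ContinuousOn (fun w => b - max (q w) a) {w | q w < b} := by fun_prop
  refine ContinuousOn.smul (ContinuousOn.div continuousOn_const h2 ?_) continuousOn_id
  intro w hw
  have : max (q w) a < b := max_lt hw hab
  linarith

lemma cmp_sub_le (hq1 : ∀ z z', |q z' - q z| ≤ ‖z' - z‖) (ha : 0 < a) (hab : a < b)
    {z z' : E2} (hz : ‖z‖ ≤ q z) :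
    ‖cmp q a b z' - cmp q a b z‖ ≤ 2 * mu q a b z' * ‖z' - z‖ := by
  have hb : 0 < b := ha.trans hab
  have h0 : cmp q a b z' - cmp q a b z = mu q a b z' • (z' - z) + (mu q a b z' - mu q a b z) • z := by
    unfold cmp
    rw [smul_sub, sub_smul]
    abel
  have hq0 : 0 ≤ q z := (norm_nonneg _).trans hz
  have hp' := mu_pos (q := q) (a := a) hb z'
  have key : |mu q a b z' - mu q a b z| * ‖z‖ ≤ mu q a b z' * ‖z' - z‖ := by
    set A := max 0 (q z - a) with hA
    set A' := max 0 (q z' - a) with hA'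
    have hA0 : 0 ≤ A := le_max_left _ _
    have hA0' : 0 ≤ A' := le_max_left _ _
    have hd : |A - A'| ≤ ‖z' - z‖ := by
      refine le_trans ?_ (hq1 z z')
      rw [abs_sub_comm]
      have := abs_max_sub_max_le_abs (q z' - a) (q z - a) 0
      rw [max_comm _ (0 : ℝ), max_comm _ (0 : ℝ)] at this
      simpa using this
    have h1 : mu q a b z' - mu q a b z = mu q a b z' * ((A - A') / (b + A)) := by
      unfold mu
      rw [← hA, ← hA']
      field_simp
      ring
    have hzA : ‖z‖ ≤ b + A := by
      have : q z - a ≤ A := le_max_right _ _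
      linarith
    rw [h1, abs_mul, abs_of_pos hp', abs_div, abs_of_pos (by positivity : 0 < b + A), mul_assoc]
    refine mul_le_mul_of_nonneg_left ?_ hp'.le
    rw [div_mul_eq_mul_div, div_le_iff₀ (by positivity)]
    exact mul_le_mul hd hzA (norm_nonneg _) (norm_nonneg _)
  rw [h0]
  refine (norm_add_le _ _).trans ?_
  rw [norm_smul, norm_smul, Real.norm_eq_abs, Real.norm_eq_abs, abs_of_pos hp']
  linarith

end

end TorusIso


namespace TorusIso

open Filter Topology Set

lemma abs_fst_le (z : E2) : |z.1| ≤ ‖z‖ := norm_fst_le z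
lemma abs_snd_le (z : E2) : |z.2| ≤ ‖z‖ := norm_snd_le z

lemma tendsto_cmp {q : E2 → ℝ} {a b : ℝ} (hq1 : ∀ z z', |q z' - q z| ≤ ‖z' - z‖)
    (ha : 0 < a) (hab : a < b) {Φ : E2 → E2} {C R : ℝ} (hC : ∀ z, ‖Φ z - z‖ ≤ C)
    (hR : ∀ z, R ≤ ‖z‖ → Φ z = z ∨ ‖z‖ ≤ q z) :
    Tendsto (fun z => cmp q a b (Φ z) - cmp q a b z) (cocompact E2) (𝓝 0) := by
  have hb : 0 < b := ha.trans hab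
  have hC0 : 0 ≤ C := (norm_nonneg _).trans (hC 0)
  rw [tendsto_zero_iff_norm_tendsto_zero, ← Metric.cobounded_eq_cocompact]
  have h1 : Tendsto (fun z : E2 => 2 * (b / (b + (‖z‖ - C - a))) * C)
      (Bornology.cobounded E2) (𝓝 0) := by
    have h2 : Tendsto (fun z : E2 => b + (‖z‖ - C - a)) (Bornology.cobounded E2) atTop := by
      apply tendsto_atTop_add_const_left
      have := tendsto_atTop_add_const_right (Bornology.cobounded E2) (-C - a)
        (tendsto_norm_cobounded_atTop (E := E2))
      refine this.congr (fun z => by ring)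
    have h3 := ((tendsto_const_nhds (x := b)).div_atTop h2).const_mul 2
    have h4 := h3.mul_const C
    simpa using h4
  refine squeeze_zero' (Eventually.of_forall (fun _ => norm_nonneg _)) ?_ h1
  have hev := (tendsto_norm_cobounded_atTop (E := E2)).eventually_ge_atTop (max R (C + a))
  filter_upwards [hev] with z hz
  have hz1 : R ≤ ‖z‖ := (le_max_left _ _).trans hz
  have hz2 : C + a ≤ ‖z‖ := (le_max_right _ _).trans hz
  have hp : 0 < b + (‖z‖ - C - a) := by linarith
  rcases hR z hz1 with h | h
  · rw [h, sub_self, norm_zero]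
    positivity
  · refine (cmp_sub_le hq1 ha hab h).trans ?_
    have h5 : q z - C ≤ q (Φ z) := by
      have := (abs_le.mp ((hq1 z (Φ z)).trans (hC z))).1
      linarith
    have h6 : mu q a b (Φ z) ≤ b / (b + (‖z‖ - C - a)) := by
      unfold mu
      apply div_le_div_of_nonneg_left hb.le hp
      have := le_max_right 0 (q (Φ z) - a)
      linarith
    have h7 := mu_pos (q := q) (a := a) hb (Φ z)
    gcongr
    exact hC z

/-! ### the stretching homeomorphism of the line -/

noncomputable def rl : ℝ ≃ₜ ℝ where
  toFun x := max (min (x + 2) (2.4 + (x - 0.4) / 21)) x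
  invFun y := min (max (y - 2) (0.4 + 21 * (y - 2.4))) y
  left_inv x := by
    simp only
    rcases le_total x 0.4 with h1 | h1
    · have e : max (min (x + 2) (2.4 + (x - 0.4) / 21)) x = x + 2 := by
        rw [min_eq_left (by linarith), max_eq_left (by linarith)]
      rw [e, max_eq_left (by linarith), min_eq_left (by linarith)]
      ring
    · rcases le_total x 2.5 with h2 | h2
      · have e : max (min (x + 2) (2.4 + (x - 0.4) / 21)) x = 2.4 + (x - 0.4) / 21 := by
          rw [min_eq_right (by linarith), max_eq_left (by linarith)]
        rw [e, max_eq_right (by linarith), min_eq_left (by linarith)]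
        ring
      · have e : max (min (x + 2) (2.4 + (x - 0.4) / 21)) x = x := by
          rw [min_eq_right (by linarith), max_eq_right (by linarith)]
        rw [e, max_eq_right (by linarith), min_eq_right (by linarith)]
  right_inv y := by
    simp only
    rcases le_total y 2.4 with h1 | h1
    · have e : min (max (y - 2) (0.4 + 21 * (y - 2.4))) y = y - 2 := by
        rw [max_eq_left (by linarith), min_eq_left (by linarith)]
      rw [e, min_eq_left (by linarith), max_eq_left (by linarith)]
      ring
    · rcases le_total y 2.5 with h2 | h2
      · have e : min (max (y - 2) (0.4 + 21 * (y - 2.4))) y = 0.4 + 21 * (y - 2.4) := by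
          rw [max_eq_right (by linarith), min_eq_left (by linarith)]
        rw [e, min_eq_right (by linarith), max_eq_left (by linarith)]
        ring
      · have e : min (max (y - 2) (0.4 + 21 * (y - 2.4))) y = y := by
          rw [max_eq_right (by linarith), min_eq_right (by linarith)]
        rw [e, min_eq_right (by linarith), max_eq_right (by linarith)]
  continuous_toFun := by fun_prop
  continuous_invFun := by fun_prop

lemma rl_apply (x : ℝ) : rl x = max (min (x + 2) (2.4 + (x - 0.4) / 21)) x := rfl

lemma rl_symm_apply (y : ℝ) : rl.symm y = min (max (y - 2) (0.4 + 21 * (y - 2.4))) y := rfl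

lemma rl_left {x : ℝ} (h : x ≤ 0.4) : rl x = x + 2 := by
  rw [rl_apply, min_eq_left (by linarith), max_eq_left (by linarith)]

lemma rl_right {x : ℝ} (h : 2.5 ≤ x) : rl x = x := by
  rw [rl_apply, max_eq_right]
  exact (min_le_right _ _).trans (by linarith)

lemma rl_disp (x : ℝ) : |rl x - x| ≤ 2 := by
  rw [rl_apply, abs_le]
  constructor
  · have := le_max_right (min (x + 2) (2.4 + (x - 0.4) / 21)) x
    linarith
  · have : max (min (x + 2) (2.4 + (x - 0.4) / 21)) x ≤ x + 2 :=
      max_le (min_le_left _ _) (by linarith)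
    linarith

lemma rl_ge {x : ℝ} (h : 0.1 ≤ x) : 2.1 ≤ rl x := by
  rw [rl_apply]
  exact le_max_of_le_left (le_min (by linarith) (by linarith))

/-- the second stretching map -/
noncomputable def sl : ℝ ≃ₜ ℝ := (Homeomorph.addRight (2 : ℝ)).trans rl.symm

lemma sl_apply (x : ℝ) : sl x = rl.symm (x + 2) := rfl

lemma sl_left {x : ℝ} (h : x ≤ 0.4) : sl x = x := by
  rw [sl_apply, Homeomorph.symm_apply_eq, rl_left h]

lemma sl_right {x : ℝ} (h : 0.5 ≤ x) : sl x = x + 2 := by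
  rw [sl_apply, Homeomorph.symm_apply_eq, rl_right (by linarith)]

lemma rl_sl (x : ℝ) : rl (sl x) = x + 2 := by
  rw [sl_apply, Homeomorph.apply_symm_apply]

lemma sl_disp (x : ℝ) : x ≤ sl x ∧ sl x ≤ x + 2 := by
  have h1 := rl_sl x
  have h2 := abs_le.mp (rl_disp (sl x))
  refine ⟨by linarith, ?_⟩
  rw [← h1, rl_apply]
  exact le_max_right _ _

noncomputable def hat (r : ℝ ≃ₜ ℝ) : E2 ≃ₜ E2 := r.prodCongr (Homeomorph.refl ℝ)

@[simp] lemma hat_fst (r : ℝ ≃ₜ ℝ) (z : E2) : (hat r z).1 = r z.1 := rfl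
@[simp] lemma hat_snd (r : ℝ ≃ₜ ℝ) (z : E2) : (hat r z).2 = z.2 := rfl

/-- translation vector -/
def tv (n : ℕ) : E2 := (2 * n, 0)

@[simp] lemma tv_fst (n : ℕ) : (tv n).1 = 2 * n := rfl
@[simp] lemma tv_snd (n : ℕ) : (tv n).2 = 0 := rfl

lemma tv_succ (n : ℕ) : tv (n + 1) = tv n + (2, 0) := by
  ext <;> simp; ring

section handle

variable (F : E2 ≃ₜ E2)

noncomputable def Um : E2 ≃ₜ E2 := (hat sl).trans (F.symm.trans ((hat rl).trans F))

lemma Um_apply (z : E2) : Um F z = F (hat rl (F.symm (hat sl z))) := rfl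

variable {F}

lemma hd1 (hd : ∀ z, ‖F z - z‖ ≤ 0.1) (z : E2) : |(F z).1 - z.1| ≤ 0.1 := (abs_fst_le (F z - z)).trans (hd z)
lemma hd2 (hd : ∀ z, ‖F z - z‖ ≤ 0.1) (z : E2) : |(F z).2 - z.2| ≤ 0.1 := (abs_snd_le (F z - z)).trans (hd z)

lemma hds (hd : ∀ z, ‖F z - z‖ ≤ 0.1) (z : E2) : ‖F.symm z - z‖ ≤ 0.1 := by
  have := hd (F.symm z)
  rwa [F.apply_symm_apply, norm_sub_rev] at this

lemma Um_right (hd : ∀ z, ‖F z - z‖ ≤ 0.1) {z : E2} (hz : 1 ≤ z.1) : Um F z = z + (2, 0) := by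
  have h1 : hat sl z = z + (2, 0) := by
    ext
    · simp [sl_right (by linarith : (0.5 : ℝ) ≤ z.1)]
    · simp
  have h2 := abs_le.mp (hd1 (hds hd) (z + (2, 0)))
  simp only [Prod.fst_add] at h2
  have h3 : hat rl (F.symm (z + (2, 0))) = F.symm (z + (2, 0)) := by
    ext
    · simp only [hat_fst]
      exact rl_right (by linarith [h2.1])
    · simp
  rw [Um_apply, h1, h3, F.apply_symm_apply]

lemma Um_left (hd : ∀ z, ‖F z - z‖ ≤ 0.1) {z : E2} (hz : z.1 ≤ 0.3) : Um F (F z) = F (z + (2, 0)) := by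
  have h2 := abs_le.mp (hd1 hd z)
  have h1 : hat sl (F z) = F z := by
    ext
    · simp only [hat_fst]
      exact sl_left (by linarith)
    · simp
  have h3 : hat rl z = z + (2, 0) := by
    ext
    · simp only [hat_fst, Prod.fst_add]
      exact rl_left (by linarith)
    · simp
  rw [Um_apply, h1, F.symm_apply_apply, h3]

lemma Um_ge (hd : ∀ z, ‖F z - z‖ ≤ 0.1) {z : E2} (hz : 0.2 ≤ z.1) : 2 ≤ (Um F z).1 := by
  rw [Um_apply]
  have h1 := (sl_disp z.1).1
  have h2 := abs_le.mp (hd1 (hds hd) (hat sl z))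
  simp only [hat_fst] at h2
  have h3 : 2.1 ≤ (hat rl (F.symm (hat sl z))).1 := by
    simp only [hat_fst]
    exact rl_ge (by linarith)
  have h4 := abs_le.mp (hd1 hd (hat rl (F.symm (hat sl z))))
  linarith

lemma Um_disp1 (hd : ∀ z, ‖F z - z‖ ≤ 0.1) (z : E2) : |(Um F z).1 - z.1| ≤ 4.2 := by
  rw [Um_apply]
  have h1 := (sl_disp z.1)
  have h2 := abs_le.mp (hd1 (hds hd) (hat sl z))
  have h3 := abs_le.mp (rl_disp (F.symm (hat sl z)).1)
  have h4 := abs_le.mp (hd1 hd (hat rl (F.symm (hat sl z))))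
  simp only [hat_fst] at *
  rw [abs_le]
  constructor <;> linarith

lemma Um_disp2 (hd : ∀ z, ‖F z - z‖ ≤ 0.1) (z : E2) : |(Um F z).2 - z.2| ≤ 0.2 := by
  rw [Um_apply]
  have h2 := abs_le.mp (hd2 (hds hd) (hat sl z))
  have h4 := abs_le.mp (hd2 hd (hat rl (F.symm (hat sl z))))
  simp only [hat_snd] at *
  rw [abs_le]
  constructor <;> linarith

lemma Um_iter (hd : ∀ z, ‖F z - z‖ ≤ 0.1) {z : E2} (hz : 1 ≤ z.1) (n : ℕ) : (Um F)^[n] z = z + tv n := by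
  induction n with
  | zero => ext <;> simp
  | succ n ih =>
    rw [Function.iterate_succ_apply', ih, Um_right hd, tv_succ, add_assoc]
    simp
    have : (0 : ℝ) ≤ n := n.cast_nonneg
    linarith

variable (F) in
noncomputable def Gm (n : ℕ) (z : E2) : E2 := (Um F)^[n] (F (z - tv n))

lemma Gm_succ (hd : ∀ z, ‖F z - z‖ ≤ 0.1) {n : ℕ} {z : E2} (hz : z.1 ≤ 2 * n + 2.3) : Gm F (n + 1) z = Gm F n z := by
  unfold Gm
  rw [Function.iterate_succ_apply, Um_left hd]
  · rw [tv_succ]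
    congr 2
    abel
  · rw [tv_succ]
    simp
    linarith

lemma Gm_add (hd : ∀ z, ‖F z - z‖ ≤ 0.1) {n : ℕ} {z : E2} (hz : z.1 ≤ 2 * n + 2.3) (k : ℕ) : Gm F (n + k) z = Gm F n z := by
  induction k with
  | zero => rfl
  | succ k ih =>
    rw [← add_assoc, Gm_succ hd, ih]
    push_cast
    have : (0 : ℝ) ≤ k := k.cast_nonneg
    linarith

variable (F) in
noncomputable def Phm (z : E2) : E2 := Gm F ⌈|z.1|⌉₊ z

lemma Phm_eq (hd : ∀ z, ‖F z - z‖ ≤ 0.1) {n : ℕ} {z : E2} (hz : z.1 ≤ 2 * n + 2.3) : Phm F z = Gm F n z := by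
  unfold Phm
  have h1 : z.1 ≤ 2 * (⌈|z.1|⌉₊ : ℝ) + 2.3 := by
    have := Nat.le_ceil |z.1|
    have := le_abs_self z.1
    have := abs_nonneg z.1
    linarith
  rw [← Gm_add hd h1 n, ← Gm_add hd hz ⌈|z.1|⌉₊, add_comm]

lemma Phm_left (hd : ∀ z, ‖F z - z‖ ≤ 0.1) {z : E2} (hz : z.1 ≤ 2.3) : Phm F z = F z := by
  rw [Phm_eq hd (n := 0) (by simpa using hz)]
  simp only [Gm, Function.iterate_zero, id]
  congr 1
  ext <;> simp

lemma Gm_cont (n : ℕ) : Continuous (Gm F n) := by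
  unfold Gm
  exact ((Um F).continuous.iterate n).comp (by fun_prop)

lemma Gm_inj (n : ℕ) : Function.Injective (Gm F n) := by
  intro z w h
  have := F.injective ((Um F).injective.iterate n h)
  simpa using this

lemma exists_nat_bd (x : ℝ) : ∃ n : ℕ, x ≤ 2 * n + 1 := by
  obtain ⟨n, hn⟩ := exists_nat_ge x
  refine ⟨n, ?_⟩
  have : (0 : ℝ) ≤ n := n.cast_nonneg
  linarith

lemma Phm_cont (hd : ∀ z, ‖F z - z‖ ≤ 0.1) : Continuous (Phm F) := by
  rw [continuous_iff_continuousAt]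
  intro z
  obtain ⟨n, hn⟩ := exists_nat_bd z.1
  have h1 : Phm F =ᶠ[𝓝 z] Gm F n := by
    have h2 : ∀ᶠ w : E2 in 𝓝 z, w.1 < 2 * (n : ℝ) + 2.3 := by
      have : ContinuousAt (fun w : E2 => w.1) z := continuousAt_fst
      exact Filter.Tendsto.eventually_lt_const (by linarith) this
    filter_upwards [h2] with w hw
    exact Phm_eq hd hw.le
  exact (Gm_cont n).continuousAt.congr h1.symm

lemma Phm_inj (hd : ∀ z, ‖F z - z‖ ≤ 0.1) : Function.Injective (Phm F) := by
  intro z w h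
  obtain ⟨n, hn⟩ := exists_nat_bd (max z.1 w.1)
  rw [Phm_eq hd (n := n) (by linarith [le_max_left z.1 w.1]),
    Phm_eq hd (n := n) (by linarith [le_max_right z.1 w.1])] at h
  exact Gm_inj n h

lemma Um_back (hd : ∀ z, ‖F z - z‖ ≤ 0.1) (n : ℕ) : ∀ w : E2, w.1 ≤ 2 * n + 1 → ((Um F).symm^[n] w).1 ≤ 1 := by
  induction n with
  | zero => intro w hw; simpa using hw
  | succ n ih =>
    intro w hw
    rw [Function.iterate_succ_apply]
    apply ih
    by_contra! hc
    have h1 : 1 ≤ ((Um F).symm w).1 := by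
      have : (0 : ℝ) ≤ n := n.cast_nonneg
      linarith
    have h2 := Um_right hd h1
    rw [Homeomorph.apply_symm_apply] at h2
    have h3 := congrArg Prod.fst h2
    simp only [Prod.fst_add] at h3
    push_cast at hw
    linarith

lemma Phm_surj (hd : ∀ z, ‖F z - z‖ ≤ 0.1) : Function.Surjective (Phm F) := by
  intro w
  obtain ⟨n, hn⟩ := exists_nat_bd w.1
  have h1 := Um_back hd n w hn
  set y := (Um F).symm^[n] w with hy
  have hyw : (Um F)^[n] y = w := by
    have : Function.LeftInverse (Um F) (Um F).symm := (Um F).apply_symm_apply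
    exact this.iterate n w
  refine ⟨F.symm y + tv n, ?_⟩
  have h2 := abs_le.mp (hd1 (hds hd) y)
  rw [Phm_eq hd (n := n)]
  · simp only [Gm, add_sub_cancel_right, F.apply_symm_apply, hyw]
  · simp
    linarith

/-- normal form of the point -/
lemma Phm_form (hd : ∀ z, ‖F z - z‖ ≤ 0.1) (z : E2) : (Phm F z = F z ∧ z.1 ≤ 2.3) ∨
    ∃ y : E2, 0.3 < y.1 ∧ y.1 ≤ 2.3 ∧ y.2 = z.2 ∧ Phm F z - z = Um F (F y) - y - (2, 0) := by
  rcases le_or_gt z.1 2.3 with hz | hz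
  · exact Or.inl ⟨Phm_left hd hz, hz⟩
  · right
    have h1 : 0 < (z.1 - 2.3) / 2 := by linarith
    obtain ⟨k, hk⟩ := Nat.exists_eq_succ_of_ne_zero (Nat.ceil_pos.mpr h1).ne'
    have h2 := Nat.ceil_lt_add_one h1.le
    have h3 := Nat.le_ceil ((z.1 - 2.3) / 2)
    rw [hk] at h2 h3
    push_cast at h2 h3
    have h4 : 0.3 < (z - tv (k + 1)).1 := by
      simp
      linarith
    have h5 : (z - tv (k + 1)).1 ≤ 2.3 := by
      simp
      linarith
    refine ⟨z - tv (k + 1), h4, h5, by simp, ?_⟩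
    have h6 : 1 ≤ (Um F (F (z - tv (k + 1)))).1 := by
      have h8 := abs_le.mp (hd1 hd (z - tv (k + 1)))
      have := Um_ge hd (z := F (z - tv (k + 1))) (by linarith)
      linarith
    rw [Phm_eq hd (n := k + 1), Gm, Function.iterate_succ_apply, Um_iter hd h6, tv_succ]
    · abel
    · push_cast
      linarith

lemma Phm_disp2 (hd : ∀ z, ‖F z - z‖ ≤ 0.1) (z : E2) : |(Phm F z).2 - z.2| ≤ 0.3 := by
  rcases Phm_form hd z with ⟨h, -⟩ | ⟨y, -, -, h3, h4⟩
  · rw [h]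
    exact (hd2 hd z).trans (by norm_num)
  · have h5 := congrArg Prod.snd h4
    simp only [Prod.snd_sub, sub_zero] at h5
    rw [h5]
    have h6 := abs_le.mp (Um_disp2 hd (F y))
    have h7 := abs_le.mp (hd2 hd y)
    rw [abs_le]
    constructor <;> linarith

lemma Phm_disp (hd : ∀ z, ‖F z - z‖ ≤ 0.1) (z : E2) : ‖Phm F z - z‖ ≤ 7 := by
  rw [Prod.norm_def, max_le_iff]
  refine ⟨?_, (Phm_disp2 hd z).trans (by norm_num)⟩
  rcases Phm_form hd z with ⟨h, -⟩ | ⟨y, -, -, h3, h4⟩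
  · rw [h]
    exact (hd1 hd z).trans (by norm_num)
  · rw [h4]
    simp only [Prod.fst_sub, Real.norm_eq_abs]
    have h6 := abs_le.mp (Um_disp1 hd (F y))
    have h7 := abs_le.mp (hd1 hd y)
    rw [abs_le]
    constructor <;> linarith

noncomputable def PhH (hd : ∀ z, ‖F z - z‖ ≤ 0.1) : E2 ≃ₜ E2 :=
  mkHomeo (Phm F) (Phm_cont hd) ⟨Phm_inj hd, Phm_surj hd⟩ 7 (Phm_disp hd)

lemma PhH_apply (hd : ∀ z, ‖F z - z‖ ≤ 0.1) (z : E2) : PhH hd z = Phm F z := rfl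

lemma Phm_fix (hd : ∀ z, ‖F z - z‖ ≤ 0.1) (hid : ∀ z : E2, |z.1| ≤ 4 → 1 ≤ |z.2| → |z.2| ≤ 8 → F z = z) {z : E2}
    (h0 : -4 ≤ z.1) (h1 : 1 ≤ |z.2|) (h2 : |z.2| ≤ 8) : Phm F z = z := by
  rcases le_or_gt z.1 2.3 with hz | hz
  · rw [Phm_left hd hz]
    exact hid z (abs_le.mpr ⟨h0, by linarith⟩) h1 h2
  rcases Phm_form hd z with h | ⟨y, g1, g2, g3, g4⟩
  · linarith [h.2]
  · rw [← sub_eq_zero, g4, sub_sub, sub_eq_zero]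
    rw [hid y (abs_le.mpr ⟨by linarith, by linarith⟩) (by rwa [g3]) (by rwa [g3])]
    rcases le_or_gt 1 y.1 with h6 | h6
    · exact Um_right hd h6
    · have h7 := sl_disp y.1
      have h8 : F.symm (hat sl y) = hat sl y := by
        rw [Homeomorph.symm_apply_eq]
        symm
        apply hid
        · simp only [hat_fst]
          exact abs_le.mpr ⟨by linarith, by linarith⟩
        · rwa [hat_snd, g3]
        · rwa [hat_snd, g3]
      have h9 : hat rl (hat sl y) = y + (2, 0) := by
        ext
        · simp [rl_sl]
        · simp
      rw [Um_apply, h8, h9]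
      apply hid
      · simp only [Prod.fst_add]
        exact abs_le.mpr ⟨by linarith, by linarith⟩
      · simpa [g3] using h1
      · simpa [g3] using h2

end handle

end TorusIso


namespace TorusIso

open Filter Topology Set

noncomputable def mir : E2 ≃ₜ E2 := (Homeomorph.neg ℝ).prodCongr (Homeomorph.refl ℝ)

@[simp] lemma mir_fst (z : E2) : (mir z).1 = -z.1 := rfl
@[simp] lemma mir_snd (z : E2) : (mir z).2 = z.2 := rfl
@[simp] lemma mir_mir (z : E2) : mir (mir z) = z := by ext <;> simp

lemma mir_sub (z w : E2) : mir (z - w) = mir z - mir w := by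
  ext
  · simp; ring
  · simp

lemma norm_mir (z : E2) : ‖mir z‖ = ‖z‖ := by
  simp [Prod.norm_def]

/-- the handle lemma, in scaled coordinates -/
lemma handle (F : E2 ≃ₜ E2) (hd : ∀ z, ‖F z - z‖ ≤ 0.1)
    (hid : ∀ z : E2, |z.1| ≤ 4 → 1 ≤ |z.2| → |z.2| ≤ 8 → F z = z) :
    ∃ g : E2 ≃ₜ E2, (∀ z, g z ≠ z → |z.1| < 3 ∧ |z.2| ≤ 1) ∧
      (∀ z : E2, |z.1| ≤ 1.4 → |z.2| ≤ 1 → g z = F z) := by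
  -- mirror image
  set F' : E2 ≃ₜ E2 := mir.trans (F.trans mir) with hF'
  have F'_apply : ∀ z, F' z = mir (F (mir z)) := fun z => rfl
  have hd' : ∀ z, ‖F' z - z‖ ≤ 0.1 := by
    intro z
    rw [F'_apply, ← norm_mir, mir_sub, mir_mir]
    exact hd _
  have hid' : ∀ z : E2, |z.1| ≤ 4 → 1 ≤ |z.2| → |z.2| ≤ 8 → F' z = z := by
    intro z h1 h2 h3
    rw [F'_apply, hid _ (by simpa using h1) (by simpa using h2) (by simpa using h3), mir_mir]
  set Ψ : E2 ≃ₜ E2 := mir.trans ((PhH hd').trans mir) with hΨ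
  have Ψ_apply : ∀ z, Ψ z = mir (Phm F' (mir z)) := fun z => rfl
  have Ψ_right : ∀ z : E2, -2.3 ≤ z.1 → Ψ z = F z := by
    intro z hz
    rw [Ψ_apply, Phm_left hd' (by simp; linarith), F'_apply, mir_mir, mir_mir]
  have Ψ_fix : ∀ z : E2, z.1 ≤ 4 → 1 ≤ |z.2| → |z.2| ≤ 8 → Ψ z = z := by
    intro z h1 h2 h3
    rw [Ψ_apply, Phm_fix hd' hid' (by simp; linarith) (by simpa using h2) (by simpa using h3),
      mir_mir]
  have Ψ_disp : ∀ z, ‖Ψ z - z‖ ≤ 7 := by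
    intro z
    rw [Ψ_apply, ← norm_mir, mir_sub, mir_mir]
    exact Phm_disp hd' _
  have Ψ_disp2 : ∀ z, |(Ψ z).2 - z.2| ≤ 0.3 := by
    intro z
    have := Phm_disp2 hd' (mir z)
    simpa [Ψ_apply] using this
  set Φ : E2 ≃ₜ E2 := Ψ.trans (F.symm.trans (PhH hd)) with hΦ
  have Φ_apply : ∀ z, Φ z = Phm F (F.symm (Ψ z)) := fun z => rfl
  have Φ_mid : ∀ z : E2, |z.1| ≤ 2 → Φ z = F z := by
    intro z hz
    rw [abs_le] at hz
    rw [Φ_apply, Ψ_right z (by linarith), F.symm_apply_apply, Phm_left hd (by linarith)]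
  have Φ_fix : ∀ z : E2, 1 ≤ |z.2| → |z.2| ≤ 8 → Φ z = z := by
    intro z h1 h2
    rcases le_or_gt (-2.3) z.1 with h | h
    · rw [Φ_apply, Ψ_right z h, F.symm_apply_apply, Phm_fix hd hid (by linarith) h1 h2]
    · have h3 := abs_le.mp (hd1 (hds hd) z)
      rw [Φ_apply, Ψ_fix z (by linarith) h1 h2, Phm_left hd (by linarith), F.apply_symm_apply]
  have Φ_disp : ∀ z, ‖Φ z - z‖ ≤ 15 := by
    intro z
    have h1 := Ψ_disp z
    have h2 := hds hd (Ψ z)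
    have h3 := Phm_disp hd (F.symm (Ψ z))
    have : Φ z - z = (Phm F (F.symm (Ψ z)) - F.symm (Ψ z)) + (F.symm (Ψ z) - Ψ z) + (Ψ z - z) := by
      rw [Φ_apply]; abel
    rw [this]
    refine (norm_add₃_le).trans ?_
    linarith
  have Φ_disp2 : ∀ z, |(Φ z).2 - z.2| ≤ 1 := by
    intro z
    have h1 := abs_le.mp (Ψ_disp2 z)
    have h2 := abs_le.mp (hd2 (hds hd) (Ψ z))
    have h3 := abs_le.mp (Phm_disp2 hd (F.symm (Ψ z)))
    rw [Φ_apply, abs_le]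
    constructor <;> linarith
  -- Φ preserves the band
  have band : ∀ z, |(Φ z).2| ≤ 1 ↔ |z.2| ≤ 1 := by
    intro z
    constructor
    · intro h
      by_contra! hc
      have h1 : |z.2| ≤ 8 := by
        have h2 := Φ_disp2 z
        have h3 := abs_sub_abs_le_abs_sub z.2 (Φ z).2
        rw [abs_sub_comm] at h3
        linarith
      rw [Φ_fix z hc.le h1] at h
      linarith
    · intro h
      by_contra! hc
      have h1 : |(Φ z).2| ≤ 8 := by
        have h2 := Φ_disp2 z
        have h3 := abs_sub_abs_le_abs_sub (Φ z).2 z.2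
        linarith
      have h2 := Φ.injective (Φ_fix (Φ z) hc.le h1)
      rw [h2] at hc
      linarith
  set Φ3 : E2 → E2 := fun z => if |z.2| ≤ 1 then Φ z else z with hΦ3
  have Φ3_in : ∀ z : E2, |z.2| ≤ 1 → Φ3 z = Φ z := fun z h => if_pos h
  have Φ3_out : ∀ z : E2, ¬ |z.2| ≤ 1 → Φ3 z = z := fun z h => if_neg h
  have Φ3_cont : Continuous Φ3 := by
    refine Continuous.if_le Φ.continuous continuous_id (by fun_prop) continuous_const ?_
    intro z hz
    exact Φ_fix z hz.ge (by rw [hz]; norm_num)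
  have Φ3_bij : Function.Bijective Φ3 := by
    constructor
    · intro z w h
      by_cases hz : |z.2| ≤ 1 <;> by_cases hw : |w.2| ≤ 1
      · rw [Φ3_in z hz, Φ3_in w hw] at h
        exact Φ.injective h
      · rw [Φ3_in z hz, Φ3_out w hw] at h
        rw [← h, band] at hw
        exact absurd hz hw
      · rw [Φ3_out z hz, Φ3_in w hw] at h
        rw [h, band] at hz
        exact absurd hw hz
      · rwa [Φ3_out z hz, Φ3_out w hw] at h
    · intro w
      by_cases hw : |w.2| ≤ 1
      · obtain ⟨z, rfl⟩ := Φ.surjective w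
        exact ⟨z, Φ3_in z ((band z).mp hw)⟩
      · exact ⟨w, Φ3_out w hw⟩
  have Φ3_disp : ∀ z, ‖Φ3 z - z‖ ≤ 15 := by
    intro z
    by_cases hz : |z.2| ≤ 1
    · rw [Φ3_in z hz]; exact Φ_disp z
    · rw [Φ3_out z hz]; simp
  obtain ⟨Φ4, hΦ4⟩ : ∃ Φ4 : E2 ≃ₜ E2, ∀ z, Φ4 z = Φ3 z :=
    ⟨mkHomeo Φ3 Φ3_cont Φ3_bij 15 Φ3_disp, fun z => rfl⟩
  set q : E2 → ℝ := fun z => |z.1| with hq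
  have hq1 : ∀ z z' : E2, |q z' - q z| ≤ ‖z' - z‖ := fun z z' =>
    (abs_abs_sub_abs_le _ _).trans (abs_fst_le (z' - z))
  have hqh : ∀ c : ℝ, 0 ≤ c → ∀ z, q (c • z) = c * q z := by
    intro c hc z
    simp [q, abs_mul, abs_of_nonneg hc]
  have hqc : Continuous q := by fun_prop
  have hγ : IsOpenEmbedding (cmp q 1.5 3) := cmp_openEmb hqc hqh (by norm_num) (by norm_num)
  have ht := tendsto_cmp (q := q) (a := 1.5) (b := 3) hq1 (by norm_num) (by norm_num) (Φ := Φ4)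
    (C := 15) (R := 2) (fun z => by rw [hΦ4]; exact Φ3_disp z) (by
      intro z hz
      by_cases h : |z.2| ≤ 1
      · right
        rw [Prod.norm_def, Real.norm_eq_abs, Real.norm_eq_abs] at hz ⊢
        rcases le_total |z.1| |z.2| with h1 | h1
        · rw [max_eq_right h1] at hz
          linarith
        · rw [max_eq_left h1]
      · left
        rw [hΦ4, Φ3_out z h])
  refine ⟨extHomeo (cmp q 1.5 3) Φ4 hγ ht, ?_, ?_⟩
  · intro z hz
    rw [extHomeo_apply] at hz
    have h1 : z ∈ range (cmp q 1.5 3) := by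
      by_contra hc
      exact hz (ext0_not hc)
    obtain ⟨y, rfl⟩ := h1
    refine ⟨q_cmp_lt hqh (by norm_num) (by norm_num) y, ?_⟩
    rw [ext0_mem hγ.injective] at hz
    have h2 : |y.2| ≤ 1 := by
      by_contra hc
      apply hz
      rw [hΦ4, Φ3_out y hc]
    have h3 := mu_pos (q := q) (a := 1.5) (b := 3) (by norm_num) y
    have h4 := mu_le_one (q := q) (a := 1.5) (b := 3) (by norm_num) y
    change |mu q 1.5 3 y * y.2| ≤ 1
    rw [abs_mul, abs_of_pos h3]
    have := abs_nonneg y.2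
    nlinarith
  · intro z h1 h2
    rw [extHomeo_apply]
    have h3 : cmp q 1.5 3 z = z := cmp_id (by norm_num) (by simp only [q]; linarith)
    conv_lhs => rw [← h3]
    rw [ext0_mem hγ.injective, hΦ4, Φ3_in z h2, Φ_mid z (by linarith)]
    apply cmp_id (by norm_num)
    have h4 := hd1 hd z
    have h5 := abs_sub_abs_le_abs_sub (F z).1 z.1
    simp only [q]
    linarith

/-- homeomorphism fixing the vertical integer lines preserves the strips -/
lemma strip_aux {F : E2 → E2} (hF : Continuous F) (hi : Function.Injective F)
    (hl : ∀ z : E2, z.1 = 0 ∨ z.1 = 1 → F z = z) {z : E2} (h0 : 0 ≤ z.1) (h1 : z.1 ≤ 1) :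
    0 ≤ (F z).1 ∧ (F z).1 ≤ 1 := by
  have key : ∀ w : E2, 0 < w.1 → w.1 < 1 → (F w).1 ≠ 0 ∧ (F w).1 ≠ 1 := by
    intro w hw0 hw1
    constructor
    · intro h
      have := hi (hl (F w) (Or.inl h))
      rw [this] at h
      linarith
    · intro h
      have := hi (hl (F w) (Or.inr h))
      rw [this] at h
      linarith
  rcases h0.eq_or_lt with h0 | h0
  · rw [hl z (Or.inl h0.symm), ← h0]
    norm_num
  rcases h1.eq_or_lt with h1 | h1
  · rw [hl z (Or.inr h1), h1]
    norm_num
  set φ : ℝ → ℝ := fun t => (F (t, z.2)).1 with hφ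
  have hc : Continuous φ := by fun_prop
  have hφ0 : φ 0 = 0 := by simp [φ, hl (0, z.2) (Or.inl rfl)]
  have hφ1 : φ 1 = 1 := by simp [φ, hl (1, z.2) (Or.inr rfl)]
  constructor
  · by_contra! hcon
    have h3 : (0 : ℝ) ∈ Icc (φ z.1) (φ 1) := ⟨hcon.le, by rw [hφ1]; norm_num⟩
    obtain ⟨t, ht, ht2⟩ := intermediate_value_Icc h1.le hc.continuousOn h3
    have ht1 : t < 1 := by
      rcases ht.2.eq_or_lt with h | h
      · rw [h, hφ1] at ht2; norm_num at ht2
      · exact h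
    exact (key (t, z.2) (lt_of_lt_of_le h0 ht.1) ht1).1 ht2
  · by_contra! hcon
    have h3 : (1 : ℝ) ∈ Icc (φ 0) (φ z.1) := ⟨by rw [hφ0]; norm_num, hcon.le⟩
    obtain ⟨t, ht, ht2⟩ := intermediate_value_Icc h0.le hc.continuousOn h3
    have ht1 : 0 < t := by
      rcases ht.1.eq_or_lt with h | h
      · rw [← h, hφ0] at ht2; norm_num at ht2
      · exact h
    exact (key (t, z.2) ht1 (lt_of_le_of_lt ht.2 h1)).2 ht2

/-- a homeomorphism fixing the grid is trivial -/
lemma triv_of_grid (F : E2 ≃ₜ E2) (hE : Equi F)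
    (h1 : ∀ z : E2, z.1 = 0 ∨ z.1 = 1 → F z = z) (h2 : ∀ z : E2, z.2 = 0 ∨ z.2 = 1 → F z = z) :
    Triv F := by
  set c : E2 := (1 / 2, 1 / 2) with hc
  have swapF : ∀ G : E2 ≃ₜ E2, (∀ z : E2, z.1 = 0 ∨ z.1 = 1 → G z = z) →
      (∀ z : E2, z.2 = 0 ∨ z.2 = 1 → G z = z) → ∀ z : E2, ‖z - c‖ ≤ 1 / 2 → ‖G z - c‖ ≤ 1 / 2 := by
    intro G g1 g2 z hz
    rw [Prod.norm_def, max_le_iff] at hz ⊢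
    simp only [c, Prod.fst_sub, Prod.snd_sub, Real.norm_eq_abs, abs_le] at hz ⊢
    obtain ⟨⟨a1, a2⟩, a3, a4⟩ := hz
    have k1 := strip_aux G.continuous G.injective g1 (z := z) (by linarith) (by linarith)
    have k2 := strip_aux (F := fun w => (G w.swap).swap) (by fun_prop)
      (fun a b h => by
        have := Prod.swap_injective h
        exact Prod.swap_injective (G.injective this))
      (fun w hw => by
        rw [g2 w.swap hw, Prod.swap_swap]) (z := z.swap) (by simp; linarith) (by simp; linarith)
    simp only [Prod.swap_swap, Prod.fst_swap] at k2
    refine ⟨⟨by linarith, by linarith⟩, by linarith, by linarith⟩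
  have sym1 : ∀ z : E2, z.1 = 0 ∨ z.1 = 1 → F.symm z = z := by
    intro z hz
    rw [Homeomorph.symm_apply_eq, h1 z hz]
  have sym2 : ∀ z : E2, z.2 = 0 ∨ z.2 = 1 → F.symm z = z := by
    intro z hz
    rw [Homeomorph.symm_apply_eq, h2 z hz]
  have P1 := swapF F h1 h2
  have P2 := swapF F.symm sym1 sym2
  set h : E2 → E2 := fun z => if ‖z‖ ≤ 1 / 2 then F (z + c) - c else z with hh
  have h_in : ∀ z : E2, ‖z‖ ≤ 1 / 2 → h z = F (z + c) - c := fun z hz => if_pos hz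
  have h_out : ∀ z : E2, ¬ ‖z‖ ≤ 1 / 2 → h z = z := fun z hz => if_neg hz
  have bd : ∀ z : E2, ‖z‖ = 1 / 2 → F (z + c) - c = z := by
    intro z hz
    rw [sub_eq_iff_eq_add]
    rw [Prod.norm_def, Real.norm_eq_abs, Real.norm_eq_abs] at hz
    rcases max_choice |z.1| |z.2| with hm | hm
    · rw [hm] at hz
      apply h1
      simp only [c, Prod.fst_add]
      rcases (abs_eq (by norm_num)).mp hz with h | h
      · right; linarith
      · left; linarith
    · rw [hm] at hz
      apply h2
      simp only [c, Prod.snd_add]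
      rcases (abs_eq (by norm_num)).mp hz with h | h
      · right; linarith
      · left; linarith
  have hcont : Continuous h := by
    refine Continuous.if_le (by fun_prop) continuous_id continuous_norm continuous_const ?_
    intro z hz
    exact bd z hz
  have hsupp : Supp h := by
    intro z hz
    rcases hz.eq_or_lt with hz | hz
    · rw [h_in z hz.ge, bd z hz.symm]
    · exact h_out z (not_le.mpr hz)
  have band : ∀ z : E2, ‖z‖ ≤ 1 / 2 ↔ ‖F (z + c) - c‖ ≤ 1 / 2 := by
    intro z
    constructor
    · intro hz
      exact P1 _ (by simpa using hz)
    · intro hz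
      have := P2 _ hz
      simpa using this
  have hbij : Function.Bijective h := by
    constructor
    · intro z w e
      by_cases hz : ‖z‖ ≤ 1 / 2 <;> by_cases hw : ‖w‖ ≤ 1 / 2
      · rw [h_in z hz, h_in w hw] at e
        have := F.injective (sub_left_injective e)
        exact add_right_cancel this
      · rw [h_in z hz, h_out w hw] at e
        rw [← e, ← band] at hw
        exact absurd hz hw
      · rw [h_out z hz, h_in w hw] at e
        rw [e, ← band] at hz
        exact absurd hw hz
      · rwa [h_out z hz, h_out w hw] at e
    · intro w
      by_cases hw : ‖w‖ ≤ 1 / 2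
      · have e : F (F.symm (w + c) - c + c) - c = w := by simp
        refine ⟨F.symm (w + c) - c, ?_⟩
        rw [h_in _ ((band _).mpr (by rwa [e])), e]
      · exact ⟨w, h_out w hw⟩
  refine ((triv_per hcont hbij hsupp).conj_add c).congr (fun z => ?_)
  have hr := norm_sub_rnd (z - c)
  rw [per_eq hsupp hr, h_in _ hr]
  have e := hE (z - c - lat (rnd (z - c)) + c) (rnd (z - c))
  rw [show z - c - lat (rnd (z - c)) + c + lat (rnd (z - c)) = z by abel] at e
  rw [e]
  abel

end TorusIso


namespace TorusIso

open Filter Topology Set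

lemma step_zero (F : E2 ≃ₜ E2) (hE : Equi F) (hd : ∀ z, ‖F z - z‖ ≤ 0.001) :
    ∃ F1 : E2 ≃ₜ E2, Equi F1 ∧ (∀ z, ‖F1 z - z‖ ≤ 0.003) ∧
      (∀ z n, ‖z - lat n‖ ≤ 0.4 → F1 z = z) ∧ (Triv F1 → Triv F) := by
  set q : E2 → ℝ := fun z => ‖z‖ with hq
  have hq1 : ∀ z z' : E2, |q z' - q z| ≤ ‖z' - z‖ := fun z z' => abs_norm_sub_norm_le z' z
  have hqh : ∀ c : ℝ, 0 ≤ c → ∀ z, q (c • z) = c * q z := by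
    intro c hc z
    simp only [q]
    rw [norm_smul, Real.norm_eq_abs, abs_of_nonneg hc]
  have hqc : Continuous q := continuous_norm
  have hγ : IsOpenEmbedding (cmp q 0.42 0.5) := cmp_openEmb hqc hqh (by norm_num) (by norm_num)
  have ht := tendsto_cmp (q := q) (a := 0.42) (b := 0.5) hq1 (by norm_num) (by norm_num) (Φ := F)
    (C := 0.001) (R := 0) hd (fun z _ => Or.inr le_rfl)
  set h : E2 ≃ₜ E2 := extHomeo (cmp q 0.42 0.5) F hγ ht with hh
  have h_apply : ∀ z, h z = ext0 (cmp q 0.42 0.5) F z := fun z => rfl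
  have hs : Supp h := by
    intro z hz
    rw [h_apply, ext0_not]
    rw [range_cmp hqh (by norm_num) (by norm_num)]
    simp only [mem_ofPred_eq, q, not_lt]
    linarith
  have h_in : ∀ z : E2, ‖z‖ ≤ 0.41 → h z = F z := by
    intro z hz
    have h3 : cmp q 0.42 0.5 z = z := cmp_id (by norm_num) (by simp only [q]; linarith)
    rw [h_apply]
    conv_lhs => rw [← h3]
    rw [ext0_mem hγ.injective]
    apply cmp_id (by norm_num)
    simp only [q]
    have := norm_sub_norm_le (F z) z
    have := hd z
    linarith
  have h_disp : ∀ z, ‖h z - z‖ ≤ 0.002 := by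
    intro z
    rw [h_apply]
    by_cases hz : z ∈ range (cmp q 0.42 0.5)
    · obtain ⟨y, rfl⟩ := hz
      rw [ext0_mem hγ.injective]
      refine (cmp_sub_le hq1 (by norm_num) (by norm_num) (z := y) (z' := F y) le_rfl).trans ?_
      have h1 := mu_le_one (q := q) (a := 0.42) (b := 0.5) (by norm_num) (F y)
      have h2 := mu_pos (q := q) (a := 0.42) (b := 0.5) (by norm_num) (F y)
      have h3 := hd y
      have h4 := norm_nonneg (F y - y)
      nlinarith
    · rw [ext0_not hz, sub_self, norm_zero]
      norm_num
  have P_disp : ∀ z, ‖Per h z - z‖ ≤ 0.002 := by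
    intro z
    rw [per_eq hs (norm_sub_rnd z)]
    rw [show h (z - lat (rnd z)) + lat (rnd z) - z = h (z - lat (rnd z)) - (z - lat (rnd z)) by abel]
    exact h_disp _
  set P := perHomeo h hs with hP
  have P_apply : ∀ z, P z = Per h z := fun z => rfl
  have PE : Equi P := per_equi hs
  refine ⟨P.symm.trans F, hE.comp PE.symm, ?_, ?_, ?_⟩
  · intro z
    obtain ⟨w, rfl⟩ := P.surjective z
    simp only [Homeomorph.trans_apply, Homeomorph.symm_apply_apply]
    have h1 := hd w
    have h2 := P_disp w
    rw [← P_apply] at h2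
    have := norm_sub_le (F w - w) (P w - w)
    rw [show F w - w - (P w - w) = F w - P w by abel] at this
    linarith
  · intro z n hz
    set w := F.symm z with hw
    have hz2 : F w = z := F.apply_symm_apply z
    have h1 := hd w
    rw [hz2] at h1
    have h2 : ‖w - lat n‖ ≤ 0.41 := by
      have := norm_sub_le (z - lat n) (z - w)
      rw [show z - lat n - (z - w) = w - lat n by abel] at this
      linarith
    have h3 : P w = z := by
      rw [P_apply, per_eq (n := n) hs (by linarith), h_in _ h2]
      have := hE (w - lat n) n
      rw [sub_add_cancel] at this
      rw [← this, hz2]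
    simp only [Homeomorph.trans_apply]
    rw [show P.symm z = w by rw [Homeomorph.symm_apply_eq, h3], hz2]
  · intro hT
    exact Triv.of_comp_symm (F := F) (G := P) hT (triv_perHomeo h hs)

lemma step_one (F : E2 ≃ₜ E2) (hE : Equi F) (hd : ∀ z, ‖F z - z‖ ≤ 0.003)
    (hid : ∀ z n, ‖z - lat n‖ ≤ 0.4 → F z = z) :
    ∃ P : E2 ≃ₜ E2, Equi P ∧ Triv P ∧ (∀ z : E2, P z ≠ z → ∃ n : ℤ, |z.2 - 1 / 2 - n| ≤ 0.1) ∧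
      (∀ z : E2, ∀ n : ℤ, |z.1 - n| ≤ 0.14 → P z = F z) := by
  set c : E2 := (0, 1 / 2) with hc
  set s : E2 ≃ₜ E2 := Homeomorph.smulOfNeZero (10 : ℝ) (by norm_num) with hs
  have s_apply : ∀ z, s z = (10 : ℝ) • z := fun z => rfl
  have ss_apply : ∀ z, s.symm z = (10 : ℝ)⁻¹ • z := fun z => rfl
  set Ft : E2 ≃ₜ E2 := s.symm.trans ((Homeomorph.addRight c).trans
    (F.trans ((Homeomorph.addRight (-c)).trans s))) with hFt
  have Ft_apply : ∀ z, Ft z = (10 : ℝ) • (F ((10 : ℝ)⁻¹ • z + c) + -c) := fun z => rfl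
  obtain ⟨g, g1, g2⟩ := handle Ft (by
    intro z
    have h1 := hd ((10 : ℝ)⁻¹ • z + c)
    have h2 : Ft z - z = (10 : ℝ) • (F ((10 : ℝ)⁻¹ • z + c) - ((10 : ℝ)⁻¹ • z + c)) := by
      rw [Ft_apply]
      simp only [smul_add, smul_sub, smul_neg, smul_inv_smul₀ (by norm_num : (10 : ℝ) ≠ 0)]
      abel
    rw [h2, norm_smul, Real.norm_eq_abs, abs_of_pos (by norm_num)]
    linarith) (by
    intro z h1 h2 h3
    have h4 : F ((10 : ℝ)⁻¹ • z + c) = (10 : ℝ)⁻¹ • z + c := by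
      have e1 : ((10 : ℝ)⁻¹ • z + c).1 = z.1 / 10 := by
        change (10 : ℝ)⁻¹ * z.1 + 0 = _
        ring
      have e2 : ((10 : ℝ)⁻¹ • z + c).2 = z.2 / 10 + 1 / 2 := by
        change (10 : ℝ)⁻¹ * z.2 + 1 / 2 = _
        ring
      rw [abs_le] at h1 h3
      rcases le_total 0 z.2 with h | h
      · rw [abs_of_nonneg h] at h2
        apply hid _ (0, 1)
        rw [Prod.norm_def, max_le_iff]
        simp only [Prod.fst_sub, Prod.snd_sub, e1, e2, lat, Real.norm_eq_abs, abs_le]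
        push_cast
        refine ⟨⟨?_, ?_⟩, ?_, ?_⟩ <;> linarith
      · rw [abs_of_nonpos h] at h2
        apply hid _ (0, 0)
        rw [Prod.norm_def, max_le_iff]
        simp only [Prod.fst_sub, Prod.snd_sub, e1, e2, lat, Real.norm_eq_abs, abs_le]
        push_cast
        refine ⟨⟨?_, ?_⟩, ?_, ?_⟩ <;> linarith
    rw [Ft_apply, h4, add_neg_cancel_right, smul_inv_smul₀ (by norm_num : (10 : ℝ) ≠ 0)])
  set g0 : E2 ≃ₜ E2 := s.trans (g.trans s.symm) with hg0
  have g0_apply : ∀ z, g0 z = (10 : ℝ)⁻¹ • g ((10 : ℝ) • z) := fun z => rfl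
  have g0_fix : ∀ z : E2, g0 z ≠ z → |z.1| < 0.3 ∧ |z.2| ≤ 0.1 := by
    intro z hz
    have h1 := g1 ((10 : ℝ) • z) (by
      intro h
      apply hz
      rw [g0_apply, h, inv_smul_smul₀ (by norm_num : (10 : ℝ) ≠ 0)])
    have e1 : |((10 : ℝ) • z).1| = 10 * |z.1| := by
      change |10 * z.1| = _
      rw [abs_mul, abs_of_pos (by norm_num : (0 : ℝ) < 10)]
    have e2 : |((10 : ℝ) • z).2| = 10 * |z.2| := by
      change |10 * z.2| = _
      rw [abs_mul, abs_of_pos (by norm_num : (0 : ℝ) < 10)]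
    rw [e1, e2] at h1
    exact ⟨by linarith [h1.1], by linarith [h1.2]⟩
  have g0_eq : ∀ z : E2, |z.1| ≤ 0.14 → |z.2| ≤ 0.1 → g0 z = F (z + c) - c := by
    intro z h1 h2
    have e1 : |((10 : ℝ) • z).1| = 10 * |z.1| := by
      change |10 * z.1| = _
      rw [abs_mul, abs_of_pos (by norm_num : (0 : ℝ) < 10)]
    have e2 : |((10 : ℝ) • z).2| = 10 * |z.2| := by
      change |10 * z.2| = _
      rw [abs_mul, abs_of_pos (by norm_num : (0 : ℝ) < 10)]
    rw [g0_apply, g2 _ (by rw [e1]; linarith) (by rw [e2]; linarith), Ft_apply,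
      inv_smul_smul₀ (by norm_num : (10 : ℝ) ≠ 0), inv_smul_smul₀ (by norm_num : (10 : ℝ) ≠ 0)]
    abel
  have hsupp : Supp g0 := by
    intro z hz
    by_contra hcon
    obtain ⟨h1, h2⟩ := g0_fix z hcon
    rw [Prod.norm_def, Real.norm_eq_abs, Real.norm_eq_abs] at hz
    have : max |z.1| |z.2| ≤ 0.3 := max_le h1.le (by linarith)
    linarith
  set P : E2 ≃ₜ E2 := (Homeomorph.addRight (-c)).trans ((perHomeo g0 hsupp).trans
    (Homeomorph.addRight c)) with hP
  have P_apply : ∀ z, P z = Per g0 (z - c) + c := by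
    intro z
    rw [sub_eq_add_neg]
    rfl
  have PT : Triv P := ((triv_perHomeo g0 hsupp).conj_add c).congr (fun z => (P_apply z).symm)
  have PE : Equi P := by
    intro z n
    rw [P_apply, P_apply, show z + lat n - c = z - c + lat n by abel, per_equi hsupp]
    abel
  refine ⟨P, PE, PT, ?_, ?_⟩
  · intro z hz
    by_contra! hcon
    apply hz
    rw [P_apply, per_fix, sub_add_cancel]
    intro n
    by_contra h
    have := (g0_fix _ h).2
    have h2 := hcon n.2
    simp only [c, lat, Prod.snd_sub] at this
    linarith
  · intro z n hn
    set m : ℤ × ℤ := (n, round (z.2 - 1 / 2)) with hm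
    set y : E2 := z - c - lat m with hy
    have y1 : y.1 = z.1 - n := by simp [y, c, lat, m]
    have y2 : y.2 = z.2 - 1 / 2 - (round (z.2 - 1 / 2) : ℤ) := by simp [y, c, lat, m]
    have hy1 : |y.1| ≤ 0.14 := by rwa [y1]
    have hy2 : |y.2| ≤ 1 / 2 := by rw [y2]; exact abs_sub_round _
    have hyn : ‖y‖ ≤ 1 / 2 := by
      rw [Prod.norm_def]
      exact max_le (hy1.trans (by norm_num)) hy2
    rw [P_apply, per_eq hsupp hyn]
    have hz : z = y + c + lat m := by simp only [y]; abel
    change g0 y + lat m + c = F z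
    by_cases h : |y.2| ≤ 0.1
    · rw [g0_eq y hy1 h, hz, hE]
      abel
    · have h3 : g0 y = y := by
        by_contra hcon
        exact h (g0_fix y hcon).2
      rw [h3]
      push Not at h
      have : F (y + c) = y + c := by
        have e2 : (y + c).2 = y.2 + 1 / 2 := rfl
        have e1 : (y + c).1 = y.1 := by simp [c]
        rw [abs_le] at hy1 hy2
        rcases le_total 0 y.2 with h4 | h4
        · rw [abs_of_nonneg h4] at h
          apply hid _ (0, 1)
          rw [Prod.norm_def, max_le_iff]
          simp only [Prod.fst_sub, Prod.snd_sub, e1, e2, lat, Real.norm_eq_abs, abs_le]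
          push_cast
          refine ⟨⟨?_, ?_⟩, ?_, ?_⟩ <;> linarith
        · rw [abs_of_nonpos h4] at h
          apply hid _ (0, 0)
          rw [Prod.norm_def, max_le_iff]
          simp only [Prod.fst_sub, Prod.snd_sub, e1, e2, lat, Real.norm_eq_abs, abs_le]
          push_cast
          refine ⟨⟨?_, ?_⟩, ?_, ?_⟩ <;> linarith
      rw [hz, hE, this]
      abel

/-- LOCAL: small equivariant homeomorphisms are trivial -/
theorem local_triv (F : E2 ≃ₜ E2) (hE : Equi F) (hd : ∀ z, ‖F z - z‖ ≤ 0.001) : Triv F := by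
  obtain ⟨F1, E1, d1, id1, T1⟩ := step_zero F hE hd
  apply T1
  obtain ⟨P, PE, PT, Pfix, Peq⟩ := step_one F1 E1 d1 id1
  -- swapped version
  set sw : E2 ≃ₜ E2 := Homeomorph.prodComm ℝ ℝ with hsw
  have sw_apply : ∀ z, sw z = z.swap := fun z => rfl
  set F1' : E2 ≃ₜ E2 := sw.trans (F1.trans sw) with hF1'
  have F1'_apply : ∀ z, F1' z = (F1 z.swap).swap := fun z => rfl
  have norm_swap : ∀ z : E2, ‖z.swap‖ = ‖z‖ := by
    intro z
    simp [Prod.norm_def, max_comm]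
  have lat_swap : ∀ n : ℤ × ℤ, (lat n).swap = lat n.swap := fun n => rfl
  have E1' : Equi F1' := by
    intro z n
    rw [F1'_apply, F1'_apply, Prod.swap_add, lat_swap, E1, Prod.swap_add, lat_swap, Prod.swap_swap]
  obtain ⟨Q', QE', QT', Qfix', Qeq'⟩ := step_one F1' E1' (by
    intro z
    rw [F1'_apply, ← norm_swap, Prod.swap_sub, Prod.swap_swap]
    exact d1 _) (by
    intro z n hz
    rw [F1'_apply, id1 z.swap n.swap, Prod.swap_swap]
    rwa [← lat_swap, ← Prod.swap_sub, norm_swap])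
  set Q : E2 ≃ₜ E2 := sw.trans (Q'.trans sw) with hQ
  have Q_apply : ∀ z, Q z = (Q' z.swap).swap := fun z => rfl
  have QT : Triv Q := QT'.conj_swap.congr (fun z => (Q_apply z).symm)
  have QE : Equi Q := by
    intro z n
    rw [Q_apply, Q_apply, Prod.swap_add, lat_swap, QE', Prod.swap_add, lat_swap, Prod.swap_swap]
  have Qfix : ∀ z : E2, Q z ≠ z → ∃ n : ℤ, |z.1 - 1 / 2 - n| ≤ 0.1 := by
    intro z hz
    have := Qfix' z.swap (by
      intro h
      apply hz
      rw [Q_apply, h, Prod.swap_swap])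
    simpa using this
  have Qeq : ∀ z : E2, ∀ n : ℤ, |z.2 - n| ≤ 0.14 → Q z = F1 z := by
    intro z n hz
    rw [Q_apply, Qeq' z.swap n (by simpa using hz), F1'_apply, Prod.swap_swap, Prod.swap_swap]
  -- composition
  have T2 : Triv (Q.symm.trans (P.symm.trans F1)) → Triv F1 := by
    intro h
    have h1 : Triv (P.symm.trans F1) := Triv.of_comp_symm (F := P.symm.trans F1) (G := Q) h QT
    exact Triv.of_comp_symm (F := F1) (G := P) h1 PT
  apply T2
  -- no half-integers
  have nohalf : ∀ (x : ℝ) (k : ℤ), |x - k| ≤ 0.1 → ∀ n : ℤ, ¬ |x - 1 / 2 - n| ≤ 0.1 := by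
    intro x k hx n hn
    rw [abs_le] at hx hn
    have h1 : (n : ℝ) < k := by linarith
    have h2 : (k : ℝ) < n + 1 := by linarith
    have h1' : n < k := by exact_mod_cast h1
    have h2' : k < n + 1 := by exact_mod_cast h2
    omega
  have Psym : ∀ (z : E2) (k : ℤ), |z.2 - k| ≤ 0.1 → P.symm z = z := by
    intro z k hz
    rw [Homeomorph.symm_apply_eq]
    by_contra h
    obtain ⟨n, hn⟩ := Pfix z (fun h' => h h'.symm)
    exact nohalf _ k hz n hn
  have Qsym : ∀ (z : E2) (k : ℤ), |z.1 - k| ≤ 0.1 → Q.symm z = z := by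
    intro z k hz
    rw [Homeomorph.symm_apply_eq]
    by_contra h
    obtain ⟨n, hn⟩ := Qfix z (fun h' => h h'.symm)
    exact nohalf _ k hz n hn
  have d1s : ∀ z, ‖F1.symm z - z‖ ≤ 0.003 := by
    intro z
    have := d1 (F1.symm z)
    rwa [F1.apply_symm_apply, norm_sub_rev] at this
  have vert : ∀ (z : E2) (k : ℤ), z.1 = k → (Q.symm.trans (P.symm.trans F1)) z = z := by
    intro z k hz
    have h1 : |(F1.symm z).1 - k| ≤ 0.14 := by
      rw [← hz]
      exact ((abs_fst_le (F1.symm z - z)).trans (d1s z)).trans (by norm_num)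
    have h2 : P.symm z = F1.symm z := by
      rw [Homeomorph.symm_apply_eq, Peq _ k h1, F1.apply_symm_apply]
    simp only [Homeomorph.trans_apply]
    rw [Qsym z k (by rw [hz]; norm_num), h2, F1.apply_symm_apply]
  have horiz : ∀ (z : E2) (k : ℤ), z.2 = k → (Q.symm.trans (P.symm.trans F1)) z = z := by
    intro z k hz
    have h1 : |(F1.symm z).2 - k| ≤ 0.003 := by
      rw [← hz]
      exact ((abs_snd_le (F1.symm z - z)).trans (d1s z))
    have h2 : Q.symm z = F1.symm z := by
      rw [Homeomorph.symm_apply_eq, Qeq _ k (by linarith), F1.apply_symm_apply]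
    simp only [Homeomorph.trans_apply]
    rw [h2, Psym _ k (by linarith), F1.apply_symm_apply]
  refine triv_of_grid _ ((E1.comp PE.symm).comp QE.symm) ?_ ?_
  · rintro z (h | h)
    · exact vert z 0 (by simpa using h)
    · exact vert z 1 (by simpa using h)
  · rintro z (h | h)
    · exact horiz z 0 (by simpa using h)
    · exact horiz z 1 (by simpa using h)

end TorusIso

namespace TorusIso
open Filter Topology Set

/-- hexagonal directions -/
def dd : Fin 6 → ℤ × ℤ := ![(1,0),(1,1),(0,1),(-1,0),(-1,-1),(0,-1)]

lemma dd_tri : ∀ i, dd i + dd (i+2) = dd (i+1) := by decide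
lemma dd_opp : ∀ i, dd (i+3) = - dd i := by decide

/-- number of cyclic sign changes -/
def chg (s : Fin 6 → Bool) (i : Fin 6) : ℕ := if s i = s (i+1) then 0 else 1

lemma chg_ge_two : ∀ s : Fin 6 → Bool, (∃ i, s i = true) → (∃ i, s i = false) → 2 ≤ ∑ i, chg s i := by
  decide

lemma chg_unique : ∀ s : Fin 6 → Bool, (∑ i, chg s i = 2) → ∃ i, (s i = true ∧ s (i+1) = false) ∧
    ∀ j, s j = true ∧ s (j+1) = false → j = i := by
  decide

lemma chg_spike : ∀ s : Fin 6 → Bool, (∑ i, chg s i = 2) → ∀ i, s i = true → s (i+1) = false → s (i+2) = true →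
    ∀ j, j ≠ i + 1 → s j = true := by
  decide

lemma chg_spike2 : ∀ s : Fin 6 → Bool, (∑ i, chg s i = 2) → ∀ i, s i = false → s (i+1) = true → s (i+2) = false →
    ∀ j, j ≠ i + 1 → s j = false := by
  decide

def det2 (a b : E2) : ℝ := a.1 * b.2 - a.2 * b.1
def dot2 (a b : E2) : ℝ := a.1 * b.1 + a.2 * b.2

lemma fin6_const (P : Fin 6 → Prop) (h : ∀ i, P i ↔ P (i+1)) : ∀ i j, P i ↔ P j := by
  have h0 := h 0
  have h1 := h 1
  have h2 := h 2
  have h3 := h 3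
  have h4 := h 4
  simp only [Fin.reduceAdd, zero_add] at h0 h1 h2 h3 h4
  intro i j
  fin_cases i <;> fin_cases j <;> simp <;> tauto

/-- Single-vertex sign property. -/
def Two (δ : Fin 6 → E2) : Prop := ∀ a b : E2, (det2 a b ≠ 0) → ∃ s : Fin 6 → Bool, (∑ i, chg s i = 2) ∧
  ∀ i, (0 < dot2 a (δ i) → s i = true) ∧ (dot2 a (δ i) < 0 → s i = false) ∧
    (dot2 a (δ i) = 0 → 0 < dot2 b (δ i) → s i = true) ∧ (dot2 a (δ i) = 0 → dot2 b (δ i) < 0 → s i = false)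

def Hull (δ : Fin 6 → E2) : Prop := ∀ a : E2, (∀ i, 0 ≤ dot2 a (δ i)) → ∀ i, dot2 a (δ i) = 0

lemma sq_pos_of_det {a b : E2} (h : det2 a b ≠ 0) : 0 < a.1^2 + a.2^2 := by
  rcases eq_or_ne a.1 0 with h1 | h1
  · rcases eq_or_ne a.2 0 with h2 | h2
    · exact absurd (by simp [det2, h1, h2]) h
    · positivity
  · positivity

lemma sign_const {δ : Fin 6 → E2} (hT : Two δ) (hH : Hull δ) (hd : ∀ i, det2 (δ i) (δ (i+1)) ≠ 0) :
    ∃ e : ℝ, (e = 1 ∨ e = -1) ∧ ∀ i, 0 < e * det2 (δ i) (δ (i+1)) := by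
  have key1 : ∀ i, 0 < det2 (δ i) (δ (i+1)) → 0 < det2 (δ (i+1)) (δ (i+1+1)) := by
    intro i hi
    by_contra hcon
    have hneg : det2 (δ (i+1)) (δ (i+1+1)) < 0 := lt_of_le_of_ne (not_lt.1 hcon) (hd _)
    have hsq := sq_pos_of_det (hd (i+1))
    set w := δ (i+1) with hw
    -- a x = det x w
    obtain ⟨s, hs, hs2⟩ := hT (w.2, -w.1) (-w.1, -w.2) (by
      simp only [det2]; nlinarith)
    have hz : ∀ x : E2, dot2 (w.2, -w.1) x = det2 x w := by intro x; simp only [dot2, det2]; ring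
    simp only [hz] at hs2
    have a1 := (hs2 i).1 hi
    have a3 := (hs2 (i+1+1)).1 (by simp only [det2] at hneg ⊢; linarith)
    have a2 := (hs2 (i+1)).2.2.2 (by rw [← hw]; simp only [det2]; ring) (by rw [← hw]; simp only [dot2]; nlinarith)
    have e2 : i+1+1 = i+2 := by rw [add_assoc]; rfl
    rw [e2] at a3
    have := chg_spike s hs i a1 a2 a3
    have hall : ∀ j, 0 ≤ dot2 (w.2, -w.1) (δ j) := by
      intro j
      rw [hz]
      by_cases hj : j = i+1
      · rw [hj, ← hw]; simp only [det2]; apply le_of_eq; ring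
      · by_contra hc
        have := this j hj
        rw [(hs2 j).2.1 (not_le.1 hc)] at this
        cases this
    have := hH _ hall i
    rw [hz] at this
    linarith
  have key2 : ∀ i, det2 (δ i) (δ (i+1)) < 0 → det2 (δ (i+1)) (δ (i+1+1)) < 0 := by
    intro i hi
    by_contra hcon
    have hneg : 0 < det2 (δ (i+1)) (δ (i+1+1)) := lt_of_le_of_ne (not_lt.1 hcon) (hd _).symm
    have hsq := sq_pos_of_det (hd (i+1))
    set w := δ (i+1) with hw
    obtain ⟨s, hs, hs2⟩ := hT (-w.2, w.1) (-w.1, -w.2) (by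
      simp only [det2]; nlinarith)
    have hz : ∀ x : E2, dot2 (-w.2, w.1) x = - det2 x w := by intro x; simp only [dot2, det2]; ring
    simp only [hz] at hs2
    have a1 := (hs2 i).1 (by linarith)
    have a3 := (hs2 (i+1+1)).1 (by simp only [det2] at hneg ⊢; linarith)
    have a2 := (hs2 (i+1)).2.2.2 (by rw [← hw]; simp only [det2]; ring) (by rw [← hw]; simp only [dot2]; nlinarith)
    have e2 : i+1+1 = i+2 := by rw [add_assoc]; rfl
    rw [e2] at a3
    have := chg_spike s hs i a1 a2 a3
    have hall : ∀ j, 0 ≤ dot2 (-w.2, w.1) (δ j) := by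
      intro j
      rw [hz]
      by_cases hj : j = i+1
      · rw [hj, ← hw]; simp only [det2]; apply le_of_eq; ring
      · by_contra hc
        have := this j hj
        rw [(hs2 j).2.1 (not_le.1 hc)] at this
        cases this
    have := hH _ hall i
    rw [hz] at this
    linarith
  have hc := fin6_const (fun i => 0 < det2 (δ i) (δ (i+1))) (by
    intro i
    refine ⟨key1 i, fun h => ?_⟩
    by_contra hc
    have := key2 i (lt_of_le_of_ne (not_lt.1 hc) (hd _))
    linarith)
  by_cases h0 : 0 < det2 (δ 0) (δ (0+1))
  · exact ⟨1, Or.inl rfl, fun i => by rw [one_mul]; exact (hc 0 i).1 h0⟩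
  · refine ⟨-1, Or.inr rfl, fun i => ?_⟩
    have : ¬ 0 < det2 (δ i) (δ (i+1)) := fun h => h0 ((hc 0 i).2 h)
    have := lt_of_le_of_ne (not_lt.1 this) (hd _)
    linarith

lemma cone_unique {δ : Fin 6 → E2} (hT : Two δ) {e : ℝ} (he : e = 1 ∨ e = -1)
    (hd : ∀ i, 0 < e * det2 (δ i) (δ (i+1))) (y : E2) (hy : y ≠ 0) :
    ∃ i, (0 ≤ e * det2 (δ i) y ∧ e * det2 (δ (i+1)) y < 0) ∧
      ∀ j, (0 ≤ e * det2 (δ j) y ∧ e * det2 (δ (j+1)) y < 0) → j = i := by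
  have hsq : 0 < y.1^2+y.2^2 := by
    rcases eq_or_ne y.1 0 with h1 | h1
    · rcases eq_or_ne y.2 0 with h2 | h2
      · exact absurd (Prod.ext h1 h2) hy
      · positivity
    · positivity
  have he2 : e * e = 1 := by rcases he with h | h <;> rw [h] <;> norm_num
  have he0 : e ≠ 0 := by rcases he with h | h <;> rw [h] <;> norm_num
  obtain ⟨s, hs, hs2⟩ := hT (e * y.2, - (e * y.1)) y (by
    simp only [det2]
    have : e * y.2 * y.2 - -(e * y.1) * y.1 = e * (y.1^2+y.2^2) := by ring
    rw [this]; exact mul_ne_zero he0 hsq.ne')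
  have hz : ∀ x : E2, dot2 (e * y.2, - (e * y.1)) x = e * det2 x y := by
    intro x; simp only [dot2, det2]; ring
  simp only [hz] at hs2
  -- parallel vectors
  have hpar : ∀ x : E2, e * det2 x y = 0 → x = (dot2 y x / (y.1^2+y.2^2)) • y := by
    intro x hx
    have hx' : det2 x y = 0 := by
      rcases mul_eq_zero.1 hx with h | h
      · exact absurd h he0
      · exact h
    simp only [det2] at hx'
    ext
    · simp only [dot2, Prod.smul_fst, smul_eq_mul]
      field_simp
      linear_combination (y.2) * hx'
    · simp only [dot2, Prod.smul_snd, smul_eq_mul]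
      field_simp
      linear_combination (-y.1) * hx'
  have hiff : ∀ i, (0 ≤ e * det2 (δ i) y ∧ e * det2 (δ (i+1)) y < 0) ↔ (s i = true ∧ s (i+1) = false) := by
    intro i
    constructor
    · rintro ⟨h1, h2⟩
      refine ⟨?_, (hs2 _).2.1 h2⟩
      rcases h1.lt_or_eq with h | h
      · exact (hs2 _).1 h
      · apply (hs2 _).2.2.1 h.symm
        have hp := hpar _ h.symm
        set c := dot2 y (δ i) / (y.1^2+y.2^2) with hcdef
        have hdi := hd i
        rw [hp] at hdi
        have : e * det2 (c • y) (δ (i+1)) = c * (-(e * det2 (δ (i+1)) y)) := by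
          simp only [det2, Prod.smul_fst, Prod.smul_snd, smul_eq_mul]; ring
        rw [this] at hdi
        have hc : 0 < c := by
          by_contra hc
          have := mul_nonneg (neg_nonneg.2 (not_lt.1 hc)) (neg_nonneg.2 h2.le)
          linarith
        rw [hcdef] at hc
        exact (div_pos_iff_of_pos_right hsq).1 hc
    · rintro ⟨h1, h2⟩
      have a1 : 0 ≤ e * det2 (δ i) y := by
        by_contra hc
        rw [(hs2 i).2.1 (not_le.1 hc)] at h1; cases h1
      refine ⟨a1, ?_⟩
      by_contra hc
      rcases (not_lt.1 hc).lt_or_eq with h | h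
      · rw [(hs2 _).1 h] at h2; cases h2
      · have hp := hpar _ h.symm
        have hn : ¬ 0 < dot2 y (δ (i+1)) := by
          intro hpos
          rw [(hs2 _).2.2.1 h.symm hpos] at h2; cases h2
        set c := dot2 y (δ (i+1)) / (y.1^2+y.2^2) with hcdef
        have hc : c ≤ 0 := div_nonpos_of_nonpos_of_nonneg (not_lt.1 hn) hsq.le
        have hdi := hd i
        rw [hp] at hdi
        have : e * det2 (δ i) (c • y) = c * (e * det2 (δ i) y) := by
          simp only [det2, Prod.smul_fst, Prod.smul_snd, smul_eq_mul]; ring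
        rw [this] at hdi
        have := mul_nonneg (neg_nonneg.2 hc) a1
        linarith
  obtain ⟨i, hi, hi2⟩ := chg_unique s hs
  exact ⟨i, (hiff i).2 hi, fun j hj => hi2 j ((hiff j).1 hj)⟩

end TorusIso

namespace TorusIso
open Filter Topology Set

def cb (a b : Bool) : ℕ := if a = b then 0 else 1

lemma chg_cb (s : Fin 6 → Bool) (i : Fin 6) : chg s i = cb (s i) (s (i+1)) := rfl

section count
variable {V : Type} [Fintype V] [AddCommGroup V] (D : Fin 6 → V) (δ : V → Fin 6 → E2)

lemma sum_chg (htriD : ∀ i, D i + D (i+2) = D (i+1))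
    (htri : ∀ v i, δ v i + δ (v + D i) (i+2) = δ v (i+1))
    (hopp : ∀ v i, δ (v + D i) (i+3) = - δ v i) (a : E2) (ha : ∀ v i, dot2 a (δ v i) ≠ 0) :
    ∑ v, ∑ i, chg (fun j => decide (0 < dot2 a (δ v j))) i = 2 * Fintype.card V := by
  classical
  set c : V × Fin 6 → ℕ := fun p => chg (fun j => decide (0 < dot2 a (δ p.1 j))) p.2 with hc
  set r : V × Fin 6 → V × Fin 6 := fun p => (p.1 + D p.2, p.2 + 2) with hr
  have hinj : Function.Injective r := by
    rintro ⟨v, i⟩ ⟨w, j⟩ h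
    simp only [hr, Prod.mk.injEq, add_left_inj] at h
    obtain ⟨h1, rfl⟩ := h
    simpa using h1
  have hbij : Function.Bijective r := Finite.injective_iff_bijective.1 hinj
  have h1 : ∑ p, c (r p) = ∑ p, c p := hbij.sum_comp c
  have h2 : ∑ p, c (r (r p)) = ∑ p, c p := by
    rw [hbij.sum_comp (fun p => c (r p)), h1]
  have hone : ∀ p, c p + c (r p) + c (r (r p)) = 1 := by
    rintro ⟨v, i⟩
    have e1 : i + 2 + 1 = i + 3 := by rw [add_assoc]; rfl
    have e2 : i + 2 + 2 = i + 1 + 3 := by rw [add_assoc, add_assoc]; rfl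
    have e3 : i + 1 + 3 + 1 = i + 2 + 3 := by simp only [add_assoc]; rfl
    simp only [hc, hr, chg_cb]
    rw [e1, add_assoc v, htriD, e2, e3]
    have q1 := hopp v i
    have q2 := hopp v (i+1)
    have q3 := hopp (v + D i) (i+2)
    rw [add_assoc v, htriD] at q3
    rw [q1, q2, q3]
    have q4 : δ (v + D i) (i+2) = δ v (i+1) - δ v i := by rw [← htri v i]; abel
    have n1 := ha v i
    have n2 := ha v (i+1)
    have n3 := ha (v + D i) (i+2)
    rw [q4] at n3 ⊢
    have s1 : ∀ x : E2, dot2 a (-x) = - dot2 a x := by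
      intro x; simp only [dot2, Prod.fst_neg, Prod.snd_neg]; ring
    have s2 : ∀ x y : E2, dot2 a (x - y) = dot2 a x - dot2 a y := by
      intro x y; simp only [dot2, Prod.fst_sub, Prod.snd_sub]; ring
    rw [s2] at n3
    rw [s1, s1, s1, s2]
    generalize dot2 a (δ v i) = A at *
    generalize dot2 a (δ v (i+1)) = B at *
    simp only [cb, decide_eq_decide]
    rcases lt_or_gt_of_ne n1 with h | h <;> rcases lt_or_gt_of_ne n2 with h' | h' <;>
      rcases lt_or_gt_of_ne n3 with h'' | h'' <;>
      first
        | (exfalso; linarith)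
        | (simp [h, h', h'', h.le, h'.le, h''.le, not_lt.2 h.le, not_lt.2 h'.le, not_lt.2 h''.le] <;>
            first
              | done
              | linarith)
  have h3 : ∑ p, (c p + c (r p) + c (r (r p))) = 6 * Fintype.card V := by
    rw [Finset.sum_congr rfl (fun p _ => hone p)]
    simp [Fintype.card_prod, mul_comm]
  rw [Finset.sum_add_distrib, Finset.sum_add_distrib, h1, h2] at h3
  have h4 : ∑ p, c p = ∑ v, ∑ i, chg (fun j => decide (0 < dot2 a (δ v j))) i := by
    rw [Fintype.sum_prod_type]
  rw [← h4]
  omega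

lemma chg_eq_two (htriD : ∀ i, D i + D (i+2) = D (i+1))
    (htri : ∀ v i, δ v i + δ (v + D i) (i+2) = δ v (i+1))
    (hopp : ∀ v i, δ (v + D i) (i+3) = - δ v i) (hH : ∀ v, Hull (δ v))
    (a : E2) (ha : ∀ v i, dot2 a (δ v i) ≠ 0) (v : V) :
    ∑ i, chg (fun j => decide (0 < dot2 a (δ v j))) i = 2 := by
  have hge : ∀ v, 2 ≤ ∑ i, chg (fun j => decide (0 < dot2 a (δ v j))) i := by
    intro v
    apply chg_ge_two
    · by_contra hcon
      push Not at hcon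
      have := hH v (-a) (by
        intro i
        have := hcon i
        simp only [ne_eq, decide_eq_true_eq] at this
        simp only [dot2, Prod.fst_neg, Prod.snd_neg] at this ⊢
        linarith) 0
      apply ha v 0
      simp only [dot2, Prod.fst_neg, Prod.snd_neg] at this ⊢
      linarith
    · by_contra hcon
      push Not at hcon
      have := hH v a (by
        intro i
        have := hcon i
        simp only [ne_eq, decide_eq_false_iff_not, not_not] at this
        exact this.le) 0
      exact ha v 0 this
  have hs := sum_chg D δ htriD htri hopp a ha
  have hs2 : ∑ v : V, 2 = ∑ v, ∑ i, chg (fun j => decide (0 < dot2 a (δ v j))) i := by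
    rw [hs]; simp [mul_comm]
  exact ((Finset.sum_eq_sum_iff_of_le (fun v _ => hge v)).1 hs2 v (Finset.mem_univ v)).symm

lemma two_of (htriD : ∀ i, D i + D (i+2) = D (i+1))
    (htri : ∀ v i, δ v i + δ (v + D i) (i+2) = δ v (i+1))
    (hopp : ∀ v i, δ (v + D i) (i+3) = - δ v i) (hH : ∀ v, Hull (δ v))
    (hd : ∀ v i, det2 (δ v i) (δ v (i+1)) ≠ 0) (v : V) : Two (δ v) := by
  intro a b hab
  have hev : ∀ v i, ∀ᶠ η : ℝ in 𝓝[>] 0, dot2 (a + η • b) (δ v i) ≠ 0 ∧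
      (0 < dot2 a (δ v i) → 0 < dot2 (a + η • b) (δ v i)) ∧
      (dot2 a (δ v i) < 0 → dot2 (a + η • b) (δ v i) < 0) ∧
      (dot2 a (δ v i) = 0 → 0 < dot2 b (δ v i) → 0 < dot2 (a + η • b) (δ v i)) ∧
      (dot2 a (δ v i) = 0 → dot2 b (δ v i) < 0 → dot2 (a + η • b) (δ v i) < 0) := by
    intro v i
    have hlin : ∀ η : ℝ, dot2 (a + η • b) (δ v i) = dot2 a (δ v i) + η * dot2 b (δ v i) := by
      intro η; simp only [dot2, Prod.fst_add, Prod.snd_add, Prod.smul_fst, Prod.smul_snd, smul_eq_mul]; ring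
    simp only [hlin]
    have hnz : dot2 a (δ v i) = 0 → dot2 b (δ v i) = 0 → False := by
      intro h1 h2
      have hsq := sq_pos_of_det (hd v i)
      simp only [dot2] at h1 h2
      simp only [det2] at hab
      have z1 : (a.1 * b.2 - a.2 * b.1) * (δ v i).1 = 0 := by linear_combination b.2 * h1 - a.2 * h2
      have z2 : (a.1 * b.2 - a.2 * b.1) * (δ v i).2 = 0 := by linear_combination -b.1 * h1 + a.1 * h2
      have z1 := (mul_eq_zero.1 z1).resolve_left hab
      have z2 := (mul_eq_zero.1 z2).resolve_left hab
      rw [z1, z2] at hsq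
      norm_num at hsq
    generalize dot2 a (δ v i) = A at *
    generalize dot2 b (δ v i) = B at *
    have hpos : ∀ᶠ η : ℝ in 𝓝[>] 0, 0 < η := eventually_mem_nhdsWithin
    have hcont : Tendsto (fun η : ℝ => A + η * B) (𝓝[>] 0) (𝓝 A) := by
      have : Tendsto (fun η : ℝ => A + η * B) (𝓝 0) (𝓝 (A + 0 * B)) := by
        apply Continuous.tendsto; fun_prop
      rw [zero_mul, add_zero] at this
      exact this.mono_left nhdsWithin_le_nhds
    rcases lt_trichotomy A 0 with h | h | h
    · filter_upwards [hcont.eventually_lt_const h] with η hη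
      exact ⟨hη.ne, fun h' => by linarith, fun _ => hη, fun h' => by linarith, fun h' => by linarith⟩
    · subst h
      filter_upwards [hpos] with η hη
      refine ⟨?_, fun h' => absurd h' (lt_irrefl _), fun h' => absurd h' (lt_irrefl _), fun _ h' => ?_, fun _ h' => ?_⟩
      · rw [zero_add]; exact mul_ne_zero hη.ne' (fun h => hnz rfl h)
      · rw [zero_add]; positivity
      · rw [zero_add]; exact mul_neg_of_pos_of_neg hη h'
    · filter_upwards [hcont.eventually_const_lt h] with η hη
      exact ⟨hη.ne', fun _ => hη, fun h' => by linarith, fun h' => by linarith, fun h' => by linarith⟩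
  have hall : ∀ᶠ η : ℝ in 𝓝[>] 0, ∀ v i, _ := eventually_all.2 fun v => eventually_all.2 fun i => hev v i
  obtain ⟨η, hη⟩ := hall.exists
  refine ⟨fun j => decide (0 < dot2 (a + η • b) (δ v j)),
    chg_eq_two D δ htriD htri hopp hH _ (fun v i => (hη v i).1) v, fun i => ?_⟩
  obtain ⟨-, h1, h2, h3, h4⟩ := hη v i
  simp only [decide_eq_true_eq, decide_eq_false_iff_not, not_lt]
  exact ⟨h1, fun h => (h2 h).le, h3, fun h h' => (h4 h h').le⟩

end count

end TorusIso

namespace TorusIso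
open Filter Topology Set

def LL (δ : Fin 6 → E2) (p : E2) : E2 :=
  max 0 (min p.1 (p.1 - p.2)) • δ 0 + max 0 (min p.1 p.2) • δ 1 + max 0 (min p.2 (p.2 - p.1)) • δ 2 +
  max 0 (min (-p.1) (p.2 - p.1)) • δ 3 + max 0 (min (-p.1) (-p.2)) • δ 4 + max 0 (min (-p.2) (p.1 - p.2)) • δ 5

lemma LL_cont (δ : Fin 6 → E2) : Continuous (LL δ) := by unfold LL; fun_prop

lemma LL_smul (δ : Fin 6 → E2) (t : ℝ) (ht : 0 ≤ t) (p : E2) : LL δ (t • p) = t • LL δ p := by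
  have h : ∀ a b : ℝ, max 0 (min (t * a) (t * b)) = t * max 0 (min a b) := by
    intro a b
    rw [mul_max_of_nonneg _ _ ht, mul_min_of_nonneg _ _ ht, mul_zero]
  simp only [LL, Prod.smul_fst, Prod.smul_snd, smul_eq_mul, ← mul_neg, ← mul_sub, h, smul_add, smul_smul]

def ddr (i : Fin 6) : E2 := (((dd i).1 : ℝ), ((dd i).2 : ℝ))

lemma LL_cone (δ : Fin 6 → E2) (i : Fin 6) (α β : ℝ) (ha : 0 ≤ α) (hb : 0 ≤ β) :
    LL δ (α • ddr i + β • ddr (i+1)) = α • δ i + β • δ (i+1) := by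
  have hz : ∀ a b : ℝ, (a ≤ 0 ∨ b ≤ 0) → max 0 (min a b) = 0 := by
    intro a b h
    apply max_eq_left
    rcases h with h | h
    · exact (min_le_left _ _).trans h
    · exact (min_le_right _ _).trans h
  have hl : ∀ a b : ℝ, 0 ≤ a → a ≤ b → max 0 (min a b) = a := by
    intro a b h h'; rw [min_eq_left h', max_eq_right h]
  have hr : ∀ a b : ℝ, 0 ≤ b → b ≤ a → max 0 (min a b) = b := by
    intro a b h h'; rw [min_eq_right h', max_eq_right h]
  fin_cases i
  · simp [LL, ddr, dd]
    rw [hr _ _ (by linarith) (by linarith), hr _ _ (by linarith) (by linarith), hz _ _ (by right; linarith),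
      hz _ _ (by left; linarith), hz _ _ (by left; linarith), hz _ _ (by left; linarith)]
    module
  · simp [LL, ddr, dd]
    rw [hz _ _ (by right; linarith), hl _ _ (by linarith) (by linarith), hr _ _ (by linarith) (by linarith),
      hz _ _ (by left; linarith), hz _ _ (by left; linarith), hz _ _ (by left; linarith)]
    module
  · simp [LL, ddr, dd]
    rw [hz _ _ (by left; linarith), hz _ _ (by left; linarith), hl _ _ (by linarith) (by linarith),
      hl _ _ (by linarith) (by linarith), hz _ _ (by right; linarith), hz _ _ (by left; linarith)]
    try module
  · simp [LL, ddr, dd]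
    rw [hz _ _ (by left; linarith), hz _ _ (by left; linarith), hz _ _ (by left; linarith),
      hr _ _ (by linarith) (by linarith), hr _ _ (by linarith) (by linarith), hz _ _ (by right; linarith)]
    module
  · simp [LL, ddr, dd]
    rw [hz _ _ (by left; linarith), hz _ _ (by left; linarith), hz _ _ (by left; linarith),
      hz _ _ (by right; linarith), hl _ _ (by linarith) (by linarith), hr _ _ (by linarith) (by linarith)]
    module
  · simp [LL, ddr, dd]
    rw [hl _ _ (by linarith) (by linarith), hz _ _ (by right; linarith), hz _ _ (by left; linarith),
      hz _ _ (by left; linarith), hz _ _ (by left; linarith), hl _ _ (by linarith) (by linarith)]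
    try module

lemma exists_cone (p : E2) (hp : p ≠ 0) : ∃ i : Fin 6, ∃ α β : ℝ, 0 < α ∧ 0 ≤ β ∧ p = α • ddr i + β • ddr (i+1) := by
  obtain ⟨x, y⟩ := p
  rcases lt_or_ge y 0 with hy | hy
  · rcases lt_or_ge x y with hxy | hxy
    · exact ⟨3, y - x, -y, by linarith, by linarith, by ext <;> simp [ddr, dd]⟩
    · rcases lt_or_ge x 0 with hx | hx
      · exact ⟨4, -x, x-y, by linarith, by linarith, by ext <;> simp [ddr, dd]⟩
      · exact ⟨5, -y, x, by linarith, by linarith, by ext <;> simp [ddr, dd]⟩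
  · rcases lt_or_ge y x with hxy | hxy
    · exact ⟨0, x - y, y, by linarith, by linarith, by ext <;> simp [ddr, dd]⟩
    · rcases lt_or_ge 0 x with hx | hx
      · exact ⟨1, x, y-x, by linarith, by linarith, by ext <;> simp [ddr, dd]⟩
      · rcases hy.lt_or_eq with hy' | hy'
        · exact ⟨2, y, -x, by linarith, by linarith, by ext <;> simp [ddr, dd]⟩
        · rcases hx.lt_or_eq with hx' | hx'
          · exact ⟨3, y-x, 0, by linarith, by linarith, by ext <;> simp [ddr, dd, ← hy']⟩
          · exact absurd (by rw [hx', ← hy']; rfl) hp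

lemma LL_bij {δ : Fin 6 → E2} (hT : Two δ) (hH : Hull δ) (hd : ∀ i, det2 (δ i) (δ (i+1)) ≠ 0) :
    Function.Bijective (LL δ) := by
  obtain ⟨e, he, hpos⟩ := sign_const hT hH hd
  have L0 : LL δ 0 = 0 := by simp [LL]
  have f1 : ∀ i (α β : ℝ), e * det2 (δ i) (α • δ i + β • δ (i+1)) = β * (e * det2 (δ i) (δ (i+1))) := by
    intro i α β
    simp only [det2, Prod.fst_add, Prod.snd_add, Prod.smul_fst, Prod.smul_snd, smul_eq_mul]; ring
  have f2 : ∀ i (α β : ℝ), e * det2 (δ (i+1)) (α • δ i + β • δ (i+1)) = - (α * (e * det2 (δ i) (δ (i+1)))) := by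
    intro i α β
    simp only [det2, Prod.fst_add, Prod.snd_add, Prod.smul_fst, Prod.smul_snd, smul_eq_mul]; ring
  have key : ∀ p, p ≠ 0 → LL δ p ≠ 0 ∧ ∃ i : Fin 6, ∃ α β : ℝ, p = α • ddr i + β • ddr (i+1) ∧
      (0 ≤ e * det2 (δ i) (LL δ p) ∧ e * det2 (δ (i+1)) (LL δ p) < 0) ∧ LL δ p = α • δ i + β • δ (i+1) := by
    intro p hp
    obtain ⟨i, α, β, ha, hb, rfl⟩ := exists_cone p hp
    rw [LL_cone δ i α β ha.le hb]
    have g1 : 0 ≤ e * det2 (δ i) (α • δ i + β • δ (i+1)) := by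
      rw [f1]; exact mul_nonneg hb (hpos i).le
    have g2 : e * det2 (δ (i+1)) (α • δ i + β • δ (i+1)) < 0 := by
      rw [f2]; have := mul_pos ha (hpos i); linarith
    refine ⟨?_, i, α, β, rfl, ⟨g1, g2⟩, rfl⟩
    intro h
    rw [h] at g2
    simp [det2] at g2
  constructor
  · intro p q hpq
    by_cases hp : p = 0
    · by_contra hne
      have hq : q ≠ 0 := fun h => hne (hp.trans h.symm)
      rw [hp, L0] at hpq
      exact (key q hq).1 hpq.symm
    · have hq : q ≠ 0 := by
        intro h
        rw [h, L0] at hpq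
        exact (key p hp).1 hpq
      obtain ⟨hy, i, α, β, hpe, hs, hL⟩ := key p hp
      obtain ⟨-, j, α', β', hqe, hs', hL'⟩ := key q hq
      obtain ⟨l, -, hl⟩ := cone_unique hT he hpos _ hy
      have e1 := hl i hs
      rw [← hpq] at hs' hL'
      have e2 := hl j hs'
      rw [← e2] at e1
      subst e1
      have hD := hpos i
      have t1 := f1 i α β
      rw [← hL, hL', f1] at t1
      have t2 := f2 i α β
      rw [← hL, hL', f2] at t2
      have z1 : β' = β := mul_right_cancel₀ hD.ne' t1
      have z2 : α' = α := mul_right_cancel₀ hD.ne' (neg_injective t2)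
      rw [hpe, hqe, z1, z2]
  · intro y
    by_cases hy : y = 0
    · exact ⟨0, by rw [L0, hy]⟩
    · obtain ⟨i, ⟨h1, h2⟩, -⟩ := cone_unique hT he hpos y hy
      have hD := hpos i
      refine ⟨(-(e * det2 (δ (i+1)) y) / (e * det2 (δ i) (δ (i+1)))) • ddr i +
        ((e * det2 (δ i) y) / (e * det2 (δ i) (δ (i+1)))) • ddr (i+1), ?_⟩
      rw [LL_cone _ _ _ _ (div_nonneg (by linarith) hD.le) (div_nonneg h1 hD.le)]
      have he0 : e ≠ 0 := by rcases he with h | h <;> rw [h] <;> norm_num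
      have hdi := hd i
      simp only [mul_comm e, ← neg_mul]
      rw [mul_div_mul_right _ _ he0, mul_div_mul_right _ _ he0]
      ext
      · simp only [Prod.fst_add, Prod.smul_fst, smul_eq_mul]
        field_simp
        simp only [det2]; ring
      · simp only [Prod.snd_add, Prod.smul_snd, smul_eq_mul]
        field_simp
        simp only [det2]; ring

lemma LL_homeo {δ : Fin 6 → E2} (hT : Two δ) (hH : Hull δ) (hd : ∀ i, det2 (δ i) (δ (i+1)) ≠ 0) :
    IsHomeomorph (LL δ) := by
  have hb := LL_bij hT hH hd
  have L0 : LL δ 0 = 0 := by simp [LL]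
  obtain ⟨c, hc, hcb⟩ : ∃ c > 0, ∀ p : E2, c * ‖p‖ ≤ ‖LL δ p‖ := by
    have hcomp : IsCompact (Metric.sphere (0 : E2) 1) := isCompact_sphere _ _
    have hne : (Metric.sphere (0 : E2) 1).Nonempty := ⟨(1, 0), by simp [Prod.norm_def]⟩
    obtain ⟨q, hq, hmin⟩ := hcomp.exists_isMinOn hne (LL_cont δ).norm.continuousOn
    have hq0 : q ≠ 0 := by
      rintro rfl
      simp at hq
    refine ⟨‖LL δ q‖, ?_, fun p => ?_⟩
    · rw [gt_iff_lt, norm_pos_iff]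
      intro h
      exact hq0 (hb.1 (h.trans L0.symm))
    · by_cases hp : p = 0
      · rw [hp, L0]; simp
      · have hn : 0 < ‖p‖ := norm_pos_iff.2 hp
        have h1 : ‖p‖⁻¹ • p ∈ Metric.sphere (0 : E2) 1 := by
          simp [norm_smul, hn.ne']
        have h2 : ‖LL δ q‖ ≤ ‖LL δ (‖p‖⁻¹ • p)‖ := hmin h1
        rw [LL_smul _ _ (by positivity), norm_smul, norm_inv, norm_norm] at h2
        calc ‖LL δ q‖ * ‖p‖ ≤ ‖p‖⁻¹ * ‖LL δ p‖ * ‖p‖ := by gcongr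
          _ = _ := by field_simp
  rw [isHomeomorph_iff_continuous_isClosedMap_bijective]
  refine ⟨LL_cont δ, ?_, hb⟩
  apply IsProperMap.isClosedMap
  rw [isProperMap_iff_tendsto_cocompact]
  refine ⟨LL_cont δ, ?_⟩
  rw [← Metric.cobounded_eq_cocompact, ← tendsto_norm_atTop_iff_cobounded]
  apply tendsto_atTop_mono hcb
  exact tendsto_norm_cobounded_atTop.const_mul_atTop hc

end TorusIso

namespace TorusIso
open Filter Topology Set

noncomputable def fl (z : E2) : ℤ × ℤ := (⌊z.1⌋, ⌊z.2⌋)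

def del (k : ℤ × ℤ → E2) (v : ℤ × ℤ) (i : Fin 6) : E2 := k (v + dd i) - k v

noncomputable def KK (k : ℤ × ℤ → E2) (z : E2) : E2 := k (fl z) + LL (del k (fl z)) (z - lat (fl z))

def hexU (v : ℤ × ℤ) : Set E2 := {z | |z.1 - v.1| < 1 ∧ |z.2 - v.2| < 1 ∧ |(z.1 - v.1) - (z.2 - v.2)| < 1}

lemma hexU_open (v : ℤ × ℤ) : IsOpen (hexU v) := by
  have h1 : Continuous fun z : E2 => |z.1 - v.1| := by fun_prop
  have h2 : Continuous fun z : E2 => |z.2 - v.2| := by fun_prop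
  have h3 : Continuous fun z : E2 => |(z.1 - v.1) - (z.2 - v.2)| := by fun_prop
  exact (isOpen_lt h1 continuous_const).inter ((isOpen_lt h2 continuous_const).inter
    (isOpen_lt h3 continuous_const))

lemma mem_hexU (z : E2) : z ∈ hexU (fl z) := by
  have h1 := Int.floor_le z.1
  have h2 := Int.lt_floor_add_one z.1
  have h3 := Int.floor_le z.2
  have h4 := Int.lt_floor_add_one z.2
  simp only [hexU, fl, Set.mem_ofPred_eq, abs_lt]
  refine ⟨⟨?_, ?_⟩, ⟨?_, ?_⟩, ?_, ?_⟩ <;> linarith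

lemma LL_cone' (δ : Fin 6 → E2) (p : E2) (i : Fin 6) (α β : ℝ) (ha : 0 ≤ α) (hb : 0 ≤ β)
    (h1 : p.1 = α * (dd i).1 + β * (dd (i+1)).1) (h2 : p.2 = α * (dd i).2 + β * (dd (i+1)).2) :
    LL δ p = α • δ i + β • δ (i+1) := by
  rw [← LL_cone δ i α β ha hb]
  congr 1
  ext
  · simpa [ddr] using h1
  · simpa [ddr] using h2

lemma KK_eq (k : ℤ × ℤ → E2) (v : ℤ × ℤ) (z : E2) (hz : z ∈ hexU v) :
    KK k z = k v + LL (del k v) (z - lat v) := by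
  obtain ⟨h1, h2, h3⟩ := hz
  rw [abs_lt] at h1 h2 h3
  have hp1 : (z - lat v).1 = z.1 - v.1 := rfl
  have hp2 : (z - lat v).2 = z.2 - v.2 := rfl
  rcases lt_or_ge z.1 v.1 with hx | hx <;> rcases lt_or_ge z.2 v.2 with hy | hy
  · have hf : fl z = v + dd 4 := by
      refine Prod.ext ?_ ?_
      · simp only [fl, Prod.fst_add]; rw [Int.floor_eq_iff]; simp [dd]; constructor <;> linarith
      · simp only [fl, Prod.snd_add]; rw [Int.floor_eq_iff]; simp [dd]; constructor <;> linarith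
    have e1 : v + dd 4 + dd 1 = v := by rw [add_assoc, show dd 4 + dd 1 = 0 by decide, add_zero]
    have e2 : v + dd 4 + dd 0 = v + dd 5 := by rw [add_assoc, show dd 4 + dd 0 = dd 5 by decide]
    have e3 : v + dd 4 + dd 2 = v + dd 3 := by rw [add_assoc, show dd 4 + dd 2 = dd 3 by decide]
    unfold KK
    rw [hf]
    rcases le_total (z.2 - v.2) (z.1 - v.1) with hxy | hxy
    · rw [LL_cone' _ (z - lat (v + dd 4)) 0 ((z.1 - v.1) - (z.2 - v.2)) (z.2 - v.2 + 1) (by linarith) (by linarith)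
        (by simp [lat, dd]; ring) (by simp [lat, dd]; ring),
        LL_cone' _ (z - lat v) 4 (-(z.1 - v.1)) ((z.1 - v.1) - (z.2 - v.2)) (by linarith) (by linarith)
        (by simp [lat, dd]) (by simp [lat, dd])]
      simp only [Fin.reduceAdd, zero_add, del, e1, e2]
      module
    · rw [LL_cone' _ (z - lat (v + dd 4)) 1 (z.1 - v.1 + 1) ((z.2 - v.2) - (z.1 - v.1)) (by linarith) (by linarith)
        (by simp [lat, dd]; ring) (by simp [lat, dd]; ring),
        LL_cone' _ (z - lat v) 3 ((z.2 - v.2) - (z.1 - v.1)) (-(z.2 - v.2)) (by linarith) (by linarith)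
        (by simp [lat, dd]) (by simp [lat, dd])]
      simp only [Fin.reduceAdd, del, e1, e3]
      module
  · have hf : fl z = v + dd 3 := by
      refine Prod.ext ?_ ?_
      · simp only [fl, Prod.fst_add]; rw [Int.floor_eq_iff]; simp [dd]; constructor <;> linarith
      · simp only [fl, Prod.snd_add]; rw [Int.floor_eq_iff]; simp [dd]; constructor <;> linarith
    have e1 : v + dd 3 + dd 0 = v := by rw [add_assoc, show dd 3 + dd 0 = 0 by decide, add_zero]
    have e2 : v + dd 3 + dd 1 = v + dd 2 := by rw [add_assoc, show dd 3 + dd 1 = dd 2 by decide]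
    unfold KK
    rw [hf]
    rw [LL_cone' _ (z - lat (v + dd 3)) 0 ((z.1 - v.1) + 1 - (z.2 - v.2)) (z.2 - v.2) (by linarith) (by linarith)
        (by simp [lat, dd]; ring) (by simp [lat, dd]),
        LL_cone' _ (z - lat v) 2 (z.2 - v.2) (-(z.1 - v.1)) (by linarith) (by linarith)
        (by simp [lat, dd]) (by simp [lat, dd])]
    simp only [Fin.reduceAdd, zero_add, del, e1, e2]
    module
  · have hf : fl z = v + dd 5 := by
      refine Prod.ext ?_ ?_
      · simp only [fl, Prod.fst_add]; rw [Int.floor_eq_iff]; simp [dd]; constructor <;> linarith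
      · simp only [fl, Prod.snd_add]; rw [Int.floor_eq_iff]; simp [dd]; constructor <;> linarith
    have e1 : v + dd 5 + dd 2 = v := by rw [add_assoc, show dd 5 + dd 2 = 0 by decide, add_zero]
    have e2 : v + dd 5 + dd 1 = v + dd 0 := by rw [add_assoc, show dd 5 + dd 1 = dd 0 by decide]
    unfold KK
    rw [hf]
    rw [LL_cone' _ (z - lat (v + dd 5)) 1 (z.1 - v.1) ((z.2 - v.2) + 1 - (z.1 - v.1)) (by linarith) (by linarith)
        (by simp [lat, dd]) (by simp [lat, dd]; ring),
        LL_cone' _ (z - lat v) 5 (-(z.2 - v.2)) (z.1 - v.1) (by linarith) (by linarith)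
        (by simp [lat, dd]) (by simp [lat, dd])]
    simp only [Fin.reduceAdd, del, e1, e2]
    module
  · have hf : fl z = v := by
      refine Prod.ext ?_ ?_
      · simp only [fl]; rw [Int.floor_eq_iff]; constructor <;> linarith
      · simp only [fl]; rw [Int.floor_eq_iff]; constructor <;> linarith
    unfold KK
    rw [hf]

lemma KK_cont (k : ℤ × ℤ → E2) : Continuous (KK k) := by
  rw [continuous_iff_continuousAt]
  intro z
  have : (fun z => k (fl z) + LL (del k (fl z)) (z - lat (fl z))) = KK k := rfl
  have h2 : (fun w => k (fl z) + LL (del k (fl z)) (w - lat (fl z))) =ᶠ[𝓝 z] KK k := by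
    filter_upwards [(hexU_open (fl z)).mem_nhds (mem_hexU z)] with w hw
    exact (KK_eq k (fl z) w hw).symm
  refine ContinuousAt.congr ?_ h2
  exact (continuous_const.add ((LL_cont _).comp (by fun_prop))).continuousAt

lemma KK_localHomeo (k : ℤ × ℤ → E2) (h : ∀ v, IsHomeomorph (LL (del k v))) : IsLocalHomeomorph (KK k) := by
  rw [isLocalHomeomorph_iff_isOpenEmbedding_restrict]
  intro z
  refine ⟨hexU (fl z), (hexU_open (fl z)).mem_nhds (mem_hexU z), ?_⟩
  have h1 : (hexU (fl z)).domRestrict (KK k) =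
      (Homeomorph.addLeft (k (fl z))) ∘ (LL (del k (fl z))) ∘ (Homeomorph.subRight (lat (fl z))) ∘ Subtype.val := by
    funext w
    exact KK_eq k (fl z) w.1 w.2
  rw [h1]
  exact (Homeomorph.isOpenEmbedding _).comp ((h _).isOpenEmbedding.comp
    ((Homeomorph.isOpenEmbedding _).comp (hexU_open _).isOpenEmbedding_subtypeVal))

lemma bij_of_localHomeo {F : E2 → E2} (hF : IsLocalHomeomorph F) {C : ℝ} (hC : ∀ z, ‖F z - z‖ ≤ C) :
    Function.Bijective F := by
  have hcont := hF.continuous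
  have hprop : IsProperMap F := by
    rw [isProperMap_iff_tendsto_cocompact]
    refine ⟨hcont, ?_⟩
    rw [← Metric.cobounded_eq_cocompact, ← tendsto_norm_atTop_iff_cobounded]
    have : ∀ z, ‖z‖ - C ≤ ‖F z‖ := by
      intro z
      have h1 := hC z
      have h2 := norm_sub_norm_le z (z - F z)
      rw [sub_sub_cancel] at h2
      rw [norm_sub_rev] at h1
      linarith
    apply tendsto_atTop_mono this
    exact tendsto_atTop_add_const_right _ _ tendsto_norm_cobounded_atTop
  have hcov : IsCoveringMap F := by
    rw [isCoveringMap_iff_isCoveringMapOn_univ]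
    apply hprop.isClosedMap.isCoveringMapOn_of_isLocalHomeomorphOn
    · intro x _
      have hK : IsCompact (F ⁻¹' {x}) := hprop.isCompact_preimage isCompact_singleton
      apply hK.finite
      apply IsDiscrete.of_openPartialHomeomorph F (x := x) subset_rfl
      intro e _
      obtain ⟨φ, h1, h2⟩ := hF e
      exact ⟨φ, h1, h2.symm⟩
    · simpa [← isLocalHomeomorph_iff_isLocalHomeomorphOn_univ]
  obtain ⟨s, ⟨hs0, hs1⟩, -⟩ := hcov.existsUnique_continuousMap_lifts (ContinuousMap.id E2) (F 0) 0 rfl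
  have h2 : s ∘ F = id := by
    apply hcov.eq_of_comp_eq (s.continuous.comp hcont) continuous_id (a := 0)
    · funext z
      exact congrFun hs1 (F z)
    · simpa using hs0
  constructor
  · intro a b hab
    have := congrFun h2 a
    have h' := congrFun h2 b
    simp only [Function.comp, id] at this h'
    rw [← this, ← h', hab]
  · intro y
    exact ⟨s y, congrFun hs1 y⟩

end TorusIso

namespace TorusIso
open Filter Topology Set

abbrev VV (N : ℕ) := ZMod N × ZMod N

def cz (N : ℕ) (v : ℤ × ℤ) : VV N := ((v.1 : ZMod N), (v.2 : ZMod N))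

lemma cz_add (N : ℕ) (v w : ℤ × ℤ) : cz N (v + w) = cz N v + cz N w := by simp [cz]
lemma cz_neg (N : ℕ) (v : ℤ × ℤ) : cz N (-v) = - cz N v := by simp [cz]
lemma cz_smul (N : ℕ) (v : ℤ × ℤ) : cz N ((N : ℤ) • v) = 0 := by simp [cz]
lemma cz_surj (N : ℕ) : Function.Surjective (cz N) := by
  rintro ⟨a, b⟩
  obtain ⟨x, rfl⟩ := ZMod.intCast_surjective a
  obtain ⟨y, rfl⟩ := ZMod.intCast_surjective b
  exact ⟨(x, y), rfl⟩

section
variable {N : ℕ}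

noncomputable def kk (u : VV N → E2) (v : ℤ × ℤ) : E2 := (N : ℝ)⁻¹ • lat v + u (cz N v)

noncomputable def dl (u : VV N → E2) (v : VV N) (i : Fin 6) : E2 := u (v + cz N (dd i)) - u v + (N : ℝ)⁻¹ • ddr i

noncomputable def GG (u : VV N → E2) (z : E2) : E2 := KK (kk u) ((N : ℝ) • z)

lemma del_kk (u : VV N → E2) (v : ℤ × ℤ) : del (kk u) v = dl u (cz N v) := by
  funext i
  simp only [del, kk, dl, cz_add, lat_add, smul_add]
  have : lat (dd i) = ddr i := rfl
  rw [this]; abel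

lemma kk_add [NeZero N] (u : VV N → E2) (v n : ℤ × ℤ) : kk u (v + (N : ℤ) • n) = kk u v + lat n := by
  have hN : (N : ℝ) ≠ 0 := by exact_mod_cast NeZero.ne N
  simp only [kk, cz_add, cz_smul, add_zero, lat_add, smul_add]
  have : (N : ℝ)⁻¹ • lat ((N : ℤ) • n) = lat n := by
    ext <;> simp [lat, hN]
  rw [this]; abel

lemma fl_add (z : E2) (n : ℤ × ℤ) : fl (z + lat n) = fl z + n := by
  simp [fl, lat]; rfl

lemma GG_equi [NeZero N] (u : VV N → E2) : Equi (GG u) := by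
  intro z n
  have h1 : (N : ℝ) • (z + lat n) = (N : ℝ) • z + lat ((N : ℤ) • n) := by
    ext <;> simp [lat, mul_add]
  simp only [GG, KK]
  rw [h1, fl_add, kk_add, del_kk, del_kk, cz_add, cz_smul, add_zero, lat_add, add_sub_add_right_eq_sub]
  abel

lemma GG_cont (u : VV N → E2) : Continuous (GG u) :=
  (KK_cont _).comp (continuous_const_smul _)

lemma LL_norm (δ : Fin 6 → E2) (p : E2) (h1 : |p.1| ≤ 1) (h2 : |p.2| ≤ 1) {M : ℝ} (hM : ∀ i, ‖δ i‖ ≤ M) :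
    ‖LL δ p‖ ≤ 6 * M := by
  rw [abs_le] at h1 h2
  have hM0 : 0 ≤ M := (norm_nonneg _).trans (hM 0)
  have hc : ∀ a b : ℝ, ∀ i, a ≤ 1 → ‖max 0 (min a b) • δ i‖ ≤ M := by
    intro a b i ha
    rw [norm_smul, Real.norm_of_nonneg (le_max_left _ _)]
    have : max 0 (min a b) ≤ 1 := max_le zero_le_one ((min_le_left _ _).trans ha)
    calc _ ≤ 1 * M := mul_le_mul this (hM i) (norm_nonneg _) zero_le_one
      _ = M := one_mul _
  unfold LL
  refine (norm_add₃_le).trans ?_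
  have a0 := hc p.1 (p.1 - p.2) 0 (by linarith)
  have a1 := hc p.1 p.2 1 (by linarith)
  have a2 := hc p.2 (p.2-p.1) 2 (by linarith)
  have a3 := hc (-p.1) (p.2-p.1) 3 (by linarith)
  have a4 := hc (-p.1) (-p.2) 4 (by linarith)
  have a5 := hc (-p.2) (p.1-p.2) 5 (by linarith)
  have b := norm_add_le (max 0 (min p.1 (p.1 - p.2)) • δ 0 + max 0 (min p.1 p.2) • δ 1 + max 0 (min p.2 (p.2 - p.1)) • δ 2)
   (max 0 (min (-p.1) (p.2 - p.1)) • δ 3)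
  have b2 := norm_add₃_le (a := max 0 (min p.1 (p.1 - p.2)) • δ 0) (b := max 0 (min p.1 p.2) • δ 1) (c := max 0 (min p.2 (p.2 - p.1)) • δ 2)
  linarith

lemma sub_fl_abs (z : E2) : |(z - lat (fl z)).1| ≤ 1 ∧ |(z - lat (fl z)).2| ≤ 1 := by
  obtain ⟨h1, h2, -⟩ := mem_hexU z
  exact ⟨h1.le, h2.le⟩

lemma GG_near (u : VV N → E2) {M : ℝ} (hM : ∀ v i, ‖dl u v i‖ ≤ M) (z : E2) :
    ‖GG u z - kk u (fl ((N : ℝ) • z))‖ ≤ 6 * M := by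
  simp only [GG, KK, add_sub_cancel_left, del_kk]
  exact LL_norm _ _ (sub_fl_abs _).1 (sub_fl_abs _).2 (hM _)

lemma LL_sub (δ δ' : Fin 6 → E2) (p : E2) : LL δ p - LL δ' p = LL (fun i => δ i - δ' i) p := by
  simp only [LL]; module

lemma GG_sub (u u' : VV N → E2) {S : ℝ} (hS : ∀ v, ‖u v - u' v‖ ≤ S) (z : E2) :
    ‖GG u z - GG u' z‖ ≤ 13 * S := by
  simp only [GG, KK, del_kk]
  rw [add_sub_add_comm, LL_sub]
  refine (norm_add_le _ _).trans ?_
  have h1 : ‖kk u (fl ((N:ℝ) • z)) - kk u' (fl ((N:ℝ) • z))‖ ≤ S := by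
    simp only [kk, add_sub_add_left_eq_sub]; exact hS _
  have h2 := LL_norm (fun i => dl u (cz N (fl ((N:ℝ) • z))) i - dl u' (cz N (fl ((N:ℝ) • z))) i)
    ((N:ℝ) • z - lat (fl ((N:ℝ) • z))) (sub_fl_abs _).1 (sub_fl_abs _).2 (M := 2 * S) (by
      intro i
      simp only [dl, add_sub_add_right_eq_sub]
      rw [sub_sub_sub_comm]
      refine (norm_sub_le _ _).trans ?_
      have a := hS (cz N (fl ((N:ℝ) • z)) + cz N (dd i))
      have b := hS (cz N (fl ((N:ℝ) • z)))
      linarith)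
  linarith

theorem tutte [NeZero N] (u : VV N → E2) (hH : ∀ v, Hull (dl u v))
    (hd : ∀ v i, det2 (dl u v i) (dl u v (i+1)) ≠ 0) :
    ∃ K : E2 ≃ₜ E2, (∀ z, K z = GG u z) ∧ Equi K := by
  have hN : (N : ℝ) ≠ 0 := by exact_mod_cast NeZero.ne N
  have hT : ∀ v, Two (dl u v) := by
    apply two_of (fun i => cz N (dd i)) (dl u) ?_ ?_ ?_ hH hd
    · intro i; rw [← cz_add, dd_tri]
    · intro v i
      simp only [dl]
      rw [add_assoc v, ← cz_add, dd_tri]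
      have : ddr (i+1) = ddr i + ddr (i+2) := by
        rw [show ddr = fun i => lat (dd i) from rfl]
        simp only [← lat_add, dd_tri]
      rw [this, smul_add]; abel
    · intro v i
      simp only [dl]
      rw [dd_opp, cz_neg, add_neg_cancel_right]
      have : ddr (i+3) = - ddr i := by
        rw [show ddr = fun i => lat (dd i) from rfl]
        simp only [← lat_neg, dd_opp]
      rw [this, smul_neg]; abel
  have hloc : IsLocalHomeomorph (KK (kk u)) := by
    apply KK_localHomeo
    intro v
    rw [del_kk]
    exact LL_homeo (hT _) (hH _) (hd _)
  have hG : IsLocalHomeomorph (GG u) := hloc.comp (Homeomorph.smulOfNeZero (N : ℝ) hN).isLocalHomeomorph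
  obtain ⟨C, hC⟩ := Equi.exists_bound (GG_cont u) (GG_equi u)
  refine ⟨mkHomeo (GG u) (GG_cont u) (bij_of_localHomeo hG hC) C hC, fun z => rfl, ?_⟩
  exact GG_equi u

end
end TorusIso

namespace TorusIso
open Filter Topology Set

section
variable {N : ℕ} [NeZero N]

/-- summation by parts -/
lemma sbp (g : VV N → Fin 6 → ℝ) (hg : ∀ v i, g (v + cz N (dd i)) (i+3) = - g v i) (y : VV N → ℝ) :
    ∑ v, ∑ i, g v i * (y (v + cz N (dd i)) - y v) = -2 * ∑ v, y v * ∑ i, g v i := by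
  set r : VV N × Fin 6 → VV N × Fin 6 := fun p => (p.1 + cz N (dd p.2), p.2 + 3) with hr
  have hinj : Function.Injective r := by
    rintro ⟨v, i⟩ ⟨w, j⟩ h
    simp only [hr, Prod.mk.injEq, add_left_inj] at h
    obtain ⟨h1, rfl⟩ := h
    simpa using h1
  have hbij : Function.Bijective r := Finite.injective_iff_bijective.1 hinj
  have h1 := hbij.sum_comp (fun p => g p.1 p.2 * y p.1)
  simp only [hr, hg] at h1
  rw [Fintype.sum_prod_type (f := fun x : VV N × Fin 6 => -g x.1 x.2 * y (x.1 + cz N (dd x.2))),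
    Fintype.sum_prod_type (f := fun x : VV N × Fin 6 => g x.1 x.2 * y x.1)] at h1
  simp only [mul_sub, Finset.sum_sub_distrib]
  simp only [neg_mul, Finset.sum_neg_distrib] at h1
  have h2 : ∑ v, y v * ∑ i, g v i = ∑ v, ∑ i, g v i * y v := by
    apply Finset.sum_congr rfl
    intro v _
    rw [mul_comm, Finset.sum_mul]
  rw [h2]
  linarith

structure IsWt (W : VV N → Fin 6 → ℝ) : Prop where
  pos : ∀ v i, 0 < W v i
  sym : ∀ v i, W (v + cz N (dd i)) (i+3) = W v i

def lap (W : VV N → Fin 6 → ℝ) (x : VV N → ℝ) (v : VV N) : ℝ := ∑ i, W v i * (x (v + cz N (dd i)) - x v)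

lemma back (v : VV N) (i : Fin 6) : v + cz N (dd i) + cz N (dd (i+3)) = v := by
  rw [dd_opp, cz_neg, add_neg_cancel_right]

lemma lap_sum {W : VV N → Fin 6 → ℝ} (hW : IsWt W) (x : VV N → ℝ) : ∑ v, lap W x v = 0 := by
  have := sbp (fun v i => W v i * (x (v + cz N (dd i)) - x v)) (by
    intro v i
    simp only [hW.sym, back]; ring) (fun _ => 1)
  simp at this
  simpa [lap] using this

lemma const_of_edges {x : VV N → ℝ} (h : ∀ v i, x (v + cz N (dd i)) = x v) (v : VV N) : x v = x 0 := by
  have h0 : ∀ n : ℕ, ∀ v, x (v + ((n : ZMod N), 0)) = x v := by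
    intro n
    induction n with
    | zero => intro v; congr 1; simp
    | succ n ih =>
      intro v
      rw [← ih v, ← h (v + ((n : ZMod N), 0)) 0, add_assoc]
      simp [cz, dd]
  have h1 : ∀ n : ℕ, ∀ v, x (v + (0, (n : ZMod N))) = x v := by
    intro n
    induction n with
    | zero => intro v; congr 1; simp
    | succ n ih =>
      intro v
      rw [← ih v, ← h (v + (0, (n : ZMod N))) 2, add_assoc]
      simp [cz, dd]
  have e : v = 0 + ((v.1.val : ZMod N), 0) + (0, (v.2.val : ZMod N)) := by
    simp
  rw [e, h1, h0]

lemma const_of_lap {W : VV N → Fin 6 → ℝ} (hW : IsWt W) {x : VV N → ℝ} (h : ∀ v, lap W x v = 0) (v : VV N) :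
    x v = x 0 := by
  apply const_of_edges
  have := sbp (fun v i => W v i * (x (v + cz N (dd i)) - x v)) (by
    intro v i
    simp only [hW.sym, back]; ring) x
  have hr : ∑ v, x v * ∑ i, W v i * (x (v + cz N (dd i)) - x v) = 0 :=
    Finset.sum_eq_zero fun v _ => by
      have := h v
      unfold lap at this
      rw [this, mul_zero]
  rw [hr, mul_zero] at this
  have hnn : ∀ v i, 0 ≤ W v i * (x (v + cz N (dd i)) - x v) * (x (v + cz N (dd i)) - x v) := by
    intro v i
    rw [mul_assoc]
    exact mul_nonneg (hW.pos v i).le (mul_self_nonneg _)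
  intro v i
  have h1 := (Finset.sum_eq_zero_iff_of_nonneg (fun v _ => Finset.sum_nonneg fun i _ => hnn v i)).1 this v (Finset.mem_univ v)
  have h2 := (Finset.sum_eq_zero_iff_of_nonneg (fun i _ => hnn v i)).1 h1 i (Finset.mem_univ i)
  rw [mul_assoc] at h2
  have h3 := (mul_eq_zero.1 h2).resolve_left (hW.pos v i).ne'
  have := mul_self_eq_zero.1 h3
  linarith

def lapL (W : VV N → Fin 6 → ℝ) : (VV N → ℝ) →ₗ[ℝ] (VV N → ℝ) where
  toFun x v := lap W x v - ∑ w, x w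
  map_add' x y := by
    funext v
    simp only [lap, Pi.add_apply, Finset.sum_add_distrib]
    have : ∑ i, W v i * (x (v + cz N (dd i)) + y (v + cz N (dd i)) - (x v + y v)) =
      ∑ i, W v i * (x (v + cz N (dd i)) - x v) + ∑ i, W v i * (y (v + cz N (dd i)) - y v) := by
      rw [← Finset.sum_add_distrib]; exact Finset.sum_congr rfl fun i _ => by ring
    rw [this]; ring
  map_smul' c x := by
    funext v
    simp only [lap, Pi.smul_apply, smul_eq_mul, RingHom.id_apply, mul_sub, Finset.mul_sum]
    congr 1
    exact Finset.sum_congr rfl fun i _ => by ring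

lemma lapL_solve {W : VV N → Fin 6 → ℝ} (hW : IsWt W) {x b : VV N → ℝ} (hb : ∑ v, b v = 0) (h : lapL W x = b)
    (v : VV N) : lap W x v = b v := by
  have h1 : ∀ v, lap W x v - ∑ w, x w = b v := fun v => congrFun h v
  have h2 : ∑ v, (lap W x v - ∑ w, x w) = 0 := by
    rw [← hb]; exact Finset.sum_congr rfl fun v _ => h1 v
  rw [Finset.sum_sub_distrib, lap_sum hW, zero_sub, neg_eq_zero, Finset.sum_const, smul_eq_zero] at h2
  have h3 : ∑ w, x w = 0 := by
    rcases h2 with h2 | h2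
    · simp at h2
      exact absurd h2 (NeZero.ne N)
    · exact h2
  rw [← h1, h3, sub_zero]

lemma lapL_inj {W : VV N → Fin 6 → ℝ} (hW : IsWt W) {x : VV N → ℝ} (h : lapL W x = 0) : x = 0 := by
  have h1 := lapL_solve hW (b := 0) (by simp) h
  have h2 := const_of_lap hW h1
  have h3 : lap W x 0 - ∑ w, x w = 0 := congrFun h 0
  rw [h1 0, Finset.sum_congr rfl fun w _ => h2 w] at h3
  simp at h3
  have hN := NeZero.ne N
  funext v
  rw [h2 v]
  simpa [hN] using h3

/-- interpolated weights -/
def Wti (W : VV N → Fin 6 → ℝ) (t : ℝ) (v : VV N) (i : Fin 6) : ℝ := (1 - t) * W v i + t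

lemma Wti_isWt {W : VV N → Fin 6 → ℝ} (hW : IsWt W) {t : ℝ} (h0 : 0 ≤ t) (h1 : t ≤ 1) : IsWt (Wti W t) where
  pos v i := by
    have := hW.pos v i
    simp only [Wti]
    rcases h0.lt_or_eq with h | h
    · have := mul_nonneg (sub_nonneg.2 h1) this.le
      linarith
    · rw [← h]; linarith
  sym v i := by simp only [Wti, hW.sym]

open Polynomial

noncomputable def PM (W : VV N → Fin 6 → ℝ) : Matrix (VV N) (VV N) ℝ[X] :=
  (1 - X : ℝ[X]) • (LinearMap.toMatrix' (lapL W)).map (C : ℝ → ℝ[X]) +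
    (X : ℝ[X]) • (LinearMap.toMatrix' (lapL (fun (_ : VV N) _ => (1:ℝ)))).map (C : ℝ → ℝ[X])

lemma PM_eval (W : VV N → Fin 6 → ℝ) (t : ℝ) : (evalRingHom t).mapMatrix (PM W) = LinearMap.toMatrix' (lapL (Wti W t)) := by
  have h : lapL (Wti W t) = (1 - t) • lapL W + t • lapL (fun (_ : VV N) _ => (1:ℝ)) := by
    refine LinearMap.ext fun x => ?_
    funext v
    change lap _ _ _ - _ = (1 - t) * (lap _ _ _ - _) + t * (lap _ _ _ - _)
    have hl : lap (Wti W t) x v = (1 - t) * lap W x v + t * lap (fun _ _ => 1) x v := by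
      simp only [lap, Finset.mul_sum, ← Finset.sum_add_distrib, Wti]
      exact Finset.sum_congr rfl fun i _ => by ring
    rw [hl]
    ring
  rw [h, map_add, map_smul, map_smul]
  ext v w
  simp only [PM, RingHom.mapMatrix_apply, Matrix.map_apply, Matrix.add_apply, Matrix.smul_apply, smul_eq_mul,
    map_add, eval_mul, coe_evalRingHom, eval_sub, eval_one, eval_X, eval_C]

end
end TorusIso

namespace TorusIso
open Filter Topology Set Polynomial

section
variable {N : ℕ} [NeZero N]

/-- right-hand side -/
noncomputable def rhs (W : VV N → Fin 6 → ℝ) (c : Fin 6 → ℝ) (v : VV N) : ℝ := - ∑ i, W v i * c i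

lemma rhs_sum {W : VV N → Fin 6 → ℝ} (hW : IsWt W) {c : Fin 6 → ℝ} (hc : ∀ i, c (i+3) = - c i) :
    ∑ v, rhs W c v = 0 := by
  have := sbp (fun v i => W v i * c i) (by
    intro v i
    simp only [hW.sym, hc]; ring) (fun _ => 1)
  simp at this
  simpa [rhs] using this

noncomputable def QQ (W : VV N → Fin 6 → ℝ) (c : Fin 6 → ℝ) : VV N → ℝ[X] :=
  (PM W).adjugate.mulVec (fun v => (1 - X : ℝ[X]) * C (rhs W c v))

noncomputable def DD (W : VV N → Fin 6 → ℝ) : ℝ[X] := (PM W).det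

noncomputable def sol (W : VV N → Fin 6 → ℝ) (c : Fin 6 → ℝ) (t : ℝ) (v : VV N) : ℝ :=
  ((DD W).eval t)⁻¹ * (QQ W c v).eval t

lemma DD_ne {W : VV N → Fin 6 → ℝ} (hW : IsWt W) {t : ℝ} (h0 : 0 ≤ t) (h1 : t ≤ 1) : (DD W).eval t ≠ 0 := by
  have h : (DD W).eval t = (LinearMap.toMatrix' (lapL (Wti W t))).det := by
    rw [← PM_eval, ← RingHom.map_det]; rfl
  rw [h]
  intro hdet
  obtain ⟨x, hx, hx0⟩ := Matrix.exists_mulVec_eq_zero_iff.2 hdet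
  rw [LinearMap.toMatrix'_mulVec] at hx0
  exact hx (lapL_inj (Wti_isWt hW h0 h1) hx0)

lemma rhs_Wti (W : VV N → Fin 6 → ℝ) {c : Fin 6 → ℝ} (hc : ∑ i, c i = 0) (t : ℝ) (v : VV N) :
    rhs (Wti W t) c v = (1 - t) * rhs W c v := by
  simp only [rhs, Wti, add_mul, Finset.sum_add_distrib, ← Finset.mul_sum, hc, mul_assoc]
  ring

lemma sol_lap {W : VV N → Fin 6 → ℝ} (hW : IsWt W) {c : Fin 6 → ℝ} (hc : ∀ i, c (i+3) = - c i)
    (hc0 : ∑ i, c i = 0) {t : ℝ} (h0 : 0 ≤ t) (h1 : t ≤ 1) (v : VV N) :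
    lap (Wti W t) (sol W c t) v = rhs (Wti W t) c v := by
  have hW' := Wti_isWt hW h0 h1
  apply lapL_solve hW' (rhs_sum hW' hc)
  have hD := DD_ne hW h0 h1
  have e1 : sol W c t = ((DD W).eval t)⁻¹ • (fun v => (QQ W c v).eval t) := rfl
  rw [e1, map_smul, ← LinearMap.toMatrix'_mulVec, ← PM_eval]
  have e2 : (fun v => (QQ W c v).eval t) = (evalRingHom t) ∘ (QQ W c) := rfl
  funext v
  rw [e2, RingHom.mapMatrix_apply, Pi.smul_apply, ← RingHom.map_mulVec, QQ, Matrix.mulVec_mulVec,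
    Matrix.mul_adjugate, Matrix.smul_mulVec, Matrix.one_mulVec, Pi.smul_apply, smul_eq_mul, smul_eq_mul,
    map_mul, rhs_Wti W hc0]
  change _ * ((DD W).eval t * _) = _
  rw [inv_mul_cancel_left₀ hD]
  simp

noncomputable def cx (N : ℕ) (i : Fin 6) : ℝ := (N : ℝ)⁻¹ * (ddr i).1
noncomputable def cy (N : ℕ) (i : Fin 6) : ℝ := (N : ℝ)⁻¹ * (ddr i).2

lemma ddr_opp (i : Fin 6) : ddr (i+3) = - ddr i := by
  rw [show ddr = fun i => lat (dd i) from rfl]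
  simp only [← lat_neg, dd_opp]

lemma cx_opp (i : Fin 6) : cx N (i+3) = - cx N i := by simp [cx, ddr_opp]
lemma cy_opp (i : Fin 6) : cy N (i+3) = - cy N i := by simp [cy, ddr_opp]
lemma cx_sum : ∑ i, cx N i = 0 := by
  simp only [cx, ← Finset.mul_sum]; simp [Fin.sum_univ_succ, ddr, dd]
lemma cy_sum : ∑ i, cy N i = 0 := by
  simp only [cy, ← Finset.mul_sum]; simp [Fin.sum_univ_succ, ddr, dd]

noncomputable def uu (W : VV N → Fin 6 → ℝ) (t : ℝ) (v : VV N) : E2 := (sol W (cx N) t v, sol W (cy N) t v)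

/-- harmonic -/
def Harm (W : VV N → Fin 6 → ℝ) (u : VV N → E2) : Prop := ∀ v, ∑ i, W v i • dl u v i = 0

lemma Harm.hull {W : VV N → Fin 6 → ℝ} (hW : IsWt W) {u : VV N → E2} (h : Harm W u) (v : VV N) :
    Hull (dl u v) := by
  intro a ha
  have h1 : ∑ i, W v i * dot2 a (dl u v i) = 0 := by
    have h2 := congrArg Prod.fst (h v)
    have h3 := congrArg Prod.snd (h v)
    simp only [Prod.fst_sum, Prod.snd_sum, Prod.smul_fst, Prod.smul_snd, smul_eq_mul, Prod.fst_zero, Prod.snd_zero] at h2 h3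
    have : ∑ i, W v i * dot2 a (dl u v i) = a.1 * ∑ i, W v i * (dl u v i).1 + a.2 * ∑ i, W v i * (dl u v i).2 := by
      simp only [Finset.mul_sum, ← Finset.sum_add_distrib, dot2]
      exact Finset.sum_congr rfl fun i _ => by ring
    rw [this, h2, h3]; ring
  intro i
  have := (Finset.sum_eq_zero_iff_of_nonneg (fun i _ => mul_nonneg (hW.pos v i).le (ha i))).1 h1 i (Finset.mem_univ i)
  exact (mul_eq_zero.1 this).resolve_left (hW.pos v i).ne'

lemma uu_harm {W : VV N → Fin 6 → ℝ} (hW : IsWt W) {t : ℝ} (h0 : 0 ≤ t) (h1 : t ≤ 1) :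
    Harm (Wti W t) (uu W t) := by
  intro v
  have a := sol_lap hW (c := cx N) cx_opp cx_sum h0 h1 v
  have b := sol_lap hW (c := cy N) cy_opp cy_sum h0 h1 v
  simp only [lap, rhs] at a b
  ext
  · simp only [Prod.fst_sum, Prod.smul_fst, smul_eq_mul, Prod.fst_zero, dl, uu, Prod.fst_add, Prod.fst_sub, mul_add, Finset.sum_add_distrib]
    rw [a]; simp [cx]
  · simp only [Prod.snd_sum, Prod.smul_snd, smul_eq_mul, Prod.snd_zero, dl, uu, Prod.snd_add, Prod.snd_sub, mul_add, Finset.sum_add_distrib]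
    rw [b]; simp [cy]

lemma uu_one (W : VV N → Fin 6 → ℝ) : uu W 1 = 0 := by
  have : ∀ c v, sol W c 1 v = 0 := by
    intro c v
    simp only [sol, QQ]
    have e := RingHom.map_mulVec (evalRingHom 1) (PM W).adjugate (fun v => (1 - X : ℝ[X]) * C (rhs W c v)) v
    rw [coe_evalRingHom] at e
    rw [e]
    have : (eval 1 ∘ fun v => (1 - X : ℝ[X]) * C (rhs W c v)) = 0 := by
      funext v; simp
    rw [this]; simp
  funext v
  simp [uu, this]

/-- polynomial for the difference -/
noncomputable def RR (W : VV N → Fin 6 → ℝ) (c : Fin 6 → ℝ) (v : VV N) (i : Fin 6) : ℝ[X] :=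
  QQ W c (v + cz N (dd i)) - QQ W c v + C (c i) * DD W

lemma RR_eval {W : VV N → Fin 6 → ℝ} (hW : IsWt W) (c : Fin 6 → ℝ) {t : ℝ} (h0 : 0 ≤ t) (h1 : t ≤ 1) (v : VV N) (i : Fin 6) :
    (RR W c v i).eval t = (DD W).eval t * (sol W c t (v + cz N (dd i)) - sol W c t v + c i) := by
  have hD := DD_ne hW h0 h1
  simp only [RR, sol, eval_add, eval_sub, eval_mul, eval_C]
  field_simp

lemma dl_eq (W : VV N → Fin 6 → ℝ) (t : ℝ) (v : VV N) (i : Fin 6) : dl (uu W t) v i =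
    (sol W (cx N) t (v + cz N (dd i)) - sol W (cx N) t v + cx N i,
      sol W (cy N) t (v + cz N (dd i)) - sol W (cy N) t v + cy N i) := rfl

noncomputable def badP (W : VV N → Fin 6 → ℝ) (v : VV N) (i : Fin 6) : ℝ[X] :=
  RR W (cx N) v i * RR W (cy N) v (i+1) - RR W (cy N) v i * RR W (cx N) v (i+1)

lemma badP_eval {W : VV N → Fin 6 → ℝ} (hW : IsWt W) {t : ℝ} (h0 : 0 ≤ t) (h1 : t ≤ 1) (v : VV N) (i : Fin 6) :
    (badP W v i).eval t = ((DD W).eval t)^2 * det2 (dl (uu W t) v i) (dl (uu W t) v (i+1)) := by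
  simp only [badP, eval_sub, eval_mul, RR_eval hW _ h0 h1, dl_eq, det2]
  ring

lemma badP_ne {W : VV N → Fin 6 → ℝ} (hW : IsWt W) (v : VV N) (i : Fin 6) : badP W v i ≠ 0 := by
  intro h
  have h1 := badP_eval hW zero_le_one le_rfl v i
  rw [h, uu_one, eval_zero] at h1
  have hD := DD_ne hW zero_le_one le_rfl
  have hN : (N : ℝ) ≠ 0 := by exact_mod_cast NeZero.ne N
  have h2 := (mul_eq_zero.1 h1.symm).resolve_left (pow_ne_zero 2 hD)
  have h3 : det2 (dl (0 : VV N → E2) v i) (dl (0 : VV N → E2) v (i+1)) = (N:ℝ)⁻¹ ^2 := by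
    simp only [dl, det2]
    fin_cases i <;> simp [ddr, dd] <;> ring
  rw [h3] at h2
  exact pow_ne_zero 2 (inv_ne_zero hN) h2

def badSet (W : VV N → Fin 6 → ℝ) : Set ℝ := ⋃ v : VV N, ⋃ i : Fin 6, {t | (badP W v i).IsRoot t}

lemma badSet_finite {W : VV N → Fin 6 → ℝ} (hW : IsWt W) : (badSet W).Finite :=
  Set.finite_iUnion fun v => Set.finite_iUnion fun i => Polynomial.finite_setOfPred_isRoot (badP_ne hW v i)

lemma good_homeo {W : VV N → Fin 6 → ℝ} (hW : IsWt W) {t : ℝ} (h0 : 0 ≤ t) (h1 : t ≤ 1) (ht : t ∉ badSet W) :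
    ∃ K : E2 ≃ₜ E2, (∀ z, K z = GG (uu W t) z) ∧ Equi K := by
  apply tutte
  · exact fun v => (uu_harm hW h0 h1).hull (Wti_isWt hW h0 h1) v
  · intro v i h
    apply ht
    simp only [badSet, Set.mem_iUnion, Set.mem_ofPred_eq, IsRoot.def]
    exact ⟨v, i, by rw [badP_eval hW h0 h1, h, mul_zero]⟩

lemma uu_cont {W : VV N → Fin 6 → ℝ} (hW : IsWt W) : ContinuousOn (uu W) (Set.Icc 0 1) := by
  have hs : ∀ c v, ContinuousOn (fun t => sol W c t v) (Set.Icc 0 1) := by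
    intro c v
    apply ContinuousOn.mul
    · exact (DD W).continuous.continuousOn.inv₀ fun t ht => DD_ne hW ht.1 ht.2
    · exact (QQ W c v).continuous.continuousOn
  exact continuousOn_pi.2 fun v => (hs _ v).prodMk (hs _ v)

end
end TorusIso

namespace TorusIso
open Filter Topology Set

section
variable {N : ℕ} [NeZero N]

lemma LL_ddr (p : E2) : LL ddr p = p := by
  by_cases hp : p = 0
  · subst hp; simp [LL]
  · obtain ⟨i, α, β, ha, hb, rfl⟩ := exists_cone p hp
    exact LL_cone ddr i α β ha.le hb

lemma GG_zero (z : E2) : GG (0 : VV N → E2) z = z := by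
  have hN : (N : ℝ) ≠ 0 := by exact_mod_cast NeZero.ne N
  have h1 : ∀ v : VV N, dl (0 : VV N → E2) v = fun i => (N : ℝ)⁻¹ • ddr i := by
    intro v; funext i; simp [dl]
  have h2 : ∀ p, LL (fun i => (N : ℝ)⁻¹ • ddr i) p = (N : ℝ)⁻¹ • p := by
    intro p
    conv_rhs => rw [← LL_ddr p]
    simp only [LL]; module
  simp only [GG, KK, del_kk, h1, h2, kk, Pi.zero_apply, add_zero]
  rw [← smul_add, add_sub_cancel, smul_smul, inv_mul_cancel₀ hN, one_smul]

lemma triv_step {K K' : E2 ≃ₜ E2} (hE : Equi K) (hE' : Equi K') (h : ∀ z, ‖K z - K' z‖ ≤ 0.001) (hT : Triv K') :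
    Triv K := by
  refine Triv.of_comp_symm (G := K') ?_ hT
  refine local_triv (K'.symm.trans K) ?_ ?_
  · exact hE.comp hE'.symm
  · intro z
    have := h (K'.symm z)
    rwa [K'.apply_symm_apply] at this

lemma exists_good {S : Set ℝ} (hS : S.Finite) {a b : ℝ} (hab : a < b) : ∃ t, a < t ∧ t < b ∧ t ∉ S := by
  have : (Set.Ioo a b \ S).Nonempty := ((Set.Ioo_infinite hab).sdiff hS).nonempty
  obtain ⟨t, ht, ht'⟩ := this
  exact ⟨t, ht.1, ht.2, ht'⟩

lemma uu_unif {W : VV N → Fin 6 → ℝ} (hW : IsWt W) {ε : ℝ} (hε : 0 < ε) :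
    ∃ η > 0, ∀ t ∈ Set.Icc (0:ℝ) 1, ∀ t' ∈ Set.Icc (0:ℝ) 1, |t - t'| < η → ∀ z, ‖GG (uu W t) z - GG (uu W t') z‖ ≤ ε := by
  have hu := isCompact_Icc.uniformContinuousOn_of_continuous (uu_cont hW)
  rw [Metric.uniformContinuousOn_iff] at hu
  obtain ⟨η, hη, h⟩ := hu (ε / 13) (by positivity)
  refine ⟨η, hη, fun t ht t' ht' htt z => ?_⟩
  have h1 := h t ht t' ht' (by rwa [Real.dist_eq])
  have := GG_sub (uu W t) (uu W t') (S := ε / 13) (fun v => by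
    rw [← dist_eq_norm]
    exact (dist_le_pi_dist _ _ v).trans h1.le) z
  linarith

lemma chain {W : VV N → Fin 6 → ℝ} (hW : IsWt W) {t : ℝ} (h0 : 0 ≤ t) (h1 : t ≤ 1) (ht : t ∉ badSet W)
    {K : E2 ≃ₜ E2} (hK : ∀ z, K z = GG (uu W t) z) (hE : Equi K) : Triv K := by
  obtain ⟨η, hη, hη2⟩ := uu_unif hW (ε := 0.001) (by norm_num)
  have key : ∀ n : ℕ, ∀ t, 0 ≤ t → t ≤ 1 → 1 - t < n * (η / 2) → t ∉ badSet W → ∀ K : E2 ≃ₜ E2,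
      (∀ z, K z = GG (uu W t) z) → Equi K → Triv K := by
    intro n
    induction n with
    | zero => intro t h0 h1 h; exfalso; simp at h; linarith
    | succ n ih =>
      intro t h0 h1 hn ht K hK hE
      by_cases hcl : 1 - t < η
      · refine triv_step (K' := Homeomorph.refl E2) hE (fun z n => rfl) ?_ triv_id
        intro z
        have := hη2 t ⟨h0, h1⟩ 1 ⟨zero_le_one, le_rfl⟩ (by rw [abs_lt]; constructor <;> linarith) z
        rw [uu_one, GG_zero, ← hK] at this
        exact this
      · obtain ⟨s, hs1, hs2, hs3⟩ := exists_good (badSet_finite hW) (show t + η / 2 < t + η by linarith)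
        have hs0 : 0 ≤ s := by linarith
        have hs1' : s ≤ 1 := by linarith
        obtain ⟨K', hK', hE'⟩ := good_homeo hW hs0 hs1' hs3
        refine triv_step (K' := K') hE hE' ?_ (ih s hs0 hs1' ?_ hs3 K' hK' hE')
        · intro z
          rw [hK, hK']
          exact hη2 t ⟨h0, h1⟩ s ⟨hs0, hs1'⟩ (by rw [abs_lt]; constructor <;> linarith) z
        · push_cast at hn; linarith
  obtain ⟨n, hn⟩ := exists_nat_gt ((1 - t) / (η / 2))
  rw [div_lt_iff₀ (by positivity)] at hn
  exact key n t h0 h1 hn ht K hK hE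

theorem harm_triv {W : VV N → Fin 6 → ℝ} (hW : IsWt W) : ∃ u : VV N → E2, Harm W u ∧ ∀ ε > 0,
    ∃ K : E2 ≃ₜ E2, Triv K ∧ Equi K ∧ ∀ z, ‖K z - GG u z‖ ≤ ε := by
  refine ⟨uu W 0, ?_, fun ε hε => ?_⟩
  · have := uu_harm hW le_rfl zero_le_one
    have e : Wti W 0 = W := by funext v i; simp [Wti]
    rwa [e] at this
  · obtain ⟨η, hη, hη2⟩ := uu_unif hW hε
    obtain ⟨s, hs1, hs2, hs3⟩ := exists_good (badSet_finite hW) (show (0:ℝ) < min η 1 by positivity)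
    have h1 : s < η := hs2.trans_le (min_le_left _ _)
    have h2 : s ≤ 1 := (hs2.trans_le (min_le_right _ _)).le
    obtain ⟨K, hK, hE⟩ := good_homeo hW hs1.le h2 hs3
    refine ⟨K, chain hW hs1.le h2 hs3 hK hE, hE, fun z => ?_⟩
    rw [hK]
    exact hη2 s ⟨hs1.le, h2⟩ 0 ⟨le_rfl, zero_le_one⟩ (by rw [abs_lt]; constructor <;> linarith) z

end
end TorusIso

namespace TorusIso
open Filter Topology Set

section energy
variable {N : ℕ} [NeZero N] {ι : Type} [Fintype ι]

/-- Reversal of an oriented edge. -/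
def rv (p : VV N × Fin 6) : VV N × Fin 6 := (p.1 + cz N (dd p.2), p.2 + 3)

lemma rv_rv (p : VV N × Fin 6) : rv (rv p) = p := by
  obtain ⟨v, i⟩ := p
  simp only [rv, Prod.mk.injEq]
  refine ⟨back v i, ?_⟩
  rw [add_assoc]
  have : (3 + 3 : Fin 6) = 0 := rfl
  rw [this, add_zero]

open Classical in
/-- The weights: large on `A`, one on special edges, small elsewhere. -/
noncomputable def wt (r : ℝ) (A : VV N → Fin 6 → Prop) (sp : ι → VV N × Fin 6) (v : VV N) (i : Fin 6) : ℝ :=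
  r ^ 2 * (if A v i then 1 else 0) + (r ^ 2)⁻¹
    + ∑ s, ((if sp s = (v, i) then (1 : ℝ) else 0) + (if rv (sp s) = (v, i) then 1 else 0))

lemma wt_isWt {r : ℝ} (hr : 0 < r) {A : VV N → Fin 6 → Prop}
    (hA : ∀ v i, A (v + cz N (dd i)) (i+3) ↔ A v i) (sp : ι → VV N × Fin 6) : IsWt (wt r A sp) := by
  classical
  constructor
  · intro v i
    unfold wt
    have h1 : 0 < (r ^ 2)⁻¹ := by positivity
    have h2 : 0 ≤ r ^ 2 * (if A v i then (1 : ℝ) else 0) := by split_ifs <;> positivity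
    have h3 : 0 ≤ ∑ s, ((if sp s = (v, i) then (1 : ℝ) else 0) + (if rv (sp s) = (v, i) then 1 else 0)) :=
      Finset.sum_nonneg fun s _ => by split_ifs <;> norm_num
    linarith
  · intro v i
    unfold wt
    congr 1
    · congr 2
      exact if_congr (hA v i) rfl rfl
    · refine Finset.sum_congr rfl fun s _ => ?_
      have e1 : (sp s = (v + cz N (dd i), i+3)) ↔ rv (sp s) = (v, i) := by
        constructor
        · intro h
          rw [h]; exact rv_rv (v, i)
        · intro h
          rw [← rv_rv (sp s), h]; rfl
      have e2 : (rv (sp s) = (v + cz N (dd i), i+3)) ↔ sp s = (v, i) := by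
        constructor
        · intro h
          rw [← rv_rv (sp s), h]; exact rv_rv (v, i)
        · intro h
          rw [h]; rfl
      simp only [e1, e2]
      exact add_comm _ _

open Classical in
lemma wt_sum (r : ℝ) (A : VV N → Fin 6 → Prop) (sp : ι → VV N × Fin 6) (X : VV N → Fin 6 → ℝ) :
    ∑ v, ∑ i, wt r A sp v i * X v i = r ^ 2 * ∑ v, ∑ i, (if A v i then X v i else 0)
      + (r ^ 2)⁻¹ * ∑ v, ∑ i, X v i + ∑ s, (X (sp s).1 (sp s).2 + X (rv (sp s)).1 (rv (sp s)).2) := by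
  have key : ∀ v i, wt r A sp v i * X v i = r ^ 2 * (if A v i then X v i else 0) + (r ^ 2)⁻¹ * X v i
      + ∑ s, ((if sp s = (v, i) then X v i else 0) + (if rv (sp s) = (v, i) then X v i else 0)) := by
    intro v i
    unfold wt
    rw [add_mul, add_mul, Finset.sum_mul]
    congr 1
    · congr 1
      split_ifs <;> ring
    · refine Finset.sum_congr rfl fun s _ => ?_
      split_ifs <;> ring
  simp only [key]
  simp only [Finset.sum_add_distrib, ← Finset.mul_sum]
  congr 1
  have g : ∀ p : VV N × Fin 6, ∑ v, ∑ i, (if p = (v, i) then X v i else 0) = X p.1 p.2 := by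
    intro p
    have := Fintype.sum_prod_type (fun q : VV N × Fin 6 => if p = q then X q.1 q.2 else 0)
    simp only at this
    rw [← this]
    simp
  have sw : ∀ φ : ι → VV N → Fin 6 → ℝ, ∑ v, ∑ i, ∑ s, φ s v i = ∑ s, ∑ v, ∑ i, φ s v i := by
    intro φ
    rw [Finset.sum_comm]
    rw [Finset.sum_congr rfl fun i _ => Finset.sum_comm]
    rw [Finset.sum_comm]
    refine Finset.sum_congr rfl fun s _ => ?_
    exact Finset.sum_comm
  rw [sw, sw]
  congr 1
  · exact Finset.sum_congr rfl fun s _ => g _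
  · exact Finset.sum_congr rfl fun s _ => g _

/-- Main scalar energy estimate. -/
lemma energy (A : VV N → Fin 6 → Prop) (sp : ι → VV N × Fin 6) (Γ : VV N → Fin 6 → ℝ)
    (hA : ∀ v i, A (v + cz N (dd i)) (i+3) ↔ A v i)
    (hΓ : ∀ v i, Γ (v + cz N (dd i)) (i+3) = - Γ v i) (hΓA : ∀ v i, A v i → Γ v i = 0)
    (C : ℝ) (hC : ∀ x : VV N → ℝ, ∀ δ : ℝ, (∀ v i, A v i → |x (v + cz N (dd i)) - x v| ≤ δ) →
      |∑ s, Γ (sp s).1 (sp s).2 * (x ((sp s).1 + cz N (dd (sp s).2)) - x (sp s).1)| ≤ C * δ) :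
    ∃ D : ℝ, 0 ≤ D ∧ ∀ r : ℝ, 1 ≤ r → ∀ x : VV N → ℝ,
      (∀ v, ∑ i, wt r A sp v i * (Γ v i + (x (v + cz N (dd i)) - x v)) = 0) →
      (∀ v i, A v i → |x (v + cz N (dd i)) - x v| ≤ D / r) ∧
      (∀ s, |x ((sp s).1 + cz N (dd (sp s).2)) - x (sp s).1| ≤ D / r) := by
  classical
  have hex : 0 ≤ ∑ v, ∑ i, |Γ v i| := Finset.sum_nonneg fun v _ => Finset.sum_nonneg fun i _ => abs_nonneg _
  refine ⟨∑ v, ∑ i, |Γ v i| + 2 * |C|, by positivity, ?_⟩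
  intro r hr x hx
  have hr0 : 0 < r := by linarith
  have hW := wt_isWt hr0 hA sp
  set W := wt r A sp with hWdef
  set d : VV N → Fin 6 → ℝ := fun v i => x (v + cz N (dd i)) - x v with hd
  have hdop : ∀ v i, d (v + cz N (dd i)) (i+3) = - d v i := by
    intro v i
    simp only [hd, back]; ring
  have h1 := sbp (fun v i => W v i * (Γ v i + d v i)) (by
    intro v i
    simp only [hW.sym, hΓ, hdop]; ring) x
  have h2 : ∑ v, x v * ∑ i, W v i * (Γ v i + d v i) = 0 :=
    Finset.sum_eq_zero fun v _ => by rw [hx v, mul_zero]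
  rw [h2, mul_zero] at h1
  have h3 : ∑ v, ∑ i, W v i * (Γ v i * d v i) + ∑ v, ∑ i, W v i * (d v i) ^ 2 = 0 := by
    rw [← h1]
    simp only [← Finset.sum_add_distrib]
    refine Finset.sum_congr rfl fun v _ => Finset.sum_congr rfl fun i _ => ?_
    simp only [hd]; ring
  set B := ∑ v, ∑ i, W v i * (d v i) ^ 2 with hB
  have hB0 : 0 ≤ B := Finset.sum_nonneg fun v _ => Finset.sum_nonneg fun i _ =>
    mul_nonneg (hW.pos v i).le (sq_nonneg _)
  have hterm : ∀ v i, W v i * (d v i) ^ 2 ≤ B := by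
    intro v i
    have a1 : W v i * (d v i) ^ 2 ≤ ∑ j, W v j * (d v j) ^ 2 :=
      Finset.single_le_sum (f := fun j => W v j * (d v j) ^ 2)
        (fun j _ => mul_nonneg (hW.pos v j).le (sq_nonneg _)) (Finset.mem_univ i)
    have a2 : ∑ j, W v j * (d v j) ^ 2 ≤ B :=
      Finset.single_le_sum (f := fun v => ∑ j, W v j * (d v j) ^ 2)
        (fun w _ => Finset.sum_nonneg fun j _ => mul_nonneg (hW.pos w j).le (sq_nonneg _)) (Finset.mem_univ v)
    linarith
  set s := Real.sqrt B with hs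
  have hs0 : 0 ≤ s := Real.sqrt_nonneg _
  have hsB : s ^ 2 = B := Real.sq_sqrt hB0
  have hge : ∀ (v : VV N) (i : Fin 6), 0 ≤ ∑ t, ((if sp t = (v, i) then (1 : ℝ) else 0) + (if rv (sp t) = (v, i) then 1 else 0)) :=
    fun v i => Finset.sum_nonneg fun t _ => by split_ifs <;> norm_num
  have hWall : ∀ v i, (r^2)⁻¹ ≤ W v i := by
    intro v i
    have := hge v i
    have h2 : 0 ≤ r ^ 2 * (if A v i then (1 : ℝ) else 0) := by split_ifs <;> positivity
    simp only [hWdef, wt]; linarith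
  have hWA : ∀ v i, A v i → r^2 ≤ W v i := by
    intro v i hv
    have := hge v i
    have h2 : 0 < (r ^ 2)⁻¹ := by positivity
    simp only [hWdef, wt, if_pos hv]; linarith
  have hWs : ∀ t, 1 ≤ W (sp t).1 (sp t).2 := by
    intro t
    have a1 : (1:ℝ) ≤ ∑ t', ((if sp t' = ((sp t).1, (sp t).2) then (1 : ℝ) else 0) + (if rv (sp t') = ((sp t).1, (sp t).2) then 1 else 0)) := by
      have := Finset.single_le_sum (f := fun t' => ((if sp t' = ((sp t).1, (sp t).2) then (1 : ℝ) else 0) + (if rv (sp t') = ((sp t).1, (sp t).2) then 1 else 0)))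
        (fun t' _ => by split_ifs <;> norm_num) (Finset.mem_univ t)
      refine le_trans ?_ this
      simp only [if_true]
      split_ifs <;> norm_num
    have h1 : 0 < (r ^ 2)⁻¹ := by positivity
    have h2 : 0 ≤ r ^ 2 * (if A (sp t).1 (sp t).2 then (1 : ℝ) else 0) := by split_ifs <;> positivity
    simp only [hWdef, wt]; linarith
  have bA : ∀ v i, A v i → |d v i| ≤ s / r := by
    intro v i hv
    rw [le_div_iff₀ hr0]
    refine abs_le_of_sq_le_sq' ?_ hs0 |>.2
    have := mul_le_mul_of_nonneg_right (hWA v i hv) (sq_nonneg (d v i))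
    have := hterm v i
    rw [mul_pow, sq_abs]; linarith
  have ball : ∀ v i, |d v i| ≤ s * r := by
    intro v i
    refine abs_le_of_sq_le_sq' ?_ (by positivity) |>.2
    have h1 := mul_le_mul_of_nonneg_right (hWall v i) (sq_nonneg (d v i))
    have h2 := hterm v i
    rw [sq_abs, mul_pow]
    have h3 : (r^2)⁻¹ * (d v i)^2 ≤ s^2 := by linarith
    rwa [inv_mul_le_iff₀ (by positivity), mul_comm] at h3
  have bs : ∀ t, |d (sp t).1 (sp t).2| ≤ s := by
    intro t
    refine abs_le_of_sq_le_sq' ?_ hs0 |>.2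
    have h1 := mul_le_mul_of_nonneg_right (hWs t) (sq_nonneg (d (sp t).1 (sp t).2))
    have h2 := hterm (sp t).1 (sp t).2
    rw [sq_abs]; linarith
  have hsum := wt_sum r A sp (fun v i => Γ v i * d v i)
  have z1 : ∑ v, ∑ i, (if A v i then Γ v i * d v i else 0) = 0 :=
    Finset.sum_eq_zero fun v _ => Finset.sum_eq_zero fun i _ => by
      split_ifs with h
      · rw [hΓA v i h, zero_mul]
      · rfl
  have z2 : ∀ t, Γ (rv (sp t)).1 (rv (sp t)).2 * d (rv (sp t)).1 (rv (sp t)).2 = Γ (sp t).1 (sp t).2 * d (sp t).1 (sp t).2 := by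
    intro t
    simp only [rv, hΓ, hdop]; ring
  simp only [z2, ← two_mul, ← Finset.mul_sum] at hsum
  rw [z1, mul_zero, zero_add, ← hWdef] at hsum
  have c1 := hC x (s / r) bA
  have c2 : |∑ v, ∑ i, Γ v i * d v i| ≤ (∑ v, ∑ i, |Γ v i|) * (s * r) := by
    rw [Finset.sum_mul]
    refine (Finset.abs_sum_le_sum_abs _ _).trans (Finset.sum_le_sum fun v _ => ?_)
    rw [Finset.sum_mul]
    refine (Finset.abs_sum_le_sum_abs _ _).trans (Finset.sum_le_sum fun i _ => ?_)
    rw [abs_mul]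
    exact mul_le_mul_of_nonneg_left (ball v i) (abs_nonneg _)
  have hfin : s ^ 2 ≤ (∑ v, ∑ i, |Γ v i| + 2 * |C|) * (s / r) := by
    have e1 : s ^ 2 = - ((r ^ 2)⁻¹ * ∑ v, ∑ i, Γ v i * d v i + 2 * ∑ t, Γ (sp t).1 (sp t).2 * d (sp t).1 (sp t).2) := by
      rw [hsB, ← hsum]; linarith
    have e2 := neg_abs_le (∑ v, ∑ i, Γ v i * d v i)
    have e3 := neg_abs_le (∑ t, Γ (sp t).1 (sp t).2 * d (sp t).1 (sp t).2)
    have e4 : (r ^ 2)⁻¹ * -(∑ v, ∑ i, Γ v i * d v i) ≤ (r^2)⁻¹ * ((∑ v, ∑ i, |Γ v i|) * (s * r)) :=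
      mul_le_mul_of_nonneg_left (by linarith) (by positivity)
    have e5 : (r^2)⁻¹ * ((∑ v, ∑ i, |Γ v i|) * (s * r)) = (∑ v, ∑ i, |Γ v i|) * (s / r) := by
      field_simp
    have e6 : C * (s / r) ≤ |C| * (s/r) := mul_le_mul_of_nonneg_right (le_abs_self C) (by positivity)
    have c1' : |∑ t, Γ (sp t).1 (sp t).2 * d (sp t).1 (sp t).2| ≤ C * (s / r) := c1
    rw [e1]
    rw [add_mul]
    linarith
  have hsle : s ≤ (∑ v, ∑ i, |Γ v i| + 2 * |C|) / r := by
    rcases hs0.eq_or_lt with h | h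
    · rw [← h]; positivity
    · have hfin : s * s ≤ s * ((∑ v, ∑ i, |Γ v i| + 2 * |C|) / r) := by
        calc s * s = s ^ 2 := (sq s).symm
          _ ≤ _ := hfin
          _ = _ := by ring
      exact le_of_mul_le_mul_left hfin h
  constructor
  · intro v i hv
    refine (bA v i hv).trans ((div_le_self hs0 hr).trans hsle)
  · intro t
    exact (bs t).trans hsle

end energy
end TorusIso

namespace TorusIso
open Filter Topology Set

/-- The two positive axis directions. -/
def ev : Fin 2 → ℤ × ℤ := ![(1,0),(0,1)]

lemma cz_eq {N : ℕ} {a b : ℤ × ℤ} (h : cz N a = cz N b) : ∃ n, a = b + (N : ℤ) • n := by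
  simp only [cz, Prod.mk.injEq] at h
  obtain ⟨h1, h2⟩ := h
  rw [eq_comm, ZMod.intCast_eq_intCast_iff_dvd_sub] at h1 h2
  obtain ⟨p, hp⟩ := h1
  obtain ⟨q, hq⟩ := h2
  refine ⟨(p, q), ?_⟩
  ext
  · simp; linarith
  · simp; linarith

section lab
variable {N m : ℕ} [NeZero N] [NeZero m]

lemma dl_opp (u : VV N → E2) (v : VV N) (i : Fin 6) : dl u (v + cz N (dd i)) (i+3) = - dl u v i := by
  simp only [dl, back, ddr_opp, smul_neg]
  abel

/-- Uniform comparison of values of slowly varying functions. -/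
def Lk (T : VV N → Fin 6 → Prop) (c c' : VV N) : Prop :=
  ∃ L : ℝ, ∀ (x : VV N → ℝ) (δ : ℝ), (∀ v i, T v i → |x (v + cz N (dd i)) - x v| ≤ δ) → |x c - x c'| ≤ L * δ

lemma Lk.refl (T : VV N → Fin 6 → Prop) (c : VV N) : Lk T c c := ⟨0, fun x δ _ => by simp⟩

lemma Lk.symm {T : VV N → Fin 6 → Prop} {c c' : VV N} (h : Lk T c c') : Lk T c' c := by
  obtain ⟨L, hL⟩ := h
  exact ⟨L, fun x δ hx => by rw [abs_sub_comm]; exact hL x δ hx⟩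

lemma Lk.trans {T : VV N → Fin 6 → Prop} {a b c : VV N} (h : Lk T a b) (h' : Lk T b c) : Lk T a c := by
  obtain ⟨L, hL⟩ := h
  obtain ⟨L', hL'⟩ := h'
  refine ⟨L + L', fun x δ hx => ?_⟩
  have := abs_sub_le (x a) (x b) (x c)
  have := hL x δ hx
  have := hL' x δ hx
  rw [add_mul]; linarith

lemma Lk.edge {T : VV N → Fin 6 → Prop} {a : VV N} {i : Fin 6} (h : T a i) : Lk T a (a + cz N (dd i)) :=
  ⟨1, fun x δ hx => by rw [abs_sub_comm, one_mul]; exact hx a i h⟩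

lemma Lk.mono {T T' : VV N → Fin 6 → Prop} (hT : ∀ v i, T v i → T' v i) {a b : VV N} (h : Lk T a b) : Lk T' a b := by
  obtain ⟨L, hL⟩ := h
  exact ⟨L, fun x δ hx => hL x δ fun v i hv => hx v i (hT v i hv)⟩

lemma approx_of_labels (ℓ : ℤ × ℤ → ℤ × ℤ) (L1 : ∀ v n, ℓ (v + (N : ℤ) • n) = ℓ v + (m : ℤ) • n)
    (L3 : ∀ v w, ℓ v = ℓ w → Relation.ReflTransGen (fun a b => ℓ a = ℓ b ∧ ∃ i, b = a + dd i) v w)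
    (L4 : ∀ (J : ℤ × ℤ) (e : Fin 2), ∃ v i, ℓ v = J ∧ ℓ (v + dd i) = J + ev e) {ε : ℝ} (hε : 0 < ε) :
    ∃ W : VV N → Fin 6 → ℝ, IsWt W ∧ ∀ u, Harm W u → ∃ c : E2, ∀ v, ‖kk u v - (m : ℝ)⁻¹ • lat (ℓ v) - c‖ ≤ ε := by
  classical
  -- comparison function
  obtain ⟨uq, huq⟩ : ∃ uq : VV N → E2, ∀ v, kk uq v = (m : ℝ)⁻¹ • lat (ℓ v) := by
    refine ⟨fun c => (m : ℝ)⁻¹ • lat (ℓ (Function.surjInv (cz_surj N) c)) - (N : ℝ)⁻¹ • lat (Function.surjInv (cz_surj N) c), ?_⟩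
    intro v
    obtain ⟨n, hn⟩ := cz_eq (Function.surjInv_eq (cz_surj N) (cz N v))
    have hN : (N : ℝ) ≠ 0 := Nat.cast_ne_zero.2 (NeZero.ne N)
    have hm : (m : ℝ) ≠ 0 := Nat.cast_ne_zero.2 (NeZero.ne m)
    simp only [kk]
    rw [hn, L1]
    ext <;> simp [lat] <;> field_simp <;> ring
  have hdl : ∀ v i, dl uq (cz N v) i = (m : ℝ)⁻¹ • lat (ℓ (v + dd i)) - (m : ℝ)⁻¹ • lat (ℓ v) := by
    intro v i
    rw [← del_kk]; simp only [del, huq]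
  set A : VV N → Fin 6 → Prop := fun c i => dl uq c i = 0 with hAdef
  have hA : ∀ v i, A (v + cz N (dd i)) (i+3) ↔ A v i := by
    intro v i
    simp only [hAdef, dl_opp, neg_eq_zero]
  have hcls : ∀ v w, ℓ v = ℓ w → Lk A (cz N v) (cz N w) := by
    intro v w h
    have := L3 v w h
    induction this with
    | refl => exact Lk.refl _ _
    | tail hb hc ih =>
      obtain ⟨h1, i, rfl⟩ := hc
      refine (ih (h.trans h1.symm)).trans ?_
      rw [cz_add]
      apply Lk.edge
      simp only [hAdef]
      rw [hdl, ← h1, sub_self]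
  have hcls' : ∀ v w, cz m (ℓ v) = cz m (ℓ w) → Lk A (cz N v) (cz N w) := by
    intro v w h
    obtain ⟨n, hn⟩ := cz_eq h
    have h1 := hcls v (w + (N : ℤ) • n) (by rw [L1, hn])
    rwa [cz_add, cz_smul, add_zero] at h1
  choose vv ii hv1 hv2 using L4
  set rep : VV m → ℤ × ℤ := Function.surjInv (cz_surj m) with hrep
  have hrep' : ∀ j, cz m (rep j) = j := Function.surjInv_eq (cz_surj m)
  set sp : VV m × Fin 2 → VV N × Fin 6 := fun p => (cz N (vv (rep p.1) p.2), ii (rep p.1) p.2) with hsp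
  set β : VV m → VV N := fun j => cz N (vv (rep j) 0) with hβ
  have hs1 : ∀ p : VV m × Fin 2, Lk A (sp p).1 (β p.1) := by
    intro p
    apply hcls; rw [hv1, hv1]
  have hs2 : ∀ p : VV m × Fin 2, Lk A ((sp p).1 + cz N (dd (sp p).2)) (β (p.1 + cz m (ev p.2))) := by
    intro p
    simp only [hsp, hβ, ← cz_add]
    apply hcls'
    rw [hv2, hv1, hrep', cz_add, hrep']
  have hΓsp : ∀ p : VV m × Fin 2, dl uq (sp p).1 (sp p).2 = (m : ℝ)⁻¹ • lat (ev p.2) := by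
    intro p
    simp only [hsp]
    rw [hdl, hv1, hv2, lat_add, smul_add]; abel
  have htel : ∀ γ : Fin 2 → ℝ, ∃ C : ℝ, ∀ x : VV N → ℝ, ∀ δ : ℝ, (∀ v i, A v i → |x (v + cz N (dd i)) - x v| ≤ δ) →
      |∑ s, γ s.2 * (x ((sp s).1 + cz N (dd (sp s).2)) - x (sp s).1)| ≤ C * δ := by
    intro γ
    choose M1 hM1 using hs1
    choose M2 hM2 using hs2
    refine ⟨∑ s, |γ s.2| * (M1 s + M2 s), fun x δ hx => ?_⟩
    have e0 : ∑ s : VV m × Fin 2, γ s.2 * (x (β (s.1 + cz m (ev s.2))) - x (β s.1)) = 0 := by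
      rw [Fintype.sum_prod_type_right]
      refine Finset.sum_eq_zero fun e _ => ?_
      simp only
      rw [← Finset.mul_sum, Finset.sum_sub_distrib]
      have := Equiv.sum_comp (Equiv.addRight (cz m (ev e))) (fun j => x (β j))
      simp only [Equiv.coe_addRight] at this
      rw [this, sub_self, mul_zero]
    rw [← sub_zero (∑ s, _), ← e0, ← Finset.sum_sub_distrib, Finset.sum_mul]
    refine (Finset.abs_sum_le_sum_abs _ _).trans (Finset.sum_le_sum fun s _ => ?_)
    rw [← mul_sub, abs_mul, mul_assoc]
    refine mul_le_mul_of_nonneg_left ?_ (abs_nonneg _)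
    have a1 := abs_le.1 (hM1 s x δ hx)
    have a2 := abs_le.1 (hM2 s x δ hx)
    rw [add_mul, abs_le]; constructor <;> linarith [a1.1, a1.2, a2.1, a2.2]
  -- connectivity
  set T : VV N → Fin 6 → Prop := fun v i => A v i ∨ ∃ s, sp s = (v, i) with hT
  have hβe : ∀ (j : VV m) (e : Fin 2), Lk T (β j) (β (j + cz m (ev e))) := by
    intro j e
    have hm : ∀ v i, A v i → T v i := fun v i h => Or.inl h
    refine ((hs1 (j, e)).mono hm).symm.trans (Lk.trans ?_ ((hs2 (j, e)).mono hm))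
    exact Lk.edge (Or.inr ⟨(j, e), rfl⟩)
  have hβd : ∀ (j : VV m) (i : Fin 6), Lk T (β j) (β (j + cz m (dd i))) := by
    have n0 : ∀ j : VV m, Lk T (β j) (β (j + cz m (1,0))) := fun j => hβe j 0
    have n1 : ∀ j : VV m, Lk T (β j) (β (j + cz m (0,1))) := fun j => hβe j 1
    have n2 : ∀ j : VV m, Lk T (β j) (β (j + cz m (1,1))) := fun j => by
      have := (n0 j).trans (n1 _)
      rwa [add_assoc, ← cz_add] at this
    have ng : ∀ (d : ℤ × ℤ), (∀ j : VV m, Lk T (β j) (β (j + cz m d))) → ∀ j : VV m, Lk T (β j) (β (j + cz m (-d))) := by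
      intro d hd j
      have := (hd (j + cz m (-d))).symm
      rwa [cz_neg, neg_add_cancel_right, ← cz_neg] at this
    intro j i
    fin_cases i
    · exact n0 j
    · exact n2 j
    · exact n1 j
    · exact ng _ n0 j
    · exact ng _ n2 j
    · exact ng _ n1 j
  have hβ0 : ∀ j : VV m, Lk T (β j) (β 0) := by
    intro j
    have := const_of_edges (N := m) (x := fun j => if Lk T (β j) (β 0) then (1 : ℝ) else 0) (by
      intro v i
      have := hβd v i
      exact if_congr ⟨fun h => this.trans h, fun h => this.symm.trans h⟩ rfl rfl) j
    simp only [Lk.refl, if_true] at this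
    by_contra hc
    rw [if_neg hc] at this
    norm_num at this
  have hall : ∀ c : VV N, Lk T c (β 0) := by
    intro c
    obtain ⟨v, rfl⟩ := cz_surj N c
    refine Lk.trans ?_ (hβ0 (cz m (ℓ v)))
    refine Lk.mono (fun v i h => Or.inl h) (hcls' v _ ?_)
    rw [hv1, hrep']
  choose Lc hLc using hall
  obtain ⟨C1, hC1⟩ := htel (fun e => ((m : ℝ)⁻¹ • lat (ev e)).1)
  obtain ⟨C2, hC2⟩ := htel (fun e => ((m : ℝ)⁻¹ • lat (ev e)).2)
  obtain ⟨D1, hD1, hE1⟩ := energy A sp (fun v i => (dl uq v i).1) hA (fun v i => by simp [dl_opp])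
    (fun v i h => by simp only [hAdef] at h; rw [h]; rfl) C1 (by
      intro x δ hx
      simp only [hΓsp]; exact hC1 x δ hx)
  obtain ⟨D2, hD2, hE2⟩ := energy A sp (fun v i => (dl uq v i).2) hA (fun v i => by simp [dl_opp])
    (fun v i h => by simp only [hAdef] at h; rw [h]; rfl) C2 (by
      intro x δ hx
      simp only [hΓsp]; exact hC2 x δ hx)
  set S := ∑ c, |Lc c| with hS
  have hS0 : 0 ≤ S := Finset.sum_nonneg fun _ _ => abs_nonneg _
  have hSc : ∀ c, Lc c ≤ S := fun c => (le_abs_self _).trans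
    (Finset.single_le_sum (f := fun c => |Lc c|) (fun _ _ => abs_nonneg _) (Finset.mem_univ c))
  set r : ℝ := 1 + S * (D1 + D2) / ε with hr
  have hr1 : 1 ≤ r := by
    have : 0 ≤ S * (D1 + D2) / ε := by positivity
    linarith
  have hr0 : 0 < r := by linarith
  have hrS : S * ((D1 + D2) / r) ≤ ε := by
    rw [← mul_div_assoc, div_le_iff₀ hr0]
    have : ε * r = ε + S * (D1 + D2) := by rw [hr]; field_simp
    linarith
  refine ⟨wt r A sp, wt_isWt hr0 hA sp, fun u hu => ⟨u (β 0) - uq (β 0), ?_⟩⟩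
  have hdd : ∀ v i, dl u v i = dl uq v i + ((u - uq) (v + cz N (dd i)) - (u - uq) v) := by
    intro v i
    simp only [dl, Pi.sub_apply]; abel
  have fin : ∀ x : VV N → ℝ, ∀ D, 0 ≤ D → D ≤ D1 + D2 → ((∀ v i, A v i → |x (v + cz N (dd i)) - x v| ≤ D / r) ∧
      (∀ s, |x ((sp s).1 + cz N (dd (sp s).2)) - x (sp s).1| ≤ D / r)) → ∀ c, |x c - x (β 0)| ≤ ε := by
    intro x D h0 hD h c
    have h1 := hLc c x (D / r) (by
      rintro v i (hv | ⟨s, hs⟩)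
      · exact h.1 v i hv
      · have := h.2 s
        rw [hs] at this
        exact this)
    calc |x c - x (β 0)| ≤ Lc c * (D / r) := h1
      _ ≤ S * (D / r) := mul_le_mul_of_nonneg_right (hSc c) (by positivity)
      _ ≤ S * ((D1 + D2) / r) := by gcongr
      _ ≤ ε := hrS
  intro v
  have q1 := fin (fun c => ((u - uq) c).1) D1 hD1 (by linarith) (hE1 r hr1 (fun c => ((u - uq) c).1) (by
    intro v
    have := congrArg Prod.fst (hu v)
    simp only [hdd, Prod.fst_sum, Prod.smul_fst, smul_eq_mul, Prod.fst_add, Prod.fst_sub, Prod.fst_zero] at this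
    exact this)) (cz N v)
  have q2 := fin (fun c => ((u - uq) c).2) D2 hD2 (by linarith) (hE2 r hr1 (fun c => ((u - uq) c).2) (by
    intro v
    have := congrArg Prod.snd (hu v)
    simp only [hdd, Prod.snd_sum, Prod.smul_snd, smul_eq_mul, Prod.snd_add, Prod.snd_sub, Prod.snd_zero] at this
    exact this)) (cz N v)
  rw [← huq]
  have e : kk u v - kk uq v - (u (β 0) - uq (β 0)) = (u - uq) (cz N v) - (u - uq) (β 0) := by
    simp only [kk, Pi.sub_apply]; abel
  rw [e, Prod.norm_def]
  exact max_le q1 q2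

end lab
end TorusIso

namespace TorusIso
open Filter Topology Set

/-- Lattice points within distance one of a set. -/
def nr (c : Set E2) : Set (ℤ × ℤ) := {v | ∃ x ∈ c, ‖lat v - x‖ ≤ 1}

/-- Mesh connectivity inside a set of lattice points. -/
def Cn (s : Set (ℤ × ℤ)) (a b : ℤ × ℤ) : Prop :=
  Relation.ReflTransGen (fun x y => x ∈ s ∧ y ∈ s ∧ ∃ i, y = x + dd i) a b

lemma Cn.refl (s : Set (ℤ × ℤ)) (a : ℤ × ℤ) : Cn s a a := Relation.ReflTransGen.refl

lemma Cn.trans {s : Set (ℤ × ℤ)} {a b c : ℤ × ℤ} (h : Cn s a b) (h' : Cn s b c) : Cn s a c :=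
  Relation.ReflTransGen.trans h h'

lemma Cn.symm {s : Set (ℤ × ℤ)} {a b : ℤ × ℤ} (h : Cn s a b) : Cn s b a := by
  unfold Cn at h
  induction h with
  | refl => exact Cn.refl _ _
  | tail _ hc ih =>
    obtain ⟨hx, hy, i, rfl⟩ := hc
    exact Relation.ReflTransGen.head ⟨hy, hx, i + 3, by rw [dd_opp]; abel⟩ ih

lemma Cn.mono {s t : Set (ℤ × ℤ)} (hst : s ⊆ t) {a b : ℤ × ℤ} (h : Cn s a b) : Cn t a b := by
  unfold Cn at h
  induction h with
  | refl => exact Cn.refl _ _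
  | tail _ hc ih => exact Relation.ReflTransGen.tail ih ⟨hst hc.1, hst hc.2.1, hc.2.2⟩

lemma Cn.edge {s : Set (ℤ × ℤ)} {a : ℤ × ℤ} (ha : a ∈ s) (i : Fin 6) (hb : a + dd i ∈ s) : Cn s a (a + dd i) :=
  Relation.ReflTransGen.single ⟨ha, hb, i, rfl⟩

lemma hline {s : Set (ℤ × ℤ)} (t p : ℤ) (n : ℕ) (h : ∀ k : ℤ, p ≤ k → k ≤ p + n → (k, t) ∈ s) :
    Cn s (p, t) (p + n, t) := by
  induction n with
  | zero => simpa using Cn.refl s (p, t)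
  | succ n ih =>
    refine (ih fun k h1 h2 => h k h1 (by push_cast; linarith)).trans ?_
    have e : ((p + (n + 1 : ℕ), t) : ℤ × ℤ) = (p + n, t) + dd 0 := by
      ext
      · simp [dd]; ring
      · simp [dd]
    rw [e]
    apply Cn.edge
    · exact h _ (by linarith) (by push_cast; linarith)
    · rw [← e]; exact h _ (by push_cast; linarith) (by push_cast; linarith)

lemma vline {s : Set (ℤ × ℤ)} (t p : ℤ) (n : ℕ) (h : ∀ k : ℤ, p ≤ k → k ≤ p + n → (t, k) ∈ s) :
    Cn s (t, p) (t, p + n) := by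
  induction n with
  | zero => simpa using Cn.refl s (t, p)
  | succ n ih =>
    refine (ih fun k h1 h2 => h k h1 (by push_cast; linarith)).trans ?_
    have e : ((t, p + (n + 1 : ℕ)) : ℤ × ℤ) = (t, p + n) + dd 2 := by
      ext
      · simp [dd]
      · simp [dd]; ring
    rw [e]
    apply Cn.edge
    · exact h _ (by linarith) (by push_cast; linarith)
    · rw [← e]; exact h _ (by push_cast; linarith) (by push_cast; linarith)

lemma norm_le_iff' {p : E2} {r : ℝ} : ‖p‖ ≤ r ↔ |p.1| ≤ r ∧ |p.2| ≤ r := by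
  rw [Prod.norm_def]; exact max_le_iff

lemma box_conn (x : E2) {a b : ℤ × ℤ} (ha : ‖lat a - x‖ ≤ 1) (hb : ‖lat b - x‖ ≤ 1) :
    Cn {v | ‖lat v - x‖ ≤ 1} a b := by
  set s : Set (ℤ × ℤ) := {v | ‖lat v - x‖ ≤ 1} with hs
  have hmem : ∀ v : ℤ × ℤ, v ∈ s ↔ |(v.1 : ℝ) - x.1| ≤ 1 ∧ |(v.2 : ℝ) - x.2| ≤ 1 := fun v => by
    rw [hs, Set.mem_ofPred_eq, norm_le_iff']; rfl
  have hH : ∀ t p q : ℤ, p ≤ q → (p, t) ∈ s → (q, t) ∈ s → Cn s (p, t) (q, t) := by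
    intro t p q hpq hp hq
    obtain ⟨n, rfl⟩ := Int.le.dest hpq
    refine hline t p n fun k h1 h2 => ?_
    rw [hmem] at hp hq ⊢
    refine ⟨?_, hp.2⟩
    have h1' : (p : ℝ) ≤ k := by exact_mod_cast h1
    have h2' : (k : ℝ) ≤ (p + n : ℤ) := by exact_mod_cast h2
    have := (abs_le.1 hp.1).1
    have := (abs_le.1 hq.1).2
    simp only at *
    rw [abs_le]; constructor <;> linarith
  have hV : ∀ t p q : ℤ, p ≤ q → (t, p) ∈ s → (t, q) ∈ s → Cn s (t, p) (t, q) := by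
    intro t p q hpq hp hq
    obtain ⟨n, rfl⟩ := Int.le.dest hpq
    refine vline t p n fun k h1 h2 => ?_
    rw [hmem] at hp hq ⊢
    refine ⟨hp.1, ?_⟩
    have h1' : (p : ℝ) ≤ k := by exact_mod_cast h1
    have h2' : (k : ℝ) ≤ (p + n : ℤ) := by exact_mod_cast h2
    have := (abs_le.1 hp.2).1
    have := (abs_le.1 hq.2).2
    simp only at *
    rw [abs_le]; constructor <;> linarith
  have ha' : a ∈ s := ha
  have hb' : b ∈ s := hb
  obtain ⟨a1, a2⟩ := a
  obtain ⟨b1, b2⟩ := b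
  have hm : ((b1, a2) : ℤ × ℤ) ∈ s := by
    rw [hmem] at ha' hb' ⊢; exact ⟨hb'.1, ha'.2⟩
  refine Cn.trans (b := (b1, a2)) ?_ ?_
  · rcases le_total a1 b1 with h | h
    · exact hH _ _ _ h ha' hm
    · exact (hH _ _ _ h hm ha').symm
  · rcases le_total a2 b2 with h | h
    · exact hV _ _ _ h hm hb'
    · exact (hV _ _ _ h hb' hm).symm

lemma nr_conn {c : Set E2} (hc : IsPreconnected c) {a b : ℤ × ℤ} (ha : a ∈ nr c) (hb : b ∈ nr c) : Cn (nr c) a b := by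
  obtain ⟨x, hx, hax⟩ := ha
  obtain ⟨y, hy, hby⟩ := hb
  have key := hc.induction₂ (fun x y => ∀ a b : ℤ × ℤ, ‖lat a - x‖ ≤ 1 → ‖lat b - y‖ ≤ 1 → Cn (nr c) a b)
    (by
      intro x hx
      have : ∀ᶠ y in 𝓝[c] x, y ∈ Metric.ball x (1/2) := mem_nhdsWithin_of_mem_nhds (Metric.ball_mem_nhds x (by norm_num))
      filter_upwards [this, self_mem_nhdsWithin] with y hy hyc a b ha hb
      have sub : ∀ z ∈ c, {v | ‖lat v - z‖ ≤ 1} ⊆ nr c := fun z hz v hv => ⟨z, hz, hv⟩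
      have h1 := norm_sub_rnd x
      rw [norm_sub_rev] at h1
      rw [Metric.mem_ball, dist_eq_norm, norm_sub_rev] at hy
      have h2 : ‖lat (rnd x) - y‖ ≤ 1 := by
        have := norm_add_le (lat (rnd x) - x) (x - y)
        rw [sub_add_sub_cancel] at this
        linarith
      exact ((box_conn x ha (by linarith)).mono (sub x hx)).trans ((box_conn y h2 hb).mono (sub y hyc)))
    (by
      intro x y z hx hy hz h1 h2 a b ha hb
      have h := norm_sub_rnd y
      rw [norm_sub_rev] at h
      exact (h1 a (rnd y) ha (by linarith)).trans (h2 (rnd y) b (by linarith) hb))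
    (by
      intro x y hx hy h a b ha hb
      exact (h b a hb ha).symm) hx hy
  exact key a b hax hby

end TorusIso

namespace TorusIso
open Filter Topology Set

section labels
variable (G : E2 ≃ₜ E2)

/-- Seeds. -/
def SS (J : ℤ × ℤ) : Set (ℤ × ℤ) := nr {x | ‖G x - lat J‖ ≤ 0.4}

/-- Bridges. -/
def YY (J : ℤ × ℤ) (e : Fin 2) : Set (ℤ × ℤ) := nr {x | ‖G x - (lat J + (1/2 : ℝ) • lat (ev e))‖ ≤ 0.1}

/-- The part of the bridge attached to its starting point. -/
def DA (J : ℤ × ℤ) (e : Fin 2) : Set (ℤ × ℤ) :=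
  {v | v ∈ YY G J e \ SS G (J + ev e) ∧ ∃ a ∈ SS G J, Cn (YY G J e \ SS G (J + ev e)) v a}

/-- Neighbourhood of the grid. -/
def XX : Set (ℤ × ℤ) := {v | (∃ J, v ∈ SS G J) ∨ ∃ J e, v ∈ YY G J e}

/-- Labels near the grid. -/
def Lb (v J : ℤ × ℤ) : Prop :=
  v ∈ SS G J ∨ ∃ J0 e, v ∈ YY G J0 e ∧ ((v ∈ DA G J0 e ∧ J = J0) ∨ (v ∉ DA G J0 e ∧ J = J0 + ev e))

/-- Labels everywhere. -/
inductive Lab : ℤ × ℤ → ℤ × ℤ → Prop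
  | base {v J : ℤ × ℤ} (h : Lb G v J) : Lab v J
  | step {v J : ℤ × ℤ} (h : v ∉ XX G) (h' : Lab (v + (1, 0)) J) : Lab v J

variable {G}

lemma pre_ball (p : E2) (r : ℝ) : IsPreconnected {x | ‖G x - p‖ ≤ r} := by
  have : {x | ‖G x - p‖ ≤ r} = G.symm '' (Metric.closedBall p r) := by
    rw [Homeomorph.image_symm]
    ext x; simp [dist_eq_norm]
  rw [this]
  exact ((convex_closedBall p r).isPreconnected).image _ G.symm.continuous.continuousOn

lemma SS_conn (J : ℤ × ℤ) {a b : ℤ × ℤ} (ha : a ∈ SS G J) (hb : b ∈ SS G J) : Cn (SS G J) a b :=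
  nr_conn (pre_ball _ _) ha hb

lemma YY_conn (J : ℤ × ℤ) (e : Fin 2) {a b : ℤ × ℤ} (ha : a ∈ YY G J e) (hb : b ∈ YY G J e) : Cn (YY G J e) a b :=
  nr_conn (pre_ball _ _) ha hb

lemma lat_mk (v : ℤ × ℤ) : (lat v).1 = v.1 ∧ (lat v).2 = v.2 := ⟨rfl, rfl⟩

lemma mem_nr_rnd {c : Set E2} {x : E2} (hx : x ∈ c) : rnd x ∈ nr c := by
  refine ⟨x, hx, ?_⟩
  have := norm_sub_rnd x
  rw [norm_sub_rev] at this; linarith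

lemma norm_ev (e : Fin 2) : ‖lat (ev e)‖ = 1 := by
  rw [Prod.norm_def]
  fin_cases e <;> simp [ev, lat]

lemma exists_start (J : ℤ × ℤ) (e : Fin 2) : ∃ a, a ∈ SS G J ∧ a ∈ YY G J e := by
  refine ⟨rnd (G.symm (lat J + (0.4 : ℝ) • lat (ev e))), mem_nr_rnd ?_, mem_nr_rnd ?_⟩
  · simp only [Set.mem_ofPred_eq, Homeomorph.apply_symm_apply]
    rw [add_sub_cancel_left, norm_smul, norm_ev]; norm_num
  · simp only [Set.mem_ofPred_eq, Homeomorph.apply_symm_apply]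
    rw [add_sub_add_left_eq_sub, ← sub_smul, norm_smul, norm_ev, mul_one, Real.norm_eq_abs, abs_le]; norm_num

lemma exists_end (J : ℤ × ℤ) (e : Fin 2) : ∃ a, a ∈ SS G (J + ev e) ∧ a ∈ YY G J e := by
  refine ⟨rnd (G.symm (lat J + (0.6 : ℝ) • lat (ev e))), mem_nr_rnd ?_, mem_nr_rnd ?_⟩
  · simp only [Set.mem_ofPred_eq, Homeomorph.apply_symm_apply]
    rw [lat_add, add_sub_add_left_eq_sub]
    nth_rewrite 2 [← one_smul ℝ (lat (ev e))]
    rw [← sub_smul, norm_smul, norm_ev, mul_one, Real.norm_eq_abs, abs_le]; norm_num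
  · simp only [Set.mem_ofPred_eq, Homeomorph.apply_symm_apply]
    rw [add_sub_add_left_eq_sub, ← sub_smul, norm_smul, norm_ev, mul_one, Real.norm_eq_abs, abs_le]; norm_num

section modulus

lemma SS_close (hmod : ∀ x y : E2, ‖x - y‖ ≤ 1 → ‖G x - G y‖ ≤ 0.05) {v J : ℤ × ℤ} (h : v ∈ SS G J) :
    |(G (lat v)).1 - J.1| ≤ 0.45 ∧ |(G (lat v)).2 - J.2| ≤ 0.45 := by
  obtain ⟨x, hx, hvx⟩ := h
  have h1 := norm_le_iff'.1 (hmod _ _ hvx)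
  have h2 := norm_le_iff'.1 (show ‖G x - lat J‖ ≤ 0.4 from hx)
  simp only [Prod.fst_sub, Prod.snd_sub, (lat_mk J).1, (lat_mk J).2, abs_le] at h1 h2 ⊢
  obtain ⟨⟨a1, a2⟩, a3, a4⟩ := h1
  obtain ⟨⟨b1, b2⟩, b3, b4⟩ := h2
  refine ⟨⟨?_, ?_⟩, ?_, ?_⟩ <;> linarith

lemma YY_close (hmod : ∀ x y : E2, ‖x - y‖ ≤ 1 → ‖G x - G y‖ ≤ 0.05) {v J : ℤ × ℤ} {e : Fin 2} (h : v ∈ YY G J e) :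
    |(G (lat v)).1 - (J.1 + (1/2) * (ev e).1)| ≤ 0.15 ∧ |(G (lat v)).2 - (J.2 + (1/2) * (ev e).2)| ≤ 0.15 := by
  obtain ⟨x, hx, hvx⟩ := h
  have h1 := norm_le_iff'.1 (hmod _ _ hvx)
  have h2 := norm_le_iff'.1 (show ‖G x - (lat J + (1/2 : ℝ) • lat (ev e))‖ ≤ 0.1 from hx)
  simp only [Prod.fst_sub, Prod.snd_sub, Prod.fst_add, Prod.snd_add, Prod.smul_fst, Prod.smul_snd, smul_eq_mul,
    (lat_mk J).1, (lat_mk J).2, (lat_mk (ev e)).1, (lat_mk (ev e)).2, abs_le] at h1 h2 ⊢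
  obtain ⟨⟨a1, a2⟩, a3, a4⟩ := h1
  obtain ⟨⟨b1, b2⟩, b3, b4⟩ := h2
  refine ⟨⟨?_, ?_⟩, ?_, ?_⟩ <;> linarith

lemma int_eq {a b : ℤ} (h1 : (a : ℝ) < b + 1) (h2 : (b : ℝ) < a + 1) : a = b := by
  have h1' : a < b + 1 := by exact_mod_cast h1
  have h2' : b < a + 1 := by exact_mod_cast h2
  omega

lemma int_not {a b : ℤ} (h1 : (a : ℝ) < b + 1) (h2 : (b : ℝ) < a) : False := by
  have h1' : a < b + 1 := by exact_mod_cast h1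
  have h2' : b < a := by exact_mod_cast h2
  omega

lemma SS_unique (hmod : ∀ x y : E2, ‖x - y‖ ≤ 1 → ‖G x - G y‖ ≤ 0.05) {v J J' : ℤ × ℤ} (h : v ∈ SS G J) (h' : v ∈ SS G J') : J = J' := by
  have h1 := SS_close hmod h
  have h2 := SS_close hmod h'
  simp only [abs_le] at h1 h2
  obtain ⟨⟨a1, a2⟩, a3, a4⟩ := h1
  obtain ⟨⟨b1, b2⟩, b3, b4⟩ := h2
  ext
  · exact int_eq (by linarith) (by linarith)
  · exact int_eq (by linarith) (by linarith)

lemma YY_unique (hmod : ∀ x y : E2, ‖x - y‖ ≤ 1 → ‖G x - G y‖ ≤ 0.05) {v J J' : ℤ × ℤ} {e e' : Fin 2} (h : v ∈ YY G J e) (h' : v ∈ YY G J' e') : J = J' ∧ e = e' := by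
  have h1 := YY_close hmod h
  have h2 := YY_close hmod h'
  simp only [abs_le] at h1 h2
  obtain ⟨⟨a1, a2⟩, a3, a4⟩ := h1
  obtain ⟨⟨b1, b2⟩, b3, b4⟩ := h2
  fin_cases e <;> fin_cases e' <;> simp [ev] at a1 a2 a3 a4 b1 b2 b3 b4 ⊢
  · ext
    · exact int_eq (by linarith) (by linarith)
    · exact int_eq (by linarith) (by linarith)
  · exact int_not (a := J'.1) (b := J.1) (by linarith) (by linarith)
  · exact int_not (a := J.1) (b := J'.1) (by linarith) (by linarith)
  · ext
    · exact int_eq (by linarith) (by linarith)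
    · exact int_eq (by linarith) (by linarith)

lemma SY (hmod : ∀ x y : E2, ‖x - y‖ ≤ 1 → ‖G x - G y‖ ≤ 0.05) {v J J' : ℤ × ℤ} {e : Fin 2} (h : v ∈ SS G J) (h' : v ∈ YY G J' e) : J = J' ∨ J = J' + ev e := by
  have h1 := SS_close hmod h
  have h2 := YY_close hmod h'
  simp only [abs_le] at h1 h2
  obtain ⟨⟨a1, a2⟩, a3, a4⟩ := h1
  obtain ⟨⟨b1, b2⟩, b3, b4⟩ := h2
  have hd : ∀ a b : ℤ, (a : ℝ) < b + 2 → (b : ℝ) < a + 1 → a = b ∨ a = b + 1 := by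
    intro a b h1 h2
    have h1' : a < b + 2 := by exact_mod_cast h1
    have h2' : b < a + 1 := by exact_mod_cast h2
    omega
  fin_cases e <;> simp [ev] at a1 a2 a3 a4 b1 b2 b3 b4 ⊢
  · have e2 : J.2 = J'.2 := int_eq (by linarith) (by linarith)
    rcases hd J.1 J'.1 (by linarith) (by linarith) with h | h
    · left; ext <;> assumption
    · right; ext <;> simp [h, e2]
  · have e2 : J.1 = J'.1 := int_eq (by linarith) (by linarith)
    rcases hd J.2 J'.2 (by linarith) (by linarith) with h | h
    · left; ext <;> assumption
    · right; ext <;> simp [h, e2]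

lemma ev_ne (e : Fin 2) : ev e ≠ 0 := by
  fin_cases e <;> simp [ev]

lemma SY_start (hmod : ∀ x y : E2, ‖x - y‖ ≤ 1 → ‖G x - G y‖ ≤ 0.05) {v J : ℤ × ℤ} {e : Fin 2} (h : v ∈ SS G J) (h' : v ∈ YY G J e) : v ∈ DA G J e := by
  refine ⟨⟨h', fun h2 => ?_⟩, v, h, Cn.refl _ _⟩
  have := SS_unique hmod h h2
  exact ev_ne e (by simpa using this.symm)

lemma SY_end {v J : ℤ × ℤ} {e : Fin 2} (h : v ∈ SS G (J + ev e)) : v ∉ DA G J e :=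
  fun h2 => h2.1.2 h

lemma Lb_unique (hmod : ∀ x y : E2, ‖x - y‖ ≤ 1 → ‖G x - G y‖ ≤ 0.05) {v J J' : ℤ × ℤ} (h : Lb G v J) (h' : Lb G v J') : J = J' := by
  have key : ∀ {J J' : ℤ × ℤ}, v ∈ SS G J → (∃ J0 e, v ∈ YY G J0 e ∧ ((v ∈ DA G J0 e ∧ J' = J0) ∨ (v ∉ DA G J0 e ∧ J' = J0 + ev e))) → J = J' := by
    rintro J J' hS ⟨J0, e, hY, h⟩
    rcases SY hmod hS hY with rfl | rfl
    · have := SY_start hmod hS hY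
      rcases h with ⟨_, rfl⟩ | ⟨hn, _⟩
      · rfl
      · exact absurd this hn
    · have := SY_end hS
      rcases h with ⟨hn, _⟩ | ⟨_, rfl⟩
      · exact absurd hn this
      · rfl
  rcases h with h | h <;> rcases h' with h' | h'
  · exact SS_unique hmod h h'
  · exact key h h'
  · exact (key h' h).symm
  · obtain ⟨J0, e, hY, h⟩ := h
    obtain ⟨J1, e1, hY1, h'⟩ := h'
    obtain ⟨rfl, rfl⟩ := YY_unique hmod hY hY1
    rcases h with ⟨h1, rfl⟩ | ⟨h1, rfl⟩ <;> rcases h' with ⟨h2, rfl⟩ | ⟨h2, rfl⟩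
    · rfl
    · exact absurd h1 h2
    · exact absurd h2 h1
    · rfl

lemma Lb_XX {v J : ℤ × ℤ} (h : Lb G v J) : v ∈ XX G := by
  rcases h with h | ⟨J0, e, h, _⟩
  · exact Or.inl ⟨J, h⟩
  · exact Or.inr ⟨J0, e, h⟩

lemma XX_Lb {v : ℤ × ℤ} (h : v ∈ XX G) : ∃ J, Lb G v J := by
  rcases h with ⟨J, h⟩ | ⟨J, e, h⟩
  · exact ⟨J, Or.inl h⟩
  · by_cases hD : v ∈ DA G J e
    · exact ⟨J, Or.inr ⟨J, e, h, Or.inl ⟨hD, rfl⟩⟩⟩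
    · exact ⟨_, Or.inr ⟨J, e, h, Or.inr ⟨hD, rfl⟩⟩⟩

lemma Lab_unique (hmod : ∀ x y : E2, ‖x - y‖ ≤ 1 → ‖G x - G y‖ ≤ 0.05) {v J J' : ℤ × ℤ} (h : Lab G v J) (h' : Lab G v J') : J = J' := by
  induction h generalizing J' with
  | base h =>
    cases h' with
    | base h2 => exact Lb_unique hmod h h2
    | step h2 _ => exact absurd (Lb_XX h) h2
  | step h _ ih =>
    cases h' with
    | base h2 => exact absurd (Lb_XX h2) h
    | step _ h3 => exact ih h3

lemma Lb_close (hmod : ∀ x y : E2, ‖x - y‖ ≤ 1 → ‖G x - G y‖ ≤ 0.05) {v J : ℤ × ℤ} (h : Lb G v J) : ‖G (lat v) - lat J‖ ≤ 1 := by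
  rw [norm_le_iff']
  simp only [Prod.fst_sub, Prod.snd_sub, (lat_mk J).1, (lat_mk J).2, abs_le]
  rcases h with h | ⟨J0, e, hY, h⟩
  · have h1 := SS_close hmod h
    simp only [abs_le] at h1
    obtain ⟨⟨a1, a2⟩, a3, a4⟩ := h1
    refine ⟨⟨?_, ?_⟩, ?_, ?_⟩ <;> linarith
  · have h2 := YY_close hmod hY
    simp only [abs_le] at h2
    obtain ⟨⟨b1, b2⟩, b3, b4⟩ := h2
    rcases h with ⟨_, rfl⟩ | ⟨_, rfl⟩
    · fin_cases e <;> simp [ev] at b1 b2 b3 b4 ⊢ <;> refine ⟨⟨?_, ?_⟩, ?_, ?_⟩ <;> linarith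
    · fin_cases e <;> simp [ev] at b1 b2 b3 b4 ⊢ <;> refine ⟨⟨?_, ?_⟩, ?_, ?_⟩ <;> linarith

end modulus
end labels
end TorusIso

namespace TorusIso
open Filter Topology Set

section labels2
variable {G : E2 ≃ₜ E2}

lemma grid_mem {v : ℤ × ℤ} {x : E2} (hx : ‖lat v - x‖ ≤ 1)
    (h : (∃ k : ℤ, (G x).1 = k) ∨ ∃ k : ℤ, (G x).2 = k) : v ∈ XX G := by
  have hy : ∀ y : ℝ, (∃ j : ℤ, |y - j| ≤ 0.4) ∨ ∃ j : ℤ, |y - (j + 1/2)| ≤ 0.1 := by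
    intro y
    have h1 := Int.floor_le y
    have h2 := Int.lt_floor_add_one y
    rcases le_or_gt y (⌊y⌋ + 0.4) with h | h
    · left; exact ⟨⌊y⌋, by rw [abs_le]; constructor <;> linarith⟩
    · rcases le_or_gt y (⌊y⌋ + 0.6) with h' | h'
      · right; exact ⟨⌊y⌋, by rw [abs_le]; constructor <;> linarith⟩
      · left; exact ⟨⌊y⌋ + 1, by push_cast; rw [abs_le]; constructor <;> linarith⟩
  rcases h with ⟨k, hk⟩ | ⟨k, hk⟩
  · rcases hy (G x).2 with ⟨j, hj⟩ | ⟨j, hj⟩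
    · refine Or.inl ⟨(k, j), x, ?_, hx⟩
      rw [Set.mem_ofPred_eq, norm_le_iff']
      simp only [lat, Prod.fst_sub, Prod.snd_sub, hk]
      exact ⟨by norm_num, hj⟩
    · refine Or.inr ⟨(k, j), 1, x, ?_, hx⟩
      rw [Set.mem_ofPred_eq, norm_le_iff']
      simp [lat, ev, hk]
      refine ⟨by norm_num, ?_⟩
      rwa [one_div] at hj
  · rcases hy (G x).1 with ⟨j, hj⟩ | ⟨j, hj⟩
    · refine Or.inl ⟨(j, k), x, ?_, hx⟩
      rw [Set.mem_ofPred_eq, norm_le_iff']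
      simp only [lat, Prod.fst_sub, Prod.snd_sub, hk]
      exact ⟨hj, by norm_num⟩
    · refine Or.inr ⟨(j, k), 0, x, ?_, hx⟩
      rw [Set.mem_ofPred_eq, norm_le_iff']
      simp [lat, ev, hk]
      refine ⟨?_, by norm_num⟩
      rwa [one_div] at hj

lemma floor_ivt {φ : ℝ → ℝ} (hφ : Continuous φ) (h : ⌊φ 0⌋ ≠ ⌊φ 1⌋) : ∃ t ∈ Icc (0:ℝ) 1, ∃ k : ℤ, φ t = k := by
  rcases lt_or_gt_of_ne h with h | h
  · obtain ⟨t, ht, he⟩ := intermediate_value_Icc zero_le_one hφ.continuousOn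
      (show ((⌊φ 1⌋ : ℤ) : ℝ) ∈ Icc (φ 0) (φ 1) from ⟨(Int.floor_lt.1 h).le, Int.floor_le _⟩)
    exact ⟨t, ht, _, he⟩
  · obtain ⟨t, ht, he⟩ := intermediate_value_Icc' zero_le_one hφ.continuousOn
      (show ((⌊φ 0⌋ : ℤ) : ℝ) ∈ Icc (φ 1) (φ 0) from ⟨(Int.floor_lt.1 h).le, Int.floor_le _⟩)
    exact ⟨t, ht, _, he⟩

lemma fl_step {v : ℤ × ℤ} (h : v ∉ XX G) : fl (G (lat (v + (1,0)))) = fl (G (lat v)) := by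
  have hc : Continuous fun t : ℝ => G (lat v + (t, 0)) := by
    have := G.continuous
    fun_prop
  have hn : ∀ t ∈ Icc (0:ℝ) 1, ‖lat v - (lat v + (t, 0))‖ ≤ 1 := by
    intro t ht
    rw [sub_add_cancel_left, norm_neg, norm_le_iff']
    simp only [abs_le]
    refine ⟨⟨by linarith [ht.1], ht.2⟩, by norm_num, by norm_num⟩
  have e1 : lat (v + (1,0)) = lat v + ((1:ℝ), (0:ℝ)) := by rw [lat_add]; simp [lat]
  have e0 : lat v = lat v + ((0:ℝ), (0:ℝ)) := by ext <;> simp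
  rw [e1]
  conv_rhs => rw [e0]
  by_contra hne
  apply h
  by_cases h1 : ⌊(G (lat v + ((0:ℝ), (0:ℝ)))).1⌋ = ⌊(G (lat v + ((1:ℝ), (0:ℝ)))).1⌋
  · have h2 : ⌊(G (lat v + ((0:ℝ), (0:ℝ)))).2⌋ ≠ ⌊(G (lat v + ((1:ℝ), (0:ℝ)))).2⌋ := by
      intro h2
      apply hne
      simp only [fl, h1, h2]
    obtain ⟨t, ht, k, hk⟩ := floor_ivt (φ := fun t : ℝ => (G (lat v + (t, 0))).2) (continuous_snd.comp hc) h2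
    exact grid_mem (hn t ht) (Or.inr ⟨k, hk⟩)
  · obtain ⟨t, ht, k, hk⟩ := floor_ivt (φ := fun t : ℝ => (G (lat v + (t, 0))).1) (continuous_fst.comp hc) h1
    exact grid_mem (hn t ht) (Or.inl ⟨k, hk⟩)

lemma Lab_exists {N m : ℕ} (hm : m ≠ 0) (hE : ∀ x n, G (x + lat ((N:ℤ) • n)) = G x + lat ((m:ℤ) • n)) (v : ℤ × ℤ) :
    ∃ J, Lab G v J := by
  by_contra hc
  have key : ∀ j : ℕ, (¬ ∃ J, Lab G (v + ((j:ℤ), 0)) J) ∧ fl (G (lat (v + ((j:ℤ), 0)))) = fl (G (lat v)) := by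
    intro j
    induction j with
    | zero =>
      have : v + (((0:ℕ):ℤ), 0) = v := by ext <;> simp
      rw [this]; exact ⟨hc, rfl⟩
    | succ j ih =>
      have e : v + (((j+1:ℕ):ℤ), 0) = v + ((j:ℤ), 0) + (1, 0) := by
        ext
        · simp; ring
        · simp
      have hX : v + ((j:ℤ), 0) ∉ XX G := by
        intro hX
        obtain ⟨J, hJ⟩ := XX_Lb hX
        exact ih.1 ⟨J, Lab.base hJ⟩
      rw [e]
      refine ⟨fun ⟨J, hJ⟩ => ih.1 ⟨J, Lab.step hX hJ⟩, ?_⟩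
      rw [fl_step hX, ih.2]
  have h1 := (key N).2
  have e : ((N:ℤ), (0:ℤ)) = (N:ℤ) • ((1:ℤ), (0:ℤ)) := by simp
  rw [e, lat_add, hE, fl_add] at h1
  have := congrArg Prod.fst h1
  simp at this
  exact hm this

lemma Lab_close (hmod : ∀ x y : E2, ‖x - y‖ ≤ 1 → ‖G x - G y‖ ≤ 0.05) {v J : ℤ × ℤ} (h : Lab G v J) :
    ‖G (lat v) - lat J‖ ≤ 2 := by
  have key : ∃ w, fl (G (lat w)) = fl (G (lat v)) ∧ Lb G w J := by
    induction h with
    | base h => exact ⟨_, rfl, h⟩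
    | step h _ ih =>
      obtain ⟨w, hw, hl⟩ := ih
      exact ⟨w, hw.trans (fl_step h), hl⟩
  obtain ⟨w, hw, hl⟩ := key
  have h1 := Lb_close hmod hl
  have h2 : ‖G (lat v) - G (lat w)‖ ≤ 1 := by
    rw [norm_le_iff']
    have q1 := congrArg Prod.fst hw
    have q2 := congrArg Prod.snd hw
    simp only [fl] at q1 q2
    exact ⟨(Int.abs_sub_lt_one_of_floor_eq_floor q1.symm).le, (Int.abs_sub_lt_one_of_floor_eq_floor q2.symm).le⟩
  have := norm_add_le (G (lat v) - G (lat w)) (G (lat w) - lat J)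
  rw [sub_add_sub_cancel] at this
  linarith

lemma Lab_conn {v J : ℤ × ℤ} (h : Lab G v J) : ∃ a ∈ SS G J, Cn {w | Lab G w J} v a := by
  induction h with
  | @step v J h h' ih =>
    obtain ⟨a, ha, hc⟩ := ih
    exact ⟨a, ha, (Cn.edge (show v ∈ {w | Lab G w J} from Lab.step h h') 0 h').trans hc⟩
  | @base v J h =>
    rcases h with h | ⟨J0, e, hY, ⟨hD, rfl⟩ | ⟨hD, rfl⟩⟩
    · exact ⟨v, h, Cn.refl _ _⟩
    · obtain ⟨h1, a, ha, hc⟩ := hD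
      refine ⟨a, ha, ?_⟩
      have hlab : ∀ x, x ∈ YY G J e \ SS G (J + ev e) → Cn (YY G J e \ SS G (J + ev e)) x a → Lab G x J :=
        fun x hx hxa => Lab.base (Or.inr ⟨J, e, hx.1, Or.inl ⟨⟨hx, a, ha, hxa⟩, rfl⟩⟩)
      clear h1 hY
      unfold Cn at hc
      induction hc using Relation.ReflTransGen.head_induction_on with
      | refl => exact Cn.refl _ _
      | head hxy hya ih =>
        obtain ⟨hx, hy, i, rfl⟩ := hxy
        refine Cn.trans (Cn.edge ?_ i ?_) ih
        · exact hlab _ hx (Relation.ReflTransGen.head ⟨hx, hy, i, rfl⟩ hya)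
        · exact hlab _ hy hya
    · obtain ⟨b, hb, hbY⟩ := exists_end (G := G) J0 e
      have hc := YY_conn J0 e hY hbY
      unfold Cn at hc
      induction hc using Relation.ReflTransGen.head_induction_on with
      | refl => exact ⟨b, hb, Cn.refl _ _⟩
      | @head x y hxy hya ih =>
        obtain ⟨hx, hy, i, rfl⟩ := hxy
        by_cases hxS : x ∈ SS G (J0 + ev e)
        · exact ⟨x, hxS, Cn.refl _ _⟩
        · have hyD : x + dd i ∉ DA G J0 e := by
            rintro ⟨g1, a, ha, hc⟩
            exact hD ⟨⟨hx, hxS⟩, a, ha, Relation.ReflTransGen.head ⟨⟨hx, hxS⟩, g1, i, rfl⟩ hc⟩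
          obtain ⟨a, ha, hc⟩ := ih hy hyD
          refine ⟨a, ha, Cn.trans (Cn.edge ?_ i ?_) hc⟩
          · exact Lab.base (Or.inr ⟨J0, e, hx, Or.inr ⟨hD, rfl⟩⟩)
          · exact Lab.base (Or.inr ⟨J0, e, hy, Or.inr ⟨hyD, rfl⟩⟩)

lemma Lab_edge (hmod : ∀ x y : E2, ‖x - y‖ ≤ 1 → ‖G x - G y‖ ≤ 0.05) (J : ℤ × ℤ) (e : Fin 2) :
    ∃ v i, Lab G v J ∧ Lab G (v + dd i) (J + ev e) := by
  obtain ⟨a, ha, haY⟩ := exists_start (G := G) J e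
  obtain ⟨b, hb, hbY⟩ := exists_end (G := G) J e
  have hc := YY_conn J e haY hbY
  have hbD := SY_end (G := G) hb
  have haD := SY_start hmod ha haY
  unfold Cn at hc
  clear ha haY
  induction hc using Relation.ReflTransGen.head_induction_on with
  | refl => exact absurd haD hbD
  | @head x y hxy hya ih =>
    obtain ⟨hx, hy, i, rfl⟩ := hxy
    by_cases hyD : x + dd i ∈ DA G J e
    · exact ih hyD
    · exact ⟨x, i, Lab.base (Or.inr ⟨J, e, hx, Or.inl ⟨haD, rfl⟩⟩), Lab.base (Or.inr ⟨J, e, hy, Or.inr ⟨hyD, rfl⟩⟩)⟩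

section shift

lemma hab_neg {a b : ℤ × ℤ} (hab : ∀ x, G (x + lat a) = G x + lat b) : ∀ x, G (x + lat (-a)) = G x + lat (-b) := by
  intro x
  have := hab (x + lat (-a))
  rw [lat_neg, neg_add_cancel_right] at this
  rw [this, lat_neg, lat_neg]; abel

lemma SS_shift {a b : ℤ × ℤ} (hab : ∀ x, G (x + lat a) = G x + lat b) {v J : ℤ × ℤ} (h : v ∈ SS G J) :
    v + a ∈ SS G (J + b) := by
  obtain ⟨x, hx, hv⟩ := h
  refine ⟨x + lat a, ?_, ?_⟩
  · rw [Set.mem_ofPred_eq] at hx ⊢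
    rw [hab, lat_add, add_sub_add_right_eq_sub]; exact hx
  · rw [lat_add, add_sub_add_right_eq_sub]; exact hv

lemma YY_shift {a b : ℤ × ℤ} (hab : ∀ x, G (x + lat a) = G x + lat b) {v J : ℤ × ℤ} {e : Fin 2} (h : v ∈ YY G J e) :
    v + a ∈ YY G (J + b) e := by
  obtain ⟨x, hx, hv⟩ := h
  refine ⟨x + lat a, ?_, ?_⟩
  · rw [Set.mem_ofPred_eq] at hx ⊢
    rw [hab, lat_add, add_right_comm, add_sub_add_right_eq_sub]; exact hx
  · rw [lat_add, add_sub_add_right_eq_sub]; exact hv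

lemma SS_shift_iff {a b : ℤ × ℤ} (hab : ∀ x, G (x + lat a) = G x + lat b) {v J : ℤ × ℤ} :
    v + a ∈ SS G (J + b) ↔ v ∈ SS G J := by
  refine ⟨fun h => ?_, SS_shift hab⟩
  simpa using SS_shift (hab_neg hab) h

lemma Cn_shift {s t : Set (ℤ × ℤ)} {a : ℤ × ℤ} (hst : ∀ x ∈ s, x + a ∈ t) {v w : ℤ × ℤ} (h : Cn s v w) :
    Cn t (v + a) (w + a) := by
  unfold Cn at h
  induction h with
  | refl => exact Cn.refl _ _
  | tail _ hc ih =>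
    obtain ⟨hx, hy, i, rfl⟩ := hc
    exact Relation.ReflTransGen.tail ih ⟨hst _ hx, hst _ hy, i, by abel⟩

lemma DA_shift {a b : ℤ × ℤ} (hab : ∀ x, G (x + lat a) = G x + lat b) {v J : ℤ × ℤ} {e : Fin 2} (h : v ∈ DA G J e) :
    v + a ∈ DA G (J + b) e := by
  obtain ⟨h1, w, hw, hc⟩ := h
  have hs : ∀ x ∈ YY G J e \ SS G (J + ev e), x + a ∈ YY G (J + b) e \ SS G (J + b + ev e) := by
    rintro x ⟨hx, hx'⟩
    refine ⟨YY_shift hab hx, ?_⟩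
    rw [add_right_comm, SS_shift_iff hab]; exact hx'
  exact ⟨hs _ h1, w + a, SS_shift hab hw, Cn_shift hs hc⟩

lemma DA_shift_iff {a b : ℤ × ℤ} (hab : ∀ x, G (x + lat a) = G x + lat b) {v J : ℤ × ℤ} {e : Fin 2} :
    v + a ∈ DA G (J + b) e ↔ v ∈ DA G J e := by
  refine ⟨fun h => ?_, DA_shift hab⟩
  simpa using DA_shift (hab_neg hab) h

lemma Lb_shift {a b : ℤ × ℤ} (hab : ∀ x, G (x + lat a) = G x + lat b) {v J : ℤ × ℤ} (h : Lb G v J) :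
    Lb G (v + a) (J + b) := by
  rcases h with h | ⟨J0, e, hY, ⟨hD, rfl⟩ | ⟨hD, rfl⟩⟩
  · exact Or.inl (SS_shift hab h)
  · exact Or.inr ⟨J + b, e, YY_shift hab hY, Or.inl ⟨DA_shift hab hD, rfl⟩⟩
  · exact Or.inr ⟨J0 + b, e, YY_shift hab hY, Or.inr ⟨by rwa [DA_shift_iff hab], by abel⟩⟩

lemma XX_shift {a b : ℤ × ℤ} (hab : ∀ x, G (x + lat a) = G x + lat b) {v : ℤ × ℤ} (h : v + a ∈ XX G) : v ∈ XX G := by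
  obtain ⟨J, hJ⟩ := XX_Lb h
  have := Lb_XX (Lb_shift (hab_neg hab) hJ)
  simpa using this

lemma Lab_shift {a b : ℤ × ℤ} (hab : ∀ x, G (x + lat a) = G x + lat b) {v J : ℤ × ℤ} (h : Lab G v J) :
    Lab G (v + a) (J + b) := by
  induction h with
  | base h => exact Lab.base (Lb_shift hab h)
  | step h _ ih =>
    refine Lab.step (fun hX => h (XX_shift hab hX)) ?_
    rw [add_right_comm]; exact ih

end shift

lemma labels {N m : ℕ} (hm : m ≠ 0) (hE : ∀ x n, G (x + lat ((N:ℤ) • n)) = G x + lat ((m:ℤ) • n))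
    (hmod : ∀ x y : E2, ‖x - y‖ ≤ 1 → ‖G x - G y‖ ≤ 0.05) :
    ∃ ℓ : ℤ × ℤ → ℤ × ℤ, (∀ v n, ℓ (v + (N : ℤ) • n) = ℓ v + (m : ℤ) • n) ∧
      (∀ v, ‖G (lat v) - lat (ℓ v)‖ ≤ 2) ∧
      (∀ v w, ℓ v = ℓ w → Relation.ReflTransGen (fun a b => ℓ a = ℓ b ∧ ∃ i, b = a + dd i) v w) ∧
      (∀ (J : ℤ × ℤ) (e : Fin 2), ∃ v i, ℓ v = J ∧ ℓ (v + dd i) = J + ev e) := by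
  choose ℓ hℓ using fun v => Lab_exists (G := G) hm hE v
  have hu : ∀ v J, Lab G v J → ℓ v = J := fun v J h => Lab_unique hmod (hℓ v) h
  refine ⟨ℓ, ?_, ?_, ?_, ?_⟩
  · intro v n
    exact hu _ _ (Lab_shift (fun x => hE x n) (hℓ v))
  · exact fun v => Lab_close hmod (hℓ v)
  · intro v w h
    obtain ⟨a, ha, hva⟩ := Lab_conn (hℓ v)
    obtain ⟨b, hb, hwb⟩ := Lab_conn (hℓ w)
    rw [← h] at hb hwb
    have hab := (SS_conn (G := G) (ℓ v) ha hb).mono (t := {x | Lab G x (ℓ v)}) fun x hx => Lab.base (Or.inl hx)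
    have hc := (hva.trans hab).trans hwb.symm
    unfold Cn at hc
    refine Relation.ReflTransGen.mono ?_ _ _ hc
    rintro x y ⟨hx, hy, hi⟩
    exact ⟨(hu _ _ hx).trans (hu _ _ hy).symm, hi⟩
  · intro J e
    obtain ⟨v, i, h1, h2⟩ := Lab_edge hmod J e
    exact ⟨v, i, hu _ _ h1, hu _ _ h2⟩

end labels2
end TorusIso

namespace TorusIso
open Filter Topology Set

lemma Equi.unif {F : E2 → E2} (hc : Continuous F) (hF : Equi F) {ε : ℝ} (hε : 0 < ε) :
    ∃ δ > 0, ∀ x y, ‖x - y‖ < δ → ‖F x - F y‖ < ε := by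
  have hu := (isCompact_closedBall (0 : E2) 2).uniformContinuousOn_of_continuous hc.continuousOn
  rw [Metric.uniformContinuousOn_iff] at hu
  obtain ⟨δ, hδ, h⟩ := hu ε hε
  refine ⟨min δ 1, by positivity, fun x y hxy => ?_⟩
  have h1 := norm_sub_rnd x
  have h2 : ‖y - lat (rnd x)‖ ≤ 2 := by
    have := norm_sub_le (x - lat (rnd x)) (x - y)
    have e : x - lat (rnd x) - (x - y) = y - lat (rnd x) := by abel
    rw [e] at this
    have := hxy.le.trans (min_le_right _ _)
    linarith
  have h3 := h (x - lat (rnd x)) (by simp; linarith) (y - lat (rnd x)) (by simpa using h2) (by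
    rw [dist_eq_norm, sub_sub_sub_cancel_right]; exact hxy.trans_le (min_le_left _ _))
  rw [dist_eq_norm] at h3
  have e1 := hF (x - lat (rnd x)) (rnd x)
  have e2 := hF (y - lat (rnd x)) (rnd x)
  rw [sub_add_cancel] at e1 e2
  rw [e1, e2, add_sub_add_right_eq_sub]
  exact h3

lemma norm_lat_dd (i : Fin 6) : ‖lat (dd i)‖ ≤ 1 := by
  rw [norm_le_iff']
  fin_cases i <;> simp [dd, lat]

theorem triv_of_equi (F : E2 ≃ₜ E2) (hF : Equi F) : Triv F := by
  obtain ⟨m, hm⟩ : ∃ m : ℕ, m = 200000 := ⟨_, rfl⟩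
  have hm0 : m ≠ 0 := by rw [hm]; norm_num
  have hmR : (m : ℝ) = 200000 := by rw [hm]; norm_num
  have hmR0 : (m : ℝ) ≠ 0 := by rw [hmR]; norm_num
  haveI : NeZero m := ⟨hm0⟩
  obtain ⟨δ, hδ, hu⟩ := Equi.unif F.continuous hF (ε := 0.05 / 200000) (by norm_num)
  obtain ⟨N, hN⟩ := exists_nat_gt (1 / δ)
  have hN0 : (0 : ℝ) < N := lt_trans (by positivity) hN
  have hNne : (N : ℝ) ≠ 0 := hN0.ne'
  haveI : NeZero N := ⟨by exact_mod_cast hNne⟩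
  have hNd : (N : ℝ)⁻¹ < δ := by
    rw [inv_lt_comm₀ hN0 hδ, ← one_div]; exact hN
  have huN : ∀ x y : E2, ‖x - y‖ ≤ 1 → ‖F ((N:ℝ)⁻¹ • x) - F ((N:ℝ)⁻¹ • y)‖ ≤ 0.05 / 200000 := by
    intro x y hxy
    refine (hu _ _ ?_).le
    rw [← smul_sub, norm_smul, norm_inv, Real.norm_natCast]
    calc (N:ℝ)⁻¹ * ‖x - y‖ ≤ (N:ℝ)⁻¹ * 1 := mul_le_mul_of_nonneg_left hxy (by positivity)
      _ < δ := by rw [mul_one]; exact hNd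
  obtain ⟨G, hG⟩ : ∃ G : E2 ≃ₜ E2, ∀ x, G x = (m : ℝ) • F ((N:ℝ)⁻¹ • x) :=
    ⟨((Homeomorph.smulOfNeZero ((N:ℝ)⁻¹) (inv_ne_zero hNne)).trans F).trans (Homeomorph.smulOfNeZero (m:ℝ) hmR0), fun x => rfl⟩
  have hsm : ∀ (k : ℕ) (n : ℤ × ℤ), lat ((k:ℤ) • n) = (k:ℝ) • lat n := by
    intro k n
    ext <;> simp [lat]
  obtain ⟨ℓ, L1, L2, L3, L4⟩ := labels (G := G) (N := N) hm0 (by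
      intro x n
      rw [hG, hG, smul_add, hsm, hsm, smul_smul, inv_mul_cancel₀ hNne, one_smul, hF, smul_add]) (by
      intro x y hxy
      rw [hG, hG, ← smul_sub, norm_smul, Real.norm_natCast, hmR]
      have := huN x y hxy
      rw [le_div_iff₀ (by norm_num)] at this
      linarith)
  obtain ⟨W, hW, hap⟩ := approx_of_labels (N := N) (m := m) ℓ L1 L3 L4 (ε := 1 / 200000) (by norm_num)
  obtain ⟨u, hH, hK⟩ := harm_triv hW
  obtain ⟨c, hc⟩ := hap u hH
  obtain ⟨K, hKT, hKE, hKn⟩ := hK 0.0005 (by norm_num)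
  have hv : ∀ v, ‖kk u v - c - F ((N:ℝ)⁻¹ • lat v)‖ ≤ 3 / 200000 := by
    intro v
    have h1 := hc v
    have h2 := L2 v
    have e : G (lat v) - lat (ℓ v) = (m:ℝ) • (F ((N:ℝ)⁻¹ • lat v) - (m:ℝ)⁻¹ • lat (ℓ v)) := by
      rw [smul_sub, smul_smul, mul_inv_cancel₀ hmR0, one_smul, hG]
    rw [e, norm_smul, Real.norm_natCast, hmR] at h2
    rw [hmR] at h1
    have h3 := norm_sub_le (kk u v - (200000:ℝ)⁻¹ • lat (ℓ v) - c) (F ((N:ℝ)⁻¹ • lat v) - (200000:ℝ)⁻¹ • lat (ℓ v))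
    have e2 : kk u v - (200000:ℝ)⁻¹ • lat (ℓ v) - c - (F ((N:ℝ)⁻¹ • lat v) - (200000:ℝ)⁻¹ • lat (ℓ v)) = kk u v - c - F ((N:ℝ)⁻¹ • lat v) := by
      abel
    rw [e2] at h3
    rw [le_div_iff₀ (by norm_num)] at h1 ⊢
    linarith
  have hM : ∀ v i, ‖dl u v i‖ ≤ 7 / 200000 := by
    intro v i
    obtain ⟨v, rfl⟩ := cz_surj N v
    rw [← del_kk]
    have h1 := hv (v + dd i)
    have h2 := hv v
    have h3 := huN (lat (v + dd i)) (lat v) (by rw [lat_add, add_sub_cancel_left]; exact norm_lat_dd i)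
    have e : del (kk u) v i = (kk u (v + dd i) - c - F ((N:ℝ)⁻¹ • lat (v + dd i))) + (F ((N:ℝ)⁻¹ • lat (v + dd i)) - F ((N:ℝ)⁻¹ • lat v))
      - (kk u v - c - F ((N:ℝ)⁻¹ • lat v)) := by
      simp only [del]; abel
    rw [e]
    refine (norm_sub_le _ _).trans ?_
    have := norm_add_le (kk u (v + dd i) - c - F ((N:ℝ)⁻¹ • lat (v + dd i))) (F ((N:ℝ)⁻¹ • lat (v + dd i)) - F ((N:ℝ)⁻¹ • lat v))
    linarith
  have hKT' : Triv (fun z => K z + -c) := Triv.comp (triv_translate (-c)) hKT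
  have hFK : ∀ z, ‖F z - (K z + -c)‖ ≤ 0.001 := by
    intro z
    set v := fl ((N:ℝ) • z) with hvd
    have h1 := GG_near u hM z
    have h2 := hKn z
    have h3 := hv v
    have h4 := huN ((N:ℝ) • z) (lat v) (norm_le_iff'.2 (sub_fl_abs _))
    rw [smul_smul, inv_mul_cancel₀ hNne, one_smul] at h4
    have e : F z - (K z + -c) = (F z - F ((N:ℝ)⁻¹ • lat v)) - (kk u v - c - F ((N:ℝ)⁻¹ • lat v)) - (GG u z - kk u v) - (K z - GG u z) := by
      abel
    rw [e]
    have g1 := norm_sub_le (F z - F ((N:ℝ)⁻¹ • lat v)) (kk u v - c - F ((N:ℝ)⁻¹ • lat v))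
    have g2 := norm_sub_le ((F z - F ((N:ℝ)⁻¹ • lat v)) - (kk u v - c - F ((N:ℝ)⁻¹ • lat v))) (GG u z - kk u v)
    have g3 := norm_sub_le ((F z - F ((N:ℝ)⁻¹ • lat v)) - (kk u v - c - F ((N:ℝ)⁻¹ • lat v)) - (GG u z - kk u v)) (K z - GG u z)
    rw [← hvd] at h1
    norm_num at h1 h2 h3 h4 g1 g2 g3 ⊢
    linarith
  refine triv_step (K := F) (K' := K.trans (Homeomorph.addRight (-c))) hF ?_ hFK ?_
  · intro z n
    change K (z + lat n) + -c = K z + -c + lat n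
    rw [hKE]; abel
  · exact hKT'.congr fun z => rfl

end TorusIso

namespace TorusIso
open Filter Topology Set
open unitInterval

/-- The torus. -/
abbrev TT := AddCircle (1 : ℝ) × AddCircle (1 : ℝ)

/-- The universal covering projection. -/
def prj (z : E2) : TT := ((z.1 : AddCircle (1 : ℝ)), (z.2 : AddCircle (1 : ℝ)))

lemma coe_add_int (x : ℝ) (n : ℤ) :
    ((x + (n : ℝ) : ℝ) : AddCircle (1 : ℝ)) = (x : AddCircle (1 : ℝ)) := by
  have : (((n : ℝ) : ℝ) : AddCircle (1 : ℝ)) = 0 :=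
    (AddCircle.coe_eq_zero_iff (1 : ℝ)).2 ⟨n, by simp⟩
  rw [AddCircle.coe_add, this, add_zero]

lemma coe_eq_int {x y : ℝ} (h : (x : AddCircle (1 : ℝ)) = (y : AddCircle (1 : ℝ))) :
    ∃ n : ℤ, x = y + n := by
  have h2 : ((x - y : ℝ) : AddCircle (1 : ℝ)) = 0 := by
    rw [AddCircle.coe_sub, h, sub_self]
  obtain ⟨n, hn⟩ := (AddCircle.coe_eq_zero_iff (1 : ℝ)).1 h2
  refine ⟨n, ?_⟩
  have : (n : ℝ) = x - y := by simpa using hn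
  linarith

lemma prj_add (z : E2) (n : ℤ × ℤ) : prj (z + lat n) = prj z :=
  Prod.ext (coe_add_int _ _) (coe_add_int _ _)

lemma prj_eq {z w : E2} (h : prj z = prj w) : ∃ n, z = w + lat n := by
  obtain ⟨a, ha⟩ := coe_eq_int (congrArg Prod.fst h)
  obtain ⟨b, hb⟩ := coe_eq_int (congrArg Prod.snd h)
  exact ⟨(a, b), Prod.ext ha hb⟩

lemma prj_open : IsOpenQuotientMap prj := by
  have h : IsOpenQuotientMap ((↑) : ℝ → AddCircle (1 : ℝ)) := QuotientAddGroup.isOpenQuotientMap_mk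
  exact h.prodMap h

lemma prj_cont : Continuous prj := prj_open.continuous
lemma prj_surj : Function.Surjective prj := prj_open.surjective

/-- Lifting a homotopy of the identity. -/
lemma exists_lift (h : I × TT → TT) (hc : Continuous h) (h0 : ∀ p, h (0, p) = p) :
    ∃ Φ : I × E2 → E2, Continuous Φ ∧ (∀ t z, prj (Φ (t, z)) = h (t, prj z)) ∧
      (∀ z, Φ (0, z) = z) ∧ (∀ t z n, Φ (t, z + lat n) = Φ (t, z) + lat n) := by
  have cov := AddCircle.isCoveringMap_coe (1 : ℝ)
  have hk : Continuous fun x : I × E2 => h (x.1, prj x.2) :=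
    hc.comp (continuous_fst.prodMk (prj_cont.comp continuous_snd))
  let K1 : C(I × E2, AddCircle (1 : ℝ)) := ⟨fun x => (h (x.1, prj x.2)).1, continuous_fst.comp hk⟩
  let K2 : C(I × E2, AddCircle (1 : ℝ)) := ⟨fun x => (h (x.1, prj x.2)).2, continuous_snd.comp hk⟩
  let f1 : C(E2, ℝ) := ⟨fun z => z.1, continuous_fst⟩
  let f2 : C(E2, ℝ) := ⟨fun z => z.2, continuous_snd⟩
  have e1 : ∀ a, K1 (0, a) = ((f1 a : ℝ) : AddCircle (1 : ℝ)) := fun a => by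
    change (h (0, prj a)).1 = _
    rw [h0]; rfl
  have e2 : ∀ a, K2 (0, a) = ((f2 a : ℝ) : AddCircle (1 : ℝ)) := fun a => by
    change (h (0, prj a)).2 = _
    rw [h0]; rfl
  have hΦc : Continuous fun x : I × E2 =>
      ((cov.liftHomotopy K1 f1 e1 x, cov.liftHomotopy K2 f2 e2 x) : E2) :=
    (ContinuousMap.continuous _).prodMk (ContinuousMap.continuous _)
  have hz : ∀ z : E2, ((cov.liftHomotopy K1 f1 e1 (0, z), cov.liftHomotopy K2 f2 e2 (0, z)) : E2)
      = z := fun z => Prod.ext (cov.liftHomotopy_zero K1 f1 e1 z) (cov.liftHomotopy_zero K2 f2 e2 z)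
  have hl : ∀ x : I × E2, prj ((cov.liftHomotopy K1 f1 e1 x, cov.liftHomotopy K2 f2 e2 x) : E2)
      = h (x.1, prj x.2) := fun x => Prod.ext (congrFun (cov.liftHomotopy_lifts K1 f1 e1) x)
        (congrFun (cov.liftHomotopy_lifts K2 f2 e2) x)
  generalize hΦ : (fun x : I × E2 =>
      ((cov.liftHomotopy K1 f1 e1 x, cov.liftHomotopy K2 f2 e2 x) : E2)) = Φ at hΦc
  have hz' : ∀ z, Φ (0, z) = z := fun z => by rw [← hΦ]; exact hz z
  have hl' : ∀ x : I × E2, prj (Φ x) = h (x.1, prj x.2) := fun x => by rw [← hΦ]; exact hl x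
  refine ⟨Φ, hΦc, fun t z => hl' (t, z), hz', fun t z n => ?_⟩
  have hA : Continuous fun t : I => Φ (t, z + lat n) := hΦc.comp (by fun_prop)
  have hB : Continuous fun t : I => Φ (t, z) + lat n :=
    (hΦc.comp (by fun_prop : Continuous fun t : I => (t, z))).add continuous_const
  have key : ∀ t : I, prj (Φ (t, z + lat n)) = prj (Φ (t, z) + lat n) := fun t => by
    rw [prj_add, hl', hl']
    simp only [prj_add]
  have k1 := cov.eq_of_comp_eq (continuous_fst.comp hA) (continuous_fst.comp hB)
    (funext fun t => congrArg Prod.fst (key t)) 0 (by simp only [Function.comp, hz'])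
  have k2 := cov.eq_of_comp_eq (continuous_snd.comp hA) (continuous_snd.comp hB)
    (funext fun t => congrArg Prod.snd (key t)) 0 (by simp only [Function.comp, hz'])
  exact Prod.ext (congrFun k1 t) (congrFun k2 t)

/-- An equivariant lift of a bijection is bijective. -/
lemma bij_lift {F : E2 → E2} {φ : TT → TT} (hF : Equi F) (hφ : Function.Bijective φ)
    (hl : ∀ z, prj (F z) = φ (prj z)) : Function.Bijective F := by
  constructor
  · intro z w hzw
    have : prj z = prj w := hφ.1 (by rw [← hl, ← hl, hzw])
    obtain ⟨n, rfl⟩ := prj_eq this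
    rw [hF] at hzw
    have : lat n = 0 := by simpa using hzw
    rw [this, add_zero]
  · intro y
    obtain ⟨p, hp⟩ := hφ.2 (prj y)
    obtain ⟨z, rfl⟩ := prj_surj p
    rw [← hl] at hp
    obtain ⟨n, hn⟩ := prj_eq hp.symm
    exact ⟨z + lat n, by rw [hF, hn]⟩

/-- An equivariant bijection descends to a bijection. -/
lemma bij_descend {F : E2 → E2} {φ : TT → TT} (hF : Equi F) (hb : Function.Bijective F)
    (hl : ∀ z, prj (F z) = φ (prj z)) : Function.Bijective φ := by
  constructor
  · intro p q hpq
    obtain ⟨z, rfl⟩ := prj_surj p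
    obtain ⟨w, rfl⟩ := prj_surj q
    rw [← hl, ← hl] at hpq
    obtain ⟨n, hn⟩ := prj_eq hpq
    rw [← hF] at hn
    rw [hb.1 hn, prj_add]
  · intro q
    obtain ⟨w, rfl⟩ := prj_surj q
    obtain ⟨z, rfl⟩ := hb.2 w
    exact ⟨prj z, (hl z).symm⟩

/-- The final reduction. -/
lemma isotopy_of_homotopy (φ : TT ≃ₜ TT) (h : I × TT → TT) (hc : Continuous h)
    (h0 : ∀ p, h (0, p) = p) (h1 : ∀ p, h (1, p) = φ p) :
    ∃ G : ℝ × TT → TT, Continuous G ∧ (∀ p, G (0, p) = p) ∧ (∀ p, G (1, p) = φ p) ∧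
      ∀ t, Function.Bijective fun p => G (t, p) := by
  obtain ⟨Φ, hΦc, hl, hz, heq⟩ := exists_lift h hc h0
  have hFc : Continuous fun z => Φ (1, z) := hΦc.comp (by fun_prop)
  have hFe : Equi fun z => Φ (1, z) := fun z n => heq 1 z n
  have hFl : ∀ z, prj (Φ (1, z)) = φ (prj z) := fun z => by rw [hl, h1]
  have hFb := bij_lift hFe φ.bijective hFl
  obtain ⟨C, hC⟩ := Equi.exists_bound hFc hFe
  obtain ⟨Ψ, hΨc, hΨ0, hΨ1, hΨb, hΨe⟩ :=
    triv_of_equi (mkHomeo (fun z => Φ (1, z)) hFc hFb C hC) hFe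
  have hq : IsOpenQuotientMap (Prod.map (id : ℝ → ℝ) prj) := IsOpenQuotientMap.id.prodMap prj_open
  let s := Function.surjInv prj_surj
  have hs : ∀ p, prj (s p) = p := Function.surjInv_eq prj_surj
  have hG : ∀ t z, prj (Ψ (t, z)) = prj (Ψ (t, s (prj z))) := fun t z => by
    obtain ⟨n, hn⟩ := prj_eq (hs (prj z)).symm
    have := hΨe t (s (prj z)) n
    simp only [] at this
    conv_lhs => rw [hn, this, prj_add]
  refine ⟨fun x => prj (Ψ (x.1, s x.2)), ?_, fun p => ?_, fun p => ?_, fun t => ?_⟩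
  · rw [hq.isQuotientMap.continuous_iff]
    have : (fun x : ℝ × TT => prj (Ψ (x.1, s x.2))) ∘ Prod.map (id : ℝ → ℝ) prj
        = fun x => prj (Ψ x) := funext fun x => (hG x.1 x.2).symm
    rw [this]
    exact prj_cont.comp hΨc
  · simp only [hΨ0, hs]
  · simp only [hΨ1, mkHomeo_apply, hFl, hs]
  · exact bij_descend (hΨe t) (hΨb t) (hG t)

end TorusIso

open unitInterval

/-- Homotopic homeomorphisms of the torus `(ℝ/ℤ) × (ℝ/ℤ)` are isotopic. -/
theorem homotopic_homeomorphs_torus_isotopic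
    (f g : Homeomorph (AddCircle (1 : ℝ) × AddCircle (1 : ℝ))
      (AddCircle (1 : ℝ) × AddCircle (1 : ℝ)))
    (H : I × (AddCircle (1 : ℝ) × AddCircle (1 : ℝ)) →
      AddCircle (1 : ℝ) × AddCircle (1 : ℝ))
    (Hcont : Continuous H)
    (H0 : ∀ p, H (0, p) = f p)
    (H1 : ∀ p, H (1, p) = g p) :
    ∃ F : I × (AddCircle (1 : ℝ) × AddCircle (1 : ℝ)) →
        AddCircle (1 : ℝ) × AddCircle (1 : ℝ), Continuous F ∧
      (∀ p, F (0, p) = f p) ∧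
      (∀ p, F (1, p) = g p) ∧
      (∀ t : I, IsHomeomorph fun p => F (t, p)) := by
  have : Fact ((0 : ℝ) < 1) := ⟨one_pos⟩
  have hc : Continuous fun x : I × TorusIso.TT => H (σ x.1, g.symm x.2) :=
    Hcont.comp ((unitInterval.continuous_symm.comp continuous_fst).prodMk
      (g.symm.continuous.comp continuous_snd))
  obtain ⟨G, hGc, hG0, hG1, hGb⟩ := TorusIso.isotopy_of_homotopy (g.symm.trans f)
    (fun x => H (σ x.1, g.symm x.2)) hc
    (fun p => by simp only [unitInterval.symm_zero, H1, Homeomorph.apply_symm_apply])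
    (fun p => by simp only [unitInterval.symm_one, H0, Homeomorph.trans_apply])
  have hFc : Continuous fun x : I × TorusIso.TT => G (1 - (x.1 : ℝ), g x.2) :=
    hGc.comp ((continuous_const.sub (continuous_subtype_val.comp continuous_fst)).prodMk
      (g.continuous.comp continuous_snd))
  refine ⟨fun x => G (1 - (x.1 : ℝ), g x.2), hFc, fun p => ?_, fun p => ?_, fun t => ?_⟩
  · simp [hG1]
  · simp [hG0]
  · rw [isHomeomorph_iff_continuous_bijective]
    exact ⟨hFc.comp (continuous_const.prodMk continuous_id), (hGb (1 - (t : ℝ))).comp g.bijective⟩
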